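/- Let Ω ⊂ ℝ² be a bounded smooth simply connected domain, n ≥ 3, a ∈ ℝ, and λ₁(Ω) be the first Dirichlet eigenvalue of −Δ on Ω. Define u_a(x₁,x₂) = (cos(ax₁), sin(ax₁), 0, …, 0) ∈ ℝⁿ and let u_bd be the restriction of u_a to ∂Ω. Then: (1) if a² ≤ λ₁(Ω), u_a is the unique minimising harmonic map in 𝒜 ∩ H¹(Ω; 𝕊^{n−1}); (2) if a² > λ₁(Ω), every minimising harmonic map u ∈ 𝒜 ∩ H¹(Ω; 𝕊^{n−1}) satisfies u(Ω) ⊄ ℝ² × {0_{ℝ^{n−2}}}, u is unique up to orthogonal transformations R ∈ O(n) fixing every point of ℝ² × {0_{ℝ^{n−2}}}, and the harmonic map u_a is unstable (its second variation is negative in some direction). -/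

import Mathlib

open MeasureTheory Set Bornology

noncomputable section

/-- Euclidean dot product on `Fin n → ℝ`. -/
def dotR {n : ℕ} (a b : Fin n → ℝ) : ℝ := ∑ j, a j * b j

/-- Squared Euclidean norm on `Fin n → ℝ`. -/
def normSq {n : ℕ} (a : Fin n → ℝ) : ℝ := ∑ j, a j ^ 2

/-- Pointwise (Frobenius) inner product of gradients `∇u · ∇v`. -/
def gradDot {m n : ℕ} (u v : (Fin m → ℝ) → Fin n → ℝ) (x : Fin m → ℝ) : ℝ :=
  ∑ i, ∑ j, fderiv ℝ u x (Pi.single i (1:ℝ)) j * fderiv ℝ v x (Pi.single i (1:ℝ)) j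

/-- `|∇u|²`. -/
def gradSq {m n : ℕ} (u : (Fin m → ℝ) → Fin n → ℝ) (x : Fin m → ℝ) : ℝ := gradDot u u x

/-- Scalar version of `gradDot`. -/
def gradDotS {m : ℕ} (φ ψ : (Fin m → ℝ) → ℝ) (x : Fin m → ℝ) : ℝ :=
  ∑ i, fderiv ℝ φ x (Pi.single i (1:ℝ)) * fderiv ℝ ψ x (Pi.single i (1:ℝ))

/-- `|∇φ|²` for scalar `φ`. -/
def gradSqS {m : ℕ} (φ : (Fin m → ℝ) → ℝ) (x : Fin m → ℝ) : ℝ := gradDotS φ φ x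

/-- `W'`, the (one-sided) derivative of the potential on `(-∞, 1]`. -/
def Wd (W : ℝ → ℝ) : ℝ → ℝ := derivWithin W (Iic (1:ℝ))

/-- The Ginzburg–Landau energy `E_ε`. -/
def GLenergy {m n : ℕ} (W : ℝ → ℝ) (ε : ℝ) (Ω : Set (Fin m → ℝ))
    (u : (Fin m → ℝ) → Fin n → ℝ) : ℝ :=
  ∫ x in Ω, (gradSq u x / 2 + W (1 - normSq (u x)) / (2 * ε ^ 2))

/-- The admissible class `𝒜`: `H¹` maps attaining the boundary data `ubd` on `∂Ω`. -/
def Admissible {m n : ℕ} (Ω : Set (Fin m → ℝ)) (ubd u : (Fin m → ℝ) → Fin n → ℝ) : Prop :=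
  ContDiffOn ℝ 1 u Ω ∧ ContinuousOn u (closure Ω) ∧
  IntegrableOn (gradSq u) Ω ∧ IntegrableOn (fun x => normSq (u x)) Ω ∧
  EqOn u ubd (frontier Ω)

/-- `H¹₀(Ω; ℝⁿ)`. -/
def H10 {m n : ℕ} (Ω : Set (Fin m → ℝ)) (v : (Fin m → ℝ) → Fin n → ℝ) : Prop :=
  ContDiffOn ℝ 1 v Ω ∧ ContinuousOn v (closure Ω) ∧
  IntegrableOn (gradSq v) Ω ∧ IntegrableOn (fun x => normSq (v x)) Ω ∧
  EqOn v 0 (frontier Ω)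

/-- `H¹₀(Ω; ℝ)`. -/
def H10S {m : ℕ} (Ω : Set (Fin m → ℝ)) (φ : (Fin m → ℝ) → ℝ) : Prop :=
  ContDiffOn ℝ 1 φ Ω ∧ ContinuousOn φ (closure Ω) ∧
  IntegrableOn (gradSqS φ) Ω ∧ IntegrableOn (fun x => φ x ^ 2) Ω ∧
  EqOn φ 0 (frontier Ω)

/-- Critical point of `E_ε`: weak solution of `-Δu = ε⁻² u W'(1-|u|²)` in `Ω`. -/
def IsCritical {m n : ℕ} (W : ℝ → ℝ) (ε : ℝ) (Ω : Set (Fin m → ℝ))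
    (u : (Fin m → ℝ) → Fin n → ℝ) : Prop :=
  ∀ v, H10 Ω v →
    (∫ x in Ω, (gradDot u v x - 1 / ε ^ 2 * Wd W (1 - normSq (u x)) * dotR (u x) (v x))) = 0

/-- Minimiser of `E_ε` over `𝒜`. -/
def IsMinimiser {m n : ℕ} (W : ℝ → ℝ) (ε : ℝ) (Ω : Set (Fin m → ℝ))
    (ubd u : (Fin m → ℝ) → Fin n → ℝ) : Prop :=
  Admissible Ω ubd u ∧ ∀ v, Admissible Ω ubd v → GLenergy W ε Ω u ≤ GLenergy W ε Ω v

/-- Orthogonal transformation of `ℝⁿ` (element of `O(n)`). -/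
def IsOrth {n : ℕ} (R : (Fin n → ℝ) →ₗ[ℝ] (Fin n → ℝ)) : Prop :=
  Function.Bijective R ∧ ∀ a b, dotR (R a) (R b) = dotR a b

/-- Sphere-valued admissible maps `𝒜 ∩ H¹(Ω; 𝕊ⁿ⁻¹)`. -/
def SAdmissible {m n : ℕ} (Ω : Set (Fin m → ℝ)) (ubd u : (Fin m → ℝ) → Fin n → ℝ) : Prop :=
  Admissible Ω ubd u ∧ ∀ x ∈ closure Ω, normSq (u x) = 1

/-- Dirichlet energy. -/
def DirEnergy {m n : ℕ} (Ω : Set (Fin m → ℝ)) (u : (Fin m → ℝ) → Fin n → ℝ) : ℝ :=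
  ∫ x in Ω, gradSq u x / 2

/-- Minimising harmonic map with boundary data `ubd`. -/
def IsMinHarm {m n : ℕ} (Ω : Set (Fin m → ℝ)) (ubd u : (Fin m → ℝ) → Fin n → ℝ) : Prop :=
  SAdmissible Ω ubd u ∧ ∀ v, SAdmissible Ω ubd v → DirEnergy Ω u ≤ DirEnergy Ω v

/-- Weakly harmonic map: weak solution of `-Δu = |∇u|² u` in `Ω`. -/
def IsWeaklyHarm {m n : ℕ} (Ω : Set (Fin m → ℝ)) (u : (Fin m → ℝ) → Fin n → ℝ) : Prop :=
  ∀ v, H10 Ω v →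
    (∫ x in Ω, (gradDot u v x - gradSq u x * dotR (u x) (v x))) = 0

/-- `lam` is the first Dirichlet eigenvalue of `-Δ` on `Ω`, characterised as the optimal
constant in the Poincaré inequality. -/
def IsFirstEigenvalue {m : ℕ} (Ω : Set (Fin m → ℝ)) (lam : ℝ) : Prop :=
  (∀ φ : (Fin m → ℝ) → ℝ, H10S Ω φ →
    lam * ∫ x in Ω, φ x ^ 2 ≤ ∫ x in Ω, gradSqS φ x) ∧
  ∀ lam' : ℝ, (∀ φ : (Fin m → ℝ) → ℝ, H10S Ω φ →
    lam' * ∫ x in Ω, φ x ^ 2 ≤ ∫ x in Ω, gradSqS φ x) → lam' ≤ lam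

/-- The horizontal plane `ℝ² × {0} ⊂ ℝⁿ`. -/
def horizontal (n : ℕ) : Set (Fin n → ℝ) := {y | ∀ j : Fin n, 2 ≤ (j : ℕ) → y j = 0}

/-- The harmonic map `u_a(x₁, x₂) = (cos (a x₁), sin (a x₁), 0, …, 0)`. -/
def uA (n : ℕ) (a : ℝ) (x : Fin 2 → ℝ) : Fin n → ℝ :=
  fun j => if (j : ℕ) = 0 then Real.cos (a * x 0)
    else if (j : ℕ) = 1 then Real.sin (a * x 0) else 0

/-- The `i`-th partial derivative of a scalar function. -/
def pd {m : ℕ} (i : Fin m) (f : (Fin m → ℝ) → ℝ) (x : Fin m → ℝ) : ℝ :=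
  fderiv ℝ f x (Pi.single i (1 : ℝ))

/-- Scalar functions that are `C¹` in `Ω`, continuous up to the boundary and of finite energy. -/
def H1C {m : ℕ} (Ω : Set (Fin m → ℝ)) (f : (Fin m → ℝ) → ℝ) : Prop :=
  ContDiffOn ℝ 1 f Ω ∧ ContinuousOn f (closure Ω) ∧ IntegrableOn (gradSqS f) Ω

section PartialDerivatives

variable {m : ℕ} {f g : (Fin m → ℝ) → ℝ} {x : Fin m → ℝ} {i : Fin m}

theorem gradDotS_eq_sum_pd (f g : (Fin m → ℝ) → ℝ) (x : Fin m → ℝ) :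
    gradDotS f g x = ∑ i, pd i f x * pd i g x := rfl

theorem gradSqS_eq_sum_pd (f : (Fin m → ℝ) → ℝ) (x : Fin m → ℝ) :
    gradSqS f x = ∑ i, pd i f x ^ 2 := by
  simp [gradSqS, gradDotS_eq_sum_pd, sq]

theorem gradSqS_nonneg (f : (Fin m → ℝ) → ℝ) (x : Fin m → ℝ) : 0 ≤ gradSqS f x := by
  rw [gradSqS_eq_sum_pd]; positivity

theorem pd_add (hf : DifferentiableAt ℝ f x) (hg : DifferentiableAt ℝ g x) :
    pd i (fun y => f y + g y) x = pd i f x + pd i g x := by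
  simp [pd, fderiv_fun_add hf hg]

theorem pd_sub (hf : DifferentiableAt ℝ f x) (hg : DifferentiableAt ℝ g x) :
    pd i (fun y => f y - g y) x = pd i f x - pd i g x := by
  simp [pd, fderiv_fun_sub hf hg]

theorem pd_mul (hf : DifferentiableAt ℝ f x) (hg : DifferentiableAt ℝ g x) :
    pd i (fun y => f y * g y) x = f x * pd i g x + g x * pd i f x := by
  simp [pd, fderiv_fun_mul hf hg]

theorem pd_const_mul (c : ℝ) (hf : DifferentiableAt ℝ f x) :
    pd i (fun y => c * f y) x = c * pd i f x := by
  simp [pd, fderiv_const_mul hf]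

theorem pd_const (c : ℝ) : pd i (fun _ : Fin m → ℝ => c) x = 0 := by
  simp [pd]

theorem pd_comp {F : ℝ → ℝ} {d : ℝ} (hF : HasDerivAt F d (f x)) (hf : DifferentiableAt ℝ f x) :
    pd i (fun y => F (f y)) x = d * pd i f x := by
  have := (hF.comp_hasFDerivAt x hf.hasFDerivAt).fderiv
  simp only [pd]
  change (fderiv ℝ (F ∘ f) x) _ = _
  rw [this]; simp

theorem pd_congr {Ω : Set (Fin m → ℝ)} (hΩ : IsOpen Ω) (h : EqOn f g Ω) (hx : x ∈ Ω) :
    pd i f x = pd i g x := by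
  simp only [pd]
  rw [Filter.EventuallyEq.fderiv_eq (h.eventuallyEq_of_mem (hΩ.mem_nhds hx))]

theorem pd_sum {ι : Type*} (s : Finset ι) {F : ι → (Fin m → ℝ) → ℝ}
    (hF : ∀ k ∈ s, DifferentiableAt ℝ (F k) x) :
    pd i (fun y => ∑ k ∈ s, F k y) x = ∑ k ∈ s, pd i (F k) x := by
  simp [pd, fderiv_fun_sum hF]

theorem fderiv_eq_zero_of_pd (h : ∀ i, pd i f x = 0) : fderiv ℝ f x = 0 := by
  ext v
  rw [← Finset.univ_sum_single v, map_sum]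
  simp only [_root_.zero_apply]
  refine Finset.sum_eq_zero fun i _ => ?_
  have : Pi.single i (v i) = v i • (Pi.single i (1:ℝ) : Fin m → ℝ) := by
    rw [← Pi.single_smul]; simp
  rw [this, map_smul]
  have := h i
  simp only [pd] at this
  simp [this]

theorem abs_gradDotS_le (f g : (Fin m → ℝ) → ℝ) (x : Fin m → ℝ) :
    |gradDotS f g x| ≤ gradSqS f x + gradSqS g x := by
  rw [gradDotS_eq_sum_pd, gradSqS_eq_sum_pd, gradSqS_eq_sum_pd, ← Finset.sum_add_distrib]
  refine (Finset.abs_sum_le_sum_abs _ _).trans (Finset.sum_le_sum fun i _ => ?_)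
  rw [abs_le]; constructor <;> nlinarith [sq_nonneg (pd i f x - pd i g x),
    sq_nonneg (pd i f x + pd i g x)]

theorem gradSqS_add (hf : DifferentiableAt ℝ f x) (hg : DifferentiableAt ℝ g x) :
    gradSqS (fun y => f y + g y) x = gradSqS f x + 2 * gradDotS f g x + gradSqS g x := by
  simp only [gradSqS_eq_sum_pd, gradDotS_eq_sum_pd, pd_add hf hg, Finset.mul_sum,
    ← Finset.sum_add_distrib]
  exact Finset.sum_congr rfl fun i _ => by ring

theorem gradSqS_const_mul (c : ℝ) (hf : DifferentiableAt ℝ f x) :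
    gradSqS (fun y => c * f y) x = c ^ 2 * gradSqS f x := by
  simp only [gradSqS_eq_sum_pd, pd_const_mul c hf, Finset.mul_sum]
  exact Finset.sum_congr rfl fun i _ => by ring

theorem gradDotS_const_mul_right (c : ℝ) (hg : DifferentiableAt ℝ g x) :
    gradDotS f (fun y => c * g y) x = c * gradDotS f g x := by
  simp only [gradDotS_eq_sum_pd, pd_const_mul c hg, Finset.mul_sum]
  exact Finset.sum_congr rfl fun i _ => by ring

theorem gradSqS_comp {F : ℝ → ℝ} {d : ℝ} (hF : HasDerivAt F d (f x))
    (hf : DifferentiableAt ℝ f x) :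
    gradSqS (fun y => F (f y)) x = d ^ 2 * gradSqS f x := by
  simp only [gradSqS_eq_sum_pd, pd_comp hF hf, Finset.mul_sum]
  exact Finset.sum_congr rfl fun i _ => by ring

theorem gradSqS_congr {Ω : Set (Fin m → ℝ)} (hΩ : IsOpen Ω) (h : EqOn f g Ω) (hx : x ∈ Ω) :
    gradSqS f x = gradSqS g x := by
  simp only [gradSqS_eq_sum_pd, pd_congr hΩ h hx]

end PartialDerivatives

section VectorGradients

variable {m n : ℕ} {u v : (Fin m → ℝ) → Fin n → ℝ} {x : Fin m → ℝ}

theorem fderiv_apply_component (hu : DifferentiableAt ℝ u x) (i : Fin m) (j : Fin n) :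
    fderiv ℝ u x (Pi.single i (1 : ℝ)) j = pd i (fun y => u y j) x := by
  have := (hasFDerivAt_pi'.1 hu.hasFDerivAt j).fderiv
  simp only [pd, this]
  rfl

theorem gradDot_eq_sum (hu : DifferentiableAt ℝ u x) (hv : DifferentiableAt ℝ v x) :
    gradDot u v x = ∑ j, gradDotS (fun y => u y j) (fun y => v y j) x := by
  simp only [gradDot, gradDotS_eq_sum_pd, fderiv_apply_component hu, fderiv_apply_component hv]
  exact Finset.sum_comm

theorem gradSq_eq_sum (hu : DifferentiableAt ℝ u x) :
    gradSq u x = ∑ j, gradSqS (fun y => u y j) x := gradDot_eq_sum hu hu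

theorem gradSq_nonneg (u : (Fin m → ℝ) → Fin n → ℝ) (x : Fin m → ℝ) : 0 ≤ gradSq u x := by
  unfold gradSq gradDot
  exact Finset.sum_nonneg fun i _ => Finset.sum_nonneg fun j _ =>
    mul_self_nonneg (fderiv ℝ u x (Pi.single i (1 : ℝ)) j)

end VectorGradients

section Regularity

variable {m n : ℕ} {Ω : Set (Fin m → ℝ)} {f g : (Fin m → ℝ) → ℝ}

theorem ContDiffOn.differentiableAt_of_isOpen {E : Type*} [NormedAddCommGroup E] [NormedSpace ℝ E]
    {F : (Fin m → ℝ) → E} (hF : ContDiffOn ℝ 1 F Ω) (hΩ : IsOpen Ω) {x : Fin m → ℝ} (hx : x ∈ Ω) :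
    DifferentiableAt ℝ F x :=
  (hF.differentiableOn one_ne_zero).differentiableAt (hΩ.mem_nhds hx)

theorem continuousOn_pd (hΩ : IsOpen Ω) (hf : ContDiffOn ℝ 1 f Ω) (i : Fin m) :
    ContinuousOn (pd i f) Ω :=
  (hf.continuousOn_fderiv_of_isOpen hΩ le_rfl).clm_apply continuousOn_const

theorem continuousOn_gradDotS (hΩ : IsOpen Ω) (hf : ContDiffOn ℝ 1 f Ω) (hg : ContDiffOn ℝ 1 g Ω) :
    ContinuousOn (gradDotS f g) Ω :=
  continuousOn_finsetSum _ fun i _ => (continuousOn_pd hΩ hf i).mul (continuousOn_pd hΩ hg i)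

theorem continuousOn_gradSqS (hΩ : IsOpen Ω) (hf : ContDiffOn ℝ 1 f Ω) :
    ContinuousOn (gradSqS f) Ω := continuousOn_gradDotS hΩ hf hf

theorem ContinuousOn.integrableOn_of_bound {G H : (Fin m → ℝ) → ℝ} (hΩ : IsOpen Ω)
    (hG : ContinuousOn G Ω) (hH : IntegrableOn H Ω) (h : ∀ x ∈ Ω, |G x| ≤ H x) :
    IntegrableOn G Ω := by
  refine Integrable.mono' hH (hG.aestronglyMeasurable hΩ.measurableSet) ?_
  exact (ae_restrict_iff' hΩ.measurableSet).2 (Filter.Eventually.of_forall h)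

theorem exists_bound_of_continuousOn (hb : IsBounded Ω) (hf : ContinuousOn f (closure Ω)) :
    ∃ C, 0 < C ∧ ∀ x ∈ closure Ω, |f x| ≤ C := by
  obtain ⟨C, hC⟩ := (hb.isCompact_closure).exists_bound_of_continuousOn hf
  exact ⟨|C| + 1, by positivity, fun x hx => (hC x hx).trans (by linarith [le_abs_self C])⟩

theorem integrableOn_of_continuousOn_closure (hb : IsBounded Ω)
    (hf : ContinuousOn f (closure Ω)) : IntegrableOn f Ω :=
  (hf.integrableOn_compact hb.isCompact_closure).mono_set subset_closure

theorem integrableOn_gradDotS (hΩ : IsOpen Ω) (hf : H1C Ω f) (hg : H1C Ω g) :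
    IntegrableOn (gradDotS f g) Ω :=
  (continuousOn_gradDotS hΩ hf.1 hg.1).integrableOn_of_bound hΩ (hf.2.2.add hg.2.2)
    fun x _ => abs_gradDotS_le f g x

/-- Multiplying an integrable function, continuous in `Ω`, by a function continuous up to the
boundary keeps it integrable. -/
theorem integrableOn_mul_of_continuousOn (hΩ : IsOpen Ω) (hb : IsBounded Ω)
    (hf : ContinuousOn f (closure Ω)) (hgc : ContinuousOn g Ω) (hg : IntegrableOn g Ω) :
    IntegrableOn (fun x => f x * g x) Ω := by
  obtain ⟨C, hC, hfC⟩ := exists_bound_of_continuousOn hb hf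
  refine ((hf.mono subset_closure).mul hgc).integrableOn_of_bound hΩ (hg.abs.const_mul C) ?_
  intro x hx
  rw [abs_mul]
  exact mul_le_mul_of_nonneg_right (hfC x (subset_closure hx)) (abs_nonneg _)

theorem H1C.differentiableAt (hf : H1C Ω f) (hΩ : IsOpen Ω) {x : Fin m → ℝ} (hx : x ∈ Ω) :
    DifferentiableAt ℝ f x := hf.1.differentiableAt_of_isOpen hΩ hx

theorem H1C.add (hΩ : IsOpen Ω) (hf : H1C Ω f) (hg : H1C Ω g) : H1C Ω (fun x => f x + g x) := by
  refine ⟨hf.1.add hg.1, hf.2.1.add hg.2.1, ?_⟩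
  refine (continuousOn_gradSqS hΩ (hf.1.add hg.1)).integrableOn_of_bound hΩ
    ((hf.2.2.const_mul 3).add (hg.2.2.const_mul 3)) fun x hx => ?_
  rw [abs_of_nonneg (gradSqS_nonneg _ _),
    gradSqS_add (hf.differentiableAt hΩ hx) (hg.differentiableAt hΩ hx)]
  have := (abs_le.1 (abs_gradDotS_le f g x)).2
  simp only [Pi.add_apply]
  linarith

theorem H1C.mul (hΩ : IsOpen Ω) (hb : IsBounded Ω) (hf : H1C Ω f) (hg : H1C Ω g) :
    H1C Ω (fun x => f x * g x) := by
  refine ⟨hf.1.mul hg.1, hf.2.1.mul hg.2.1, ?_⟩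
  have h1 := (integrableOn_mul_of_continuousOn hΩ hb (hf.2.1.pow 2)
    (continuousOn_gradSqS hΩ hg.1) hg.2.2).const_mul 2
  have h2 := (integrableOn_mul_of_continuousOn hΩ hb (hg.2.1.pow 2)
    (continuousOn_gradSqS hΩ hf.1) hf.2.2).const_mul 2
  refine (continuousOn_gradSqS hΩ (hf.1.mul hg.1)).integrableOn_of_bound hΩ (h1.add h2)
    fun x hx => ?_
  rw [abs_of_nonneg (gradSqS_nonneg _ _)]
  simp only [gradSqS_eq_sum_pd, Pi.add_apply, Finset.mul_sum, ← Finset.sum_add_distrib]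
  refine Finset.sum_le_sum fun i _ => ?_
  rw [pd_mul (hf.differentiableAt hΩ hx) (hg.differentiableAt hΩ hx), Pi.pow_apply, Pi.pow_apply]
  nlinarith [sq_nonneg (f x * pd i g x - g x * pd i f x)]

theorem H1C.comp (hΩ : IsOpen Ω) (hb : IsBounded Ω) (hf : H1C Ω f) {F : ℝ → ℝ} {S : Set ℝ}
    (hS : IsOpen S) (hF : ContDiffOn ℝ 1 F S) (hfS : MapsTo f (closure Ω) S) :
    H1C Ω (fun x => F (f x)) := by
  have h1 : ContDiffOn ℝ 1 (fun x => F (f x)) Ω := hF.comp hf.1 (hfS.mono_left subset_closure)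
  refine ⟨h1, hF.continuousOn.comp hf.2.1 hfS, ?_⟩
  have h2 : ContinuousOn (fun x => (deriv F (f x)) ^ 2) (closure Ω) :=
    ((hF.continuousOn_deriv_of_isOpen hS le_rfl).comp hf.2.1 hfS).pow 2
  refine (continuousOn_gradSqS hΩ h1).integrableOn_of_bound hΩ
    (integrableOn_mul_of_continuousOn hΩ hb h2 (continuousOn_gradSqS hΩ hf.1) hf.2.2)
    fun x hx => ?_
  rw [abs_of_nonneg (gradSqS_nonneg _ _), gradSqS_comp _ (hf.differentiableAt hΩ hx)]
  exact ((hF.differentiableOn one_ne_zero).differentiableAt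
    (hS.mem_nhds (hfS (subset_closure hx)))).hasDerivAt

theorem H1C.of_contDiff (hb : IsBounded Ω) (hf : ContDiff ℝ 1 f) : H1C Ω f := by
  refine ⟨hf.contDiffOn, hf.continuous.continuousOn, ?_⟩
  refine integrableOn_of_continuousOn_closure hb ?_
  exact ((continuousOn_gradSqS isOpen_univ hf.contDiffOn).mono (subset_univ _))

theorem H1C.const_mul (hΩ : IsOpen Ω) (hb : IsBounded Ω) (hf : H1C Ω f) (c : ℝ) :
    H1C Ω (fun x => c * f x) :=
  (H1C.of_contDiff hb contDiff_const).mul hΩ hb hf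

theorem H1C.sub (hΩ : IsOpen Ω) (hb : IsBounded Ω) (hf : H1C Ω f) (hg : H1C Ω g) :
    H1C Ω (fun x => f x - g x) := by
  simpa [sub_eq_add_neg] using hf.add hΩ (hg.const_mul hΩ hb (-1))

theorem H1C.sum (hΩ : IsOpen Ω) (hb : IsBounded Ω) {ι : Type*} (s : Finset ι)
    {F : ι → (Fin m → ℝ) → ℝ} (hF : ∀ k ∈ s, H1C Ω (F k)) : H1C Ω (fun x => ∑ k ∈ s, F k x) := by
  classical
  induction s using Finset.induction_on with
  | empty => simpa using H1C.of_contDiff hb contDiff_const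
  | insert a s ha ih =>
    simp only [Finset.sum_insert ha]
    exact (hF a (Finset.mem_insert_self _ _)).add hΩ
      (ih fun k hk => hF k (Finset.mem_insert_of_mem hk))

theorem H10S.h1c (hf : H10S Ω f) : H1C Ω f := ⟨hf.1, hf.2.1, hf.2.2.1⟩

theorem H1C.h10S (hb : IsBounded Ω) (hf : H1C Ω f) (h0 : EqOn f 0 (frontier Ω)) : H10S Ω f :=
  ⟨hf.1, hf.2.1, hf.2.2, integrableOn_of_continuousOn_closure hb (hf.2.1.pow 2), h0⟩

end Regularity

section VectorRegularity

variable {m n : ℕ} {Ω : Set (Fin m → ℝ)} {ubd u : (Fin m → ℝ) → Fin n → ℝ}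

theorem contDiffOn_of_components (h : ∀ j, H1C Ω (fun x => u x j)) : ContDiffOn ℝ 1 u Ω :=
  contDiffOn_pi.2 fun j => (h j).1

theorem differentiableAt_of_components (hΩ : IsOpen Ω) (h : ∀ j, H1C Ω (fun x => u x j))
    {x : Fin m → ℝ} (hx : x ∈ Ω) : DifferentiableAt ℝ u x :=
  (contDiffOn_of_components h).differentiableAt_of_isOpen hΩ hx

theorem continuousOn_of_components (h : ∀ j, H1C Ω (fun x => u x j)) :
    ContinuousOn u (closure Ω) := continuousOn_pi.2 fun j => (h j).2.1

theorem continuousOn_gradSq (hΩ : IsOpen Ω) (h : ∀ j, H1C Ω (fun x => u x j)) :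
    ContinuousOn (gradSq u) Ω :=
  ContinuousOn.congr (continuousOn_finsetSum _ fun j _ => continuousOn_gradSqS hΩ (h j).1)
    fun _ hx => gradSq_eq_sum (differentiableAt_of_components hΩ h hx)

theorem integrableOn_gradSq (hΩ : IsOpen Ω) (h : ∀ j, H1C Ω (fun x => u x j)) :
    IntegrableOn (gradSq u) Ω := by
  refine IntegrableOn.congr_fun (f := fun x => ∑ j, gradSqS (fun y => u y j) x)
    (integrable_finsetSum _ fun j _ => (h j).2.2) (fun x hx => ?_) hΩ.measurableSet
  exact (gradSq_eq_sum (differentiableAt_of_components hΩ h hx)).symm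

theorem continuousOn_normSq {s : Set (Fin m → ℝ)} (h : ContinuousOn u s) :
    ContinuousOn (fun x => normSq (u x)) s :=
  continuousOn_finsetSum _ fun j _ => (continuousOn_pi.1 h j).pow 2

theorem admissible_of_components (hΩ : IsOpen Ω) (hb : IsBounded Ω)
    (h : ∀ j, H1C Ω (fun x => u x j)) (hbd : EqOn u ubd (frontier Ω)) : Admissible Ω ubd u :=
  ⟨contDiffOn_of_components h, continuousOn_of_components h, integrableOn_gradSq hΩ h,
    integrableOn_of_continuousOn_closure hb (continuousOn_normSq (continuousOn_of_components h)),
    hbd⟩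

theorem Admissible.component (hΩ : IsOpen Ω) (hu : Admissible Ω ubd u) (j : Fin n) :
    H1C Ω (fun x => u x j) := by
  have h1 : ContDiffOn ℝ 1 (fun x => u x j) Ω := contDiffOn_pi.1 hu.1 j
  refine ⟨h1, continuousOn_pi.1 hu.2.1 j, ?_⟩
  refine (continuousOn_gradSqS hΩ h1).integrableOn_of_bound hΩ hu.2.2.1 fun x hx => ?_
  rw [abs_of_nonneg (gradSqS_nonneg _ _),
    gradSq_eq_sum (hu.1.differentiableAt_of_isOpen hΩ hx)]
  exact Finset.single_le_sum (f := fun j => gradSqS (fun y => u y j) x)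
    (fun k _ => gradSqS_nonneg _ _) (Finset.mem_univ j)

end VectorRegularity

section CompactSupport

variable {m : ℕ} {Ω K : Set (Fin m → ℝ)} {f : (Fin m → ℝ) → ℝ}

theorem contDiff_of_eq_zero_off_compact (hΩ : IsOpen Ω) (hK : IsCompact K) (hKΩ : K ⊆ Ω)
    (hf : ContDiffOn ℝ 1 f Ω) (h0 : ∀ x, x ∉ K → f x = 0) : ContDiff ℝ 1 f := by
  rw [contDiff_iff_contDiffAt]
  intro x
  by_cases hx : x ∈ Ω
  · exact hf.contDiffAt (hΩ.mem_nhds hx)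
  · have : f =ᶠ[nhds x] fun _ => 0 := by
      filter_upwards [hK.isClosed.isOpen_compl.mem_nhds (fun h => hx (hKΩ h))] with y hy
      exact h0 y hy
    exact contDiffAt_const.congr_of_eventuallyEq this

theorem pd_eq_zero_off_compact (hK : IsCompact K) (h0 : ∀ x, x ∉ K → f x = 0) (i : Fin m)
    {x : Fin m → ℝ} (hx : x ∉ K) : pd i f x = 0 := by
  have : EqOn f (fun _ => 0) Kᶜ := fun y hy => h0 y hy
  rw [pd_congr hK.isClosed.isOpen_compl this hx, pd_const]

theorem integral_pd_eq_zero_of_compact (hΩ : IsOpen Ω) (hK : IsCompact K) (hKΩ : K ⊆ Ω)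
    (hf : ContDiffOn ℝ 1 f Ω) (h0 : ∀ x, x ∉ K → f x = 0) (i : Fin m) :
    ∫ x in Ω, pd i f x = 0 := by
  have hC := contDiff_of_eq_zero_off_compact hΩ hK hKΩ hf h0
  have hs : HasCompactSupport f := HasCompactSupport.intro hK h0
  rw [setIntegral_eq_integral_of_forall_compl_eq_zero
    (fun x hx => pd_eq_zero_off_compact hK h0 i (fun h => hx (hKΩ h)))]
  have hpc : Continuous (pd i f) := by
    have := continuousOn_pd isOpen_univ hC.contDiffOn i
    rwa [continuousOn_univ] at this
  have hps : HasCompactSupport (pd i f) :=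
    HasCompactSupport.intro hK fun x hx => pd_eq_zero_off_compact hK h0 i hx
  have := integral_mul_fderiv_eq_neg_fderiv_mul_of_integrable (μ := (volume : Measure (Fin m → ℝ)))
    (f := fun _ => (1 : ℝ)) (g := f) (v := Pi.single i (1 : ℝ)) (by simp)
    (by simpa using! hpc.integrable_of_hasCompactSupport hps)
    (by simpa using hC.continuous.integrable_of_hasCompactSupport hs)
    (fun x _ => differentiableAt_const _) (fun x _ => hC.differentiable one_ne_zero x)
  simpa [pd] using this

theorem h10S_of_compact (hΩ : IsOpen Ω) (hb : IsBounded Ω) (hK : IsCompact K) (hKΩ : K ⊆ Ω)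
    (hf : ContDiffOn ℝ 1 f Ω) (h0 : ∀ x, x ∉ K → f x = 0) : H10S Ω f := by
  refine (H1C.of_contDiff hb (contDiff_of_eq_zero_off_compact hΩ hK hKΩ hf h0)).h10S hb ?_
  intro x hx
  rw [hΩ.frontier_eq] at hx
  exact h0 x fun h => hx.2 (hKΩ h)

end CompactSupport

section Truncation

theorem deriv_smoothTransition_eq_zero {t : ℝ} (ht : t < 0 ∨ 1 < t) :
    deriv Real.smoothTransition t = 0 := by
  rcases ht with ht | ht
  · have : Real.smoothTransition =ᶠ[nhds t] fun _ => 0 := by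
      filter_upwards [isOpen_Iio.mem_nhds ht] with y hy
      exact Real.smoothTransition.zero_of_nonpos (le_of_lt hy)
    rw [this.deriv_eq]; simp
  · have : Real.smoothTransition =ᶠ[nhds t] fun _ => 1 := by
      filter_upwards [isOpen_Ioi.mem_nhds ht] with y hy
      exact Real.smoothTransition.one_of_one_le (le_of_lt hy)
    rw [this.deriv_eq]; simp

theorem exists_bound_deriv_smoothTransition :
    ∃ C, 0 ≤ C ∧ ∀ t, |deriv Real.smoothTransition t| ≤ C := by
  have hc : Continuous (deriv Real.smoothTransition) :=
    (Real.smoothTransition.contDiff (n := 1)).continuous_deriv le_rfl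
  obtain ⟨C, hC⟩ := isCompact_Icc.exists_bound_of_continuousOn (s := Icc (0 : ℝ) 1) hc.continuousOn
  refine ⟨|C|, abs_nonneg _, fun t => ?_⟩
  by_cases ht : t ∈ Icc (0 : ℝ) 1
  · exact (hC t ht).trans (le_abs_self C)
  · rw [mem_Icc, not_and_or, not_le, not_le] at ht
    rw [deriv_smoothTransition_eq_zero ht]
    simp

/-- A smooth truncation of the identity, vanishing on `[-δ, δ]`. -/
def trunc (δ t : ℝ) : ℝ := t * Real.smoothTransition ((t / δ) ^ 2 - 1)

theorem contDiff_trunc (δ : ℝ) : ContDiff ℝ 1 (trunc δ) := by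
  refine contDiff_id.mul (Real.smoothTransition.contDiff.comp ?_)
  exact ((contDiff_id.div_const δ).pow 2).sub contDiff_const

theorem trunc_eq_zero {δ t : ℝ} (hδ : 0 < δ) (ht : |t| ≤ δ) : trunc δ t = 0 := by
  have : (t / δ) ^ 2 ≤ 1 := by
    rw [sq_le_one_iff_abs_le_one, abs_div, abs_of_pos hδ]
    exact div_le_one_of_le₀ ht hδ.le
  rw [trunc, Real.smoothTransition.zero_of_nonpos (by linarith), mul_zero]

theorem trunc_eq_self {δ t : ℝ} (hδ : 0 < δ) (ht : 2 * δ ≤ |t|) : trunc δ t = t := by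
  have h1 : 2 ≤ |t / δ| := by rw [abs_div, abs_of_pos hδ, le_div_iff₀ hδ]; exact ht
  have : 4 ≤ (t / δ) ^ 2 := by rw [← sq_abs]; nlinarith
  rw [trunc, Real.smoothTransition.one_of_one_le (by linarith), mul_one]

theorem abs_trunc_le (δ t : ℝ) : |trunc δ t| ≤ |t| := by
  rw [trunc, abs_mul, abs_of_nonneg (Real.smoothTransition.nonneg _)]
  exact mul_le_of_le_one_right (abs_nonneg _) (Real.smoothTransition.le_one _)

theorem exists_bound_deriv_trunc : ∃ C, 0 ≤ C ∧ ∀ δ t : ℝ, |deriv (trunc δ) t| ≤ C := by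
  obtain ⟨C, hC0, hC⟩ := exists_bound_deriv_smoothTransition
  refine ⟨1 + 4 * C, by positivity, fun δ t => ?_⟩
  have h1 : HasDerivAt (fun t : ℝ => (t / δ) ^ 2 - 1) (2 * (t / δ) * (1 / δ)) t := by
    have := (((hasDerivAt_id t).div_const δ).pow 2).sub_const 1
    simpa using this
  have h2 : HasDerivAt Real.smoothTransition
      (deriv Real.smoothTransition ((t / δ) ^ 2 - 1)) ((t / δ) ^ 2 - 1) :=
    (Real.smoothTransition.contDiff (n := 1)).differentiable one_ne_zero _ |>.hasDerivAt
  have h3 : deriv (trunc δ) t = Real.smoothTransition ((t / δ) ^ 2 - 1) +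
      deriv Real.smoothTransition ((t / δ) ^ 2 - 1) * (2 * (t / δ) ^ 2) := by
    have := ((hasDerivAt_id t).mul (h2.comp t h1)).deriv
    change deriv (trunc δ) t = _ at this
    rw [this]; simp; ring
  rw [h3]
  refine (abs_add_le _ _).trans (add_le_add ?_ ?_)
  · rw [abs_of_nonneg (Real.smoothTransition.nonneg _)]; exact Real.smoothTransition.le_one _
  · by_cases h : 1 < (t / δ) ^ 2 - 1
    · rw [deriv_smoothTransition_eq_zero (Or.inr h)]; simpa using hC0
    · rw [abs_mul, abs_of_nonneg (a := 2 * (t / δ) ^ 2) (by positivity)]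
      have := hC ((t / δ) ^ 2 - 1)
      nlinarith [abs_nonneg (deriv Real.smoothTransition ((t / δ) ^ 2 - 1)), sq_nonneg (t / δ)]

theorem deriv_trunc_zero {δ : ℝ} (hδ : 0 < δ) : deriv (trunc δ) 0 = 0 := by
  have : trunc δ =ᶠ[nhds 0] fun _ => 0 := by
    filter_upwards [Metric.ball_mem_nhds (0 : ℝ) hδ] with y hy
    rw [mem_ball_zero_iff, Real.norm_eq_abs] at hy
    exact trunc_eq_zero hδ hy.le
  rw [this.deriv_eq]; simp

theorem deriv_trunc_eq_one {δ t : ℝ} (hδ : 0 < δ) (ht : 2 * δ < |t|) : deriv (trunc δ) t = 1 := by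
  have : trunc δ =ᶠ[nhds t] id := by
    filter_upwards [(isOpen_lt continuous_const continuous_abs).mem_nhds ht] with y hy
    exact trunc_eq_self hδ (le_of_lt hy)
  rw [this.deriv_eq]; simp

theorem tendsto_trunc_seq (t : ℝ) :
    ∀ᶠ k : ℕ in Filter.atTop, trunc (1 / ((k : ℝ) + 1)) t = t ∧
      deriv (trunc (1 / ((k : ℝ) + 1))) t = if t = 0 then 0 else 1 := by
  by_cases ht : t = 0
  · refine Filter.Eventually.of_forall fun k => ?_
    subst ht
    exact ⟨by simp [trunc], by
      rw [deriv_trunc_zero (Nat.one_div_pos_of_nat (α := ℝ) (n := k)), if_pos rfl]⟩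
  · have : Filter.Tendsto (fun k : ℕ => 2 * (1 / ((k : ℝ) + 1))) Filter.atTop (nhds (2 * 0)) :=
      tendsto_one_div_add_atTop_nhds_zero_nat.const_mul 2
    have h2 := this.eventually_lt_const (u := |t|) (by simpa using ht)
    filter_upwards [h2] with k hk
    have hk0 := Nat.one_div_pos_of_nat (α := ℝ) (n := k)
    exact ⟨trunc_eq_self hk0 hk.le, by rw [deriv_trunc_eq_one hk0 hk, if_neg ht]⟩

end Truncation

section BoundaryIntegrals

variable {m : ℕ} {Ω : Set (Fin m → ℝ)} {f : (Fin m → ℝ) → ℝ}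

/-- The compact set on which a function vanishing on `∂Ω` is at least `δ` in absolute value. -/
theorem isCompact_superlevel (hb : IsBounded Ω) (hf : ContinuousOn f (closure Ω)) (δ : ℝ) :
    IsCompact {x | x ∈ closure Ω ∧ δ ≤ |f x|} :=
  hb.isCompact_closure.of_isClosed_subset
    (hf.abs.preimage_isClosed_of_isClosed isClosed_closure isClosed_Ici) fun _ hx => hx.1

theorem superlevel_subset (hΩ : IsOpen Ω) (h0 : EqOn f 0 (frontier Ω)) {δ : ℝ} (hδ : 0 < δ) :
    {x | x ∈ closure Ω ∧ δ ≤ |f x|} ⊆ Ω := by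
  intro x hx
  by_contra h
  have : f x = 0 := h0 (by rw [hΩ.frontier_eq]; exact ⟨hx.1, h⟩)
  have := hx.2
  simp_all; linarith

/-- The gradient of a `C¹` function vanishes almost everywhere on its zero set. -/
theorem ae_pd_eq_zero_of_eq_zero (hΩ : IsOpen Ω) (hf : ContDiffOn ℝ 1 f Ω) (i : Fin m) :
    ∀ᵐ x, x ∈ Ω → f x = 0 → pd i f x = 0 := by
  set s : Set (Fin m → ℝ) := {x | x ∈ Ω → f x = 0 → pd i f x = 0} with hs
  have hsc : sᶜ = (Ω \ (Ω ∩ f ⁻¹' {0}ᶜ)) ∩ (Ω ∩ pd i f ⁻¹' {0}ᶜ) := by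
    ext x; simp [hs]; tauto
  have hms : MeasurableSet s := by
    rw [← MeasurableSet.compl_iff, hsc]
    refine (hΩ.measurableSet.diff ?_).inter ?_
    · exact (hf.continuousOn.isOpen_inter_preimage hΩ isOpen_compl_singleton).measurableSet
    · exact ((continuousOn_pd hΩ hf i).isOpen_inter_preimage hΩ isOpen_compl_singleton).measurableSet
  refine ae_mem_of_ae_add_linearMap_mem
    (LinearMap.toSpanSingleton ℝ (Fin m → ℝ) (Pi.single i (1 : ℝ))) volume volume hms fun y => ?_
  set ℓ : ℝ → (Fin m → ℝ) := fun t => y + t • Pi.single i (1 : ℝ) with hℓ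
  set T : Set ℝ := {t | ℓ t ∉ s} with hT
  have hTc : T.Countable := by
    refine (countable_setOfPred_isolated_right_within (s := T)).mono fun t ht => ?_
    refine mem_sep ht ?_
    simp only [hT, hs, mem_ofPred_eq, Classical.not_imp] at ht
    obtain ⟨h1, h2, h3⟩ := ht
    have hd : HasDerivAt ℓ (Pi.single i (1 : ℝ)) t := by
      have h := ((hasDerivAt_id t).smul_const (Pi.single i (1 : ℝ) : Fin m → ℝ)).const_add y
      rw [one_smul] at h
      exact h
    have hd2 : HasDerivAt (fun t => f (ℓ t)) (pd i f (ℓ t)) t :=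
      (hf.differentiableAt_of_isOpen hΩ h1).hasFDerivAt.comp_hasDerivAt t hd
    have he := hd2.eventually_ne (c := 0) h3
    rw [← Filter.eventually_false_iff_eq_bot]
    have he' := he.filter_mono (nhdsWithin_mono t (fun z hz => ne_of_gt hz.2) :
      nhdsWithin t (T ∩ Ioi t) ≤ nhdsWithin t {t}ᶜ)
    filter_upwards [he', self_mem_nhdsWithin] with z hz hzT
    have := hzT.1
    simp only [hT, hs, mem_ofPred_eq, Classical.not_imp] at this
    exact hz this.2.1
  filter_upwards [hTc.ae_notMem volume] with t ht
  by_contra hcon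
  exact ht hcon

theorem trunc_indicator_eq_zero {δ : ℝ} (hδ : 0 < δ) {x : Fin m → ℝ}
    (hx : x ∉ {x | x ∈ closure Ω ∧ δ ≤ |f x|}) :
    Ω.indicator (fun x => trunc δ (f x)) x = 0 := by
  by_cases h : x ∈ Ω
  · rw [indicator_of_mem h]
    refine trunc_eq_zero hδ ?_
    by_contra hc
    exact hx ⟨subset_closure h, (not_le.1 hc).le⟩
  · exact indicator_of_notMem h _

theorem integrableOn_pd (hΩ : IsOpen Ω) (hb : IsBounded Ω) (hf : H1C Ω f) (i : Fin m) :
    IntegrableOn (pd i f) Ω := by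
  have hc : IntegrableOn (fun _ : Fin m → ℝ => (1 : ℝ)) Ω :=
    integrableOn_of_continuousOn_closure hb continuousOn_const
  refine (continuousOn_pd hΩ hf.1 i).integrableOn_of_bound hΩ (hc.add hf.2.2) fun x _ => ?_
  have : pd i f x ^ 2 ≤ gradSqS f x := by
    rw [gradSqS_eq_sum_pd]
    exact Finset.single_le_sum (f := fun i => pd i f x ^ 2) (fun _ _ => sq_nonneg _)
      (Finset.mem_univ i)
  simp only [Pi.add_apply]
  nlinarith [sq_abs (pd i f x), sq_nonneg (|pd i f x| - 1)]

theorem integral_pd_eq_zero (hΩ : IsOpen Ω) (hb : IsBounded Ω) (hf : H10S Ω f) (i : Fin m) :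
    ∫ x in Ω, pd i f x = 0 := by
  obtain ⟨C, hC0, hC⟩ := exists_bound_deriv_trunc
  have hintg := integrableOn_pd hΩ hb hf.h1c i
  have hae : ∀ᵐ x ∂(volume.restrict Ω), f x = 0 → pd i f x = 0 :=
    (ae_restrict_iff' hΩ.measurableSet).2 (ae_pd_eq_zero_of_eq_zero hΩ hf.1 i)
  have hlim := tendsto_integral_of_dominated_convergence (μ := volume.restrict Ω)
    (F := fun (k : ℕ) x => deriv (trunc (1 / ((k : ℝ) + 1))) (f x) * pd i f x)
    (f := pd i f) (fun x => C * |pd i f x|) (fun k => ?_) (hintg.abs.const_mul C) (fun k => ?_) ?_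
  · have hz : ∀ k : ℕ, ∫ x in Ω, deriv (trunc (1 / ((k : ℝ) + 1))) (f x) * pd i f x = 0 := by
      intro k
      have hk0 := Nat.one_div_pos_of_nat (α := ℝ) (n := k)
      have hg : ContDiffOn ℝ 1 (Ω.indicator fun x => trunc (1 / ((k : ℝ) + 1)) (f x)) Ω :=
        ((contDiff_trunc _).comp_contDiffOn hf.1).congr fun x hx => indicator_of_mem hx _
      rw [← integral_pd_eq_zero_of_compact hΩ (isCompact_superlevel hb hf.2.1 _)
        (superlevel_subset hΩ hf.2.2.2.2 hk0) hg (fun x hx => trunc_indicator_eq_zero hk0 hx) i]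
      refine setIntegral_congr_fun hΩ.measurableSet fun x hx => ?_
      rw [pd_congr hΩ (fun y hy => indicator_of_mem hy _) hx,
        pd_comp (((contDiff_trunc _).differentiable one_ne_zero _).hasDerivAt)
          (hf.h1c.differentiableAt hΩ hx)]
    simp only [hz] at hlim
    exact (tendsto_nhds_unique hlim tendsto_const_nhds)
  · refine ContinuousOn.aestronglyMeasurable ?_ hΩ.measurableSet
    exact (((contDiff_trunc _).continuous_deriv le_rfl).comp_continuousOn hf.1.continuousOn).mul
      (continuousOn_pd hΩ hf.1 i)
  · refine Filter.Eventually.of_forall fun x => ?_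
    rw [norm_mul, Real.norm_eq_abs, Real.norm_eq_abs]
    exact mul_le_mul_of_nonneg_right (hC _ _) (abs_nonneg _)
  · filter_upwards [hae] with x hx
    refine tendsto_const_nhds.congr' ?_
    filter_upwards [tendsto_trunc_seq (f x)] with k hk
    rw [hk.2]
    split_ifs with h
    · simp [hx h]
    · simp

end BoundaryIntegrals

section Comparison

variable {m n : ℕ} {Ω : Set (Fin m → ℝ)} {u W ubd : (Fin m → ℝ) → Fin n → ℝ}

theorem SAdmissible.component (hΩ : IsOpen Ω) (hu : SAdmissible Ω ubd u) (j : Fin n) :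
    H1C Ω (fun x => u x j) := hu.1.component hΩ j

theorem normSq_nonneg (y : Fin n → ℝ) : 0 ≤ normSq y := Finset.sum_nonneg fun _ _ => sq_nonneg _

theorem H1C.normSq (hΩ : IsOpen Ω) (hb : IsBounded Ω) (h : ∀ j, H1C Ω (fun x => u x j)) :
    H1C Ω (fun x => normSq (u x)) := by
  unfold _root_.normSq
  simp only [sq]
  exact H1C.sum hΩ hb _ fun j _ => (h j).mul hΩ hb (h j)

theorem sum_mul_pd_eq_zero (hΩ : IsOpen Ω) (h : ∀ j, H1C Ω (fun x => u x j))
    (h1 : ∀ x ∈ Ω, normSq (u x) = 1) {x : Fin m → ℝ} (hx : x ∈ Ω) (i : Fin m) :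
    ∑ j, u x j * pd i (fun y => u y j) x = 0 := by
  have e1 : pd i (fun y => ∑ j, u y j * u y j) x = 0 := by
    rw [pd_congr hΩ (g := fun _ => 1) (fun y hy => ?_) hx, pd_const]
    rw [← h1 y hy, normSq]
    exact Finset.sum_congr rfl fun j _ => (sq _).symm
  rw [pd_sum _ fun j _ => ((h j).differentiableAt hΩ hx).fun_mul
    ((h j).differentiableAt hΩ hx)] at e1
  have e2 : ∀ j, pd i (fun y => u y j * u y j) x = 2 * (u x j * pd i (fun y => u y j) x) := by
    intro j
    rw [pd_mul ((h j).differentiableAt hΩ hx) ((h j).differentiableAt hΩ hx)]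
    ring
  simp only [e2, ← Finset.mul_sum] at e1
  linarith

theorem gradSq_eq_sum_pd (hu : DifferentiableAt ℝ u x) :
    gradSq u x = ∑ i, ∑ j, pd i (fun y => u y j) x ^ 2 := by
  rw [gradSq_eq_sum hu, Finset.sum_comm]
  simp only [gradSqS_eq_sum_pd]

/-- Radial projection onto the sphere of a map that does not vanish. -/
theorem exists_sAdmissible_projection (hΩ : IsOpen Ω) (hb : IsBounded Ω)
    (hW : ∀ j, H1C Ω (fun x => W x j)) (hpos : ∀ x ∈ closure Ω, 0 < normSq (W x))
    (hbd : EqOn W ubd (frontier Ω)) (h1 : ∀ x ∈ frontier Ω, normSq (ubd x) = 1) :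
    ∃ U, SAdmissible Ω ubd U ∧ ∀ x ∈ Ω, gradSq U x * normSq (W x) ≤ gradSq W x := by
  have hN := H1C.normSq hΩ hb hW
  have hsq : ContDiffOn ℝ 1 Real.sqrt (Ioi 0) := fun s hs =>
    (Real.contDiffAt_sqrt (ne_of_gt hs)).contDiffWithinAt
  have hρ : H1C Ω (fun x => Real.sqrt (normSq (W x))) := hN.comp hΩ hb isOpen_Ioi hsq hpos
  have hr : H1C Ω (fun x => (Real.sqrt (normSq (W x)))⁻¹) := by
    refine hN.comp hΩ hb isOpen_Ioi (F := fun s => (Real.sqrt s)⁻¹) (hsq.inv fun s hs => ?_) hpos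
    exact (Real.sqrt_pos.2 hs).ne'
  set ρ : (Fin m → ℝ) → ℝ := fun x => Real.sqrt (normSq (W x)) with hρd
  have hρpos : ∀ x ∈ closure Ω, 0 < ρ x := fun x hx => Real.sqrt_pos.2 (hpos x hx)
  have hρsq : ∀ x ∈ closure Ω, ρ x ^ 2 = normSq (W x) := fun x hx => Real.sq_sqrt (hpos x hx).le
  set U : (Fin m → ℝ) → Fin n → ℝ := fun x j => W x j * (ρ x)⁻¹ with hU
  have hUc : ∀ j, H1C Ω (fun x => U x j) := fun j => (hW j).mul hΩ hb hr
  have hU1 : ∀ x ∈ closure Ω, normSq (U x) = 1 := by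
    intro x hx
    have e : normSq (U x) = normSq (W x) * ((ρ x)⁻¹) ^ 2 := by
      simp only [normSq, hU, mul_pow, Finset.sum_mul]
    rw [e, ← hρsq x hx, ← mul_pow, mul_inv_cancel₀ (hρpos x hx).ne', one_pow]
  have hWU : ∀ j, EqOn (fun x => W x j) (fun x => ρ x * U x j) Ω := by
    intro j x hx
    have := (hρpos x (subset_closure hx)).ne'
    simp only [hU]
    field_simp
  refine ⟨U, ⟨admissible_of_components hΩ hb hUc fun x hx => ?_, hU1⟩, fun x hx => ?_⟩
  · have : ρ x = 1 := by
      simp only [hρd]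
      rw [hbd hx, h1 x hx, Real.sqrt_one]
    ext j
    simp only [hU, this, inv_one, mul_one, hbd hx]
  · rw [gradSq_eq_sum_pd (differentiableAt_of_components hΩ hUc hx),
      gradSq_eq_sum_pd (differentiableAt_of_components hΩ hW hx), Finset.sum_mul]
    refine Finset.sum_le_sum fun i _ => ?_
    have e : ∀ j, pd i (fun y => W y j) x ^ 2 = pd i (fun y => U y j) x ^ 2 * ρ x ^ 2
        + 2 * ρ x * pd i ρ x * (U x j * pd i (fun y => U y j) x) + U x j ^ 2 * pd i ρ x ^ 2 := by
      intro j
      rw [pd_congr hΩ (hWU j) hx, pd_mul (hρ.differentiableAt hΩ hx)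
        ((hUc j).differentiableAt hΩ hx)]
      ring
    simp only [e, Finset.sum_add_distrib, ← Finset.mul_sum, ← Finset.sum_mul]
    rw [sum_mul_pd_eq_zero hΩ hUc (fun y hy => hU1 y (subset_closure hy)) hx i,
      hρsq x (subset_closure hx)]
    have := hU1 x (subset_closure hx)
    rw [normSq] at this
    rw [this]
    nlinarith [sq_nonneg (pd i ρ x)]

theorem IsMinHarm.integral_gradSq_le_sAdmissible {v : (Fin m → ℝ) → Fin n → ℝ}
    (hu : IsMinHarm Ω ubd u) (hv : SAdmissible Ω ubd v) :
    ∫ x in Ω, gradSq u x ≤ ∫ x in Ω, gradSq v x := by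
  have h := hu.2 v hv
  simp only [DirEnergy, integral_div] at h
  linarith

/-- Comparison of a minimising map with non-vanishing competitors, not necessarily of unit
length. -/
theorem IsMinHarm.integral_gradSq_le (hu : IsMinHarm Ω ubd u) (hΩ : IsOpen Ω) (hb : IsBounded Ω)
    (hW : ∀ j, H1C Ω (fun x => W x j)) (hpos : ∀ x ∈ closure Ω, 0 < normSq (W x))
    (hbd : EqOn W u (frontier Ω)) {G : (Fin m → ℝ) → ℝ} (hG : IntegrableOn G Ω)
    (h : ∀ x ∈ Ω, gradSq W x ≤ G x * normSq (W x)) :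
    ∫ x in Ω, gradSq u x ≤ ∫ x in Ω, G x := by
  have hub : EqOn u ubd (frontier Ω) := hu.1.1.2.2.2.2
  obtain ⟨U, hU, hUle⟩ := exists_sAdmissible_projection hΩ hb hW hpos
    (fun x hx => (hbd hx).trans (hub hx))
    (fun x hx => by rw [← hub hx]; exact hu.1.2 x (frontier_subset_closure hx))
  refine (hu.integral_gradSq_le_sAdmissible hU).trans
    (setIntegral_mono_on hU.1.2.2.1 hG hΩ.measurableSet fun x hx => ?_)
  exact le_of_mul_le_mul_right ((hUle x hx).trans (h x hx)) (hpos x (subset_closure hx))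

end Comparison

section EulerLagrange

variable {m n : ℕ} {Ω : Set (Fin m → ℝ)} {u η ubd : (Fin m → ℝ) → Fin n → ℝ}

theorem first_variation_bound {g d e s q t M : ℝ} (hg : 0 ≤ g) (he : 0 ≤ e) (hd : |d| ≤ g + e)
    (hs : |s| ≤ M) (hq : 0 ≤ q) (ht : |t| ≤ 1) (htM : 4 * M * |t| ≤ 1)
    (hN : 0 ≤ g + 2 * t * d + t ^ 2 * e) :
    g + 2 * t * d + t ^ 2 * e ≤ (g + 2 * t * (d - g * s) +
      t ^ 2 * ((1 + 6 * M + 24 * M ^ 2) * (g + e))) * (1 + 2 * t * s + t ^ 2 * q) := by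
  have hM : 0 ≤ M := (abs_nonneg s).trans hs
  set N := g + 2 * t * d + t ^ 2 * e with hNd
  set x := 2 * t * s with hxd
  have hx : -(1 / 2) ≤ x := by
    have h1 : |t * s| ≤ |t| * M := by
      rw [abs_mul]; exact mul_le_mul_of_nonneg_left hs (abs_nonneg _)
    have := neg_abs_le (t * s)
    simp only [hxd]; nlinarith
  have ht2 : t ^ 2 ≤ 1 := by rw [← sq_abs]; nlinarith [abs_nonneg t]
  have hNle : N ≤ 3 * (g + e) := by
    have h1 : t * d ≤ g + e := by
      calc t * d ≤ |t * d| := le_abs_self _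
        _ = |t| * |d| := abs_mul _ _
        _ ≤ 1 * (g + e) := mul_le_mul ht hd (abs_nonneg _) zero_le_one
        _ = g + e := one_mul _
    simp only [hNd]; nlinarith
  have hs2 : s ^ 2 ≤ M ^ 2 := by rw [← sq_abs s]; exact pow_le_pow_left₀ (abs_nonneg _) hs 2
  have k1 : -(s * d) ≤ M * (g + e) := by
    calc -(s * d) ≤ |s * d| := neg_le_abs _
      _ = |s| * |d| := abs_mul _ _
      _ ≤ M * (g + e) := mul_le_mul hs hd (abs_nonneg _) hM
  have k2 : -(t * s * e) ≤ M * (g + e) := by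
    have : -(t * s) ≤ M := by
      calc -(t * s) ≤ |t * s| := neg_le_abs _
        _ = |t| * |s| := abs_mul _ _
        _ ≤ 1 * M := mul_le_mul ht hs (abs_nonneg _) zero_le_one
        _ = M := one_mul _
    nlinarith
  have k3 : s ^ 2 * N ≤ M ^ 2 * (3 * (g + e)) := mul_le_mul hs2 hNle hN (sq_nonneg _)
  set G := g + 2 * t * (d - g * s) + t ^ 2 * ((1 + 6 * M + 24 * M ^ 2) * (g + e)) with hGd
  have hG : N * (1 - x + 2 * x ^ 2) ≤ G := by
    have e1 : N * (1 - x + 2 * x ^ 2) = g + 2 * t * (d - g * s) +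
        t ^ 2 * (e + 4 * (-(s * d)) + 2 * (-(t * s * e)) + 8 * (s ^ 2 * N)) := by
      simp only [hNd, hxd]; ring
    rw [e1, hGd]
    gcongr
    nlinarith
  have hG0 : 0 ≤ G := le_trans (mul_nonneg hN (by nlinarith [sq_nonneg (x - 1)])) hG
  calc N ≤ N * (1 - x + 2 * x ^ 2) * (1 + x) := by
        have : N * (1 - x + 2 * x ^ 2) * (1 + x) = N + N * (x ^ 2 * (1 + 2 * x)) := by ring
        rw [this]
        have : 0 ≤ N * (x ^ 2 * (1 + 2 * x)) :=
          mul_nonneg hN (mul_nonneg (sq_nonneg _) (by linarith))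
        linarith
    _ ≤ G * (1 + x) := mul_le_mul_of_nonneg_right hG (by linarith)
    _ ≤ G * (1 + x + t ^ 2 * q) := by
        refine mul_le_mul_of_nonneg_left ?_ hG0
        nlinarith [mul_nonneg (sq_nonneg t) hq]

theorem eq_zero_of_two_sided_bound {c b t₀ : ℝ} (ht₀ : 0 < t₀)
    (h : ∀ t, |t| ≤ t₀ → 0 ≤ t * c + t ^ 2 * b) : c = 0 := by
  by_contra hc
  set s := min t₀ (|c| / (2 * (|b| + 1))) with hs
  have hcpos : 0 < |c| := abs_pos.2 hc
  have hb1 : (0 : ℝ) < 2 * (|b| + 1) := by positivity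
  have hspos : 0 < s := lt_min ht₀ (div_pos hcpos hb1)
  have hs2 : s * (2 * (|b| + 1)) ≤ |c| := by
    rw [← le_div_iff₀ hb1]; exact min_le_right _ _
  have hsb : s * b ≤ s * |b| := mul_le_mul_of_nonneg_left (le_abs_self b) hspos.le
  rcases lt_or_gt_of_ne hc with hneg | hpos
  · have := h s (by rw [abs_of_pos hspos]; exact min_le_left _ _)
    rw [abs_of_neg hneg] at hs2 hcpos
    nlinarith
  · have := h (-s) (by rw [abs_neg, abs_of_pos hspos]; exact min_le_left _ _)
    rw [abs_of_pos hpos] at hs2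
    nlinarith

theorem abs_gradDot_le (hu : DifferentiableAt ℝ u x) (hη : DifferentiableAt ℝ η x) :
    |gradDot u η x| ≤ gradSq u x + gradSq η x := by
  rw [gradDot_eq_sum hu hη, gradSq_eq_sum hu, gradSq_eq_sum hη, ← Finset.sum_add_distrib]
  exact (Finset.abs_sum_le_sum_abs _ _).trans (Finset.sum_le_sum fun j _ => abs_gradDotS_le _ _ _)

theorem continuousOn_gradDot (hΩ : IsOpen Ω) (hu : ∀ j, H1C Ω (fun x => u x j))
    (hη : ∀ j, H1C Ω (fun x => η x j)) : ContinuousOn (gradDot u η) Ω :=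
  ContinuousOn.congr
    (continuousOn_finsetSum _ fun j _ => continuousOn_gradDotS hΩ (hu j).1 (hη j).1)
    fun _ hx => gradDot_eq_sum (differentiableAt_of_components hΩ hu hx)
      (differentiableAt_of_components hΩ hη hx)

theorem integrableOn_gradDot (hΩ : IsOpen Ω) (hu : ∀ j, H1C Ω (fun x => u x j))
    (hη : ∀ j, H1C Ω (fun x => η x j)) : IntegrableOn (gradDot u η) Ω :=
  (continuousOn_gradDot hΩ hu hη).integrableOn_of_bound hΩ
    ((integrableOn_gradSq hΩ hu).add (integrableOn_gradSq hΩ hη)) fun _ hx =>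
      abs_gradDot_le (differentiableAt_of_components hΩ hu hx)
        (differentiableAt_of_components hΩ hη hx)

theorem continuousOn_dotR {s : Set (Fin m → ℝ)} (hu : ContinuousOn u s) (hη : ContinuousOn η s) :
    ContinuousOn (fun x => dotR (u x) (η x)) s :=
  continuousOn_finsetSum _ fun j _ => (continuousOn_pi.1 hu j).mul (continuousOn_pi.1 hη j)

theorem gradSq_add_smul (hu : ∀ j, DifferentiableAt ℝ (fun y => u y j) x)
    (hη : ∀ j, DifferentiableAt ℝ (fun y => η y j) x) (t : ℝ) :
    gradSq (fun y j => u y j + t * η y j) x =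
      gradSq u x + 2 * t * gradDot u η x + t ^ 2 * gradSq η x := by
  have hu' : DifferentiableAt ℝ u x := differentiableAt_pi.2 hu
  have hη' : DifferentiableAt ℝ η x := differentiableAt_pi.2 hη
  rw [gradSq_eq_sum (differentiableAt_pi.2 fun j => (hu j).fun_add ((hη j).const_mul t)),
    gradSq_eq_sum hu', gradSq_eq_sum hη', gradDot_eq_sum hu' hη', Finset.mul_sum, Finset.mul_sum,
    ← Finset.sum_add_distrib, ← Finset.sum_add_distrib]
  refine Finset.sum_congr rfl fun j _ => ?_
  rw [gradSqS_add (hu j) ((hη j).const_mul t), gradDotS_const_mul_right t (hη j),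
    gradSqS_const_mul t (hη j)]
  ring

theorem normSq_add_smul (y z : Fin n → ℝ) (t : ℝ) :
    normSq (fun j => y j + t * z j) = normSq y + 2 * t * dotR y z + t ^ 2 * normSq z := by
  simp only [normSq, dotR, Finset.mul_sum, ← Finset.sum_add_distrib]
  exact Finset.sum_congr rfl fun j _ => by ring

theorem integrableOn_gradSq_mul_dotR (hΩ : IsOpen Ω) (hb : IsBounded Ω)
    (hu : ∀ j, H1C Ω (fun x => u x j)) (hη : ∀ j, H1C Ω (fun x => η x j)) :
    IntegrableOn (fun x => gradSq u x * dotR (u x) (η x)) Ω := by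
  have := integrableOn_mul_of_continuousOn hΩ hb
    (continuousOn_dotR (continuousOn_of_components hu) (continuousOn_of_components hη))
    (continuousOn_gradSq hΩ hu) (integrableOn_gradSq hΩ hu)
  exact this.congr (Filter.Eventually.of_forall fun x => mul_comm _ _)

theorem integral_add_mul_add_mul {f g h : (Fin m → ℝ) → ℝ} (hf : IntegrableOn f Ω)
    (hg : IntegrableOn g Ω) (hh : IntegrableOn h Ω) (s t : ℝ) :
    ∫ x in Ω, (f x + s * g x + t * h x) =
      (∫ x in Ω, f x) + s * (∫ x in Ω, g x) + t * ∫ x in Ω, h x := by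
  have e := integral_add (hf.add (hg.const_mul s)) (hh.const_mul t)
  have e' := integral_add hf (hg.const_mul s)
  simp only [integral_const_mul] at e e'
  rw [← e']
  exact e

/-- Minimising harmonic maps are weakly harmonic. -/
theorem IsMinHarm.euler_lagrange (hu : IsMinHarm Ω ubd u) (hΩ : IsOpen Ω) (hb : IsBounded Ω)
    (hη : ∀ j, H1C Ω (fun x => η x j)) (h0 : EqOn η 0 (frontier Ω)) :
    ∫ x in Ω, (gradDot u η x - gradSq u x * dotR (u x) (η x)) = 0 := by
  have huc := fun j => hu.1.component hΩ j
  have hsc := continuousOn_dotR (continuousOn_of_components huc) (continuousOn_of_components hη)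
  obtain ⟨M, hM0, hM⟩ := exists_bound_of_continuousOn hb hsc
  have hi1 : IntegrableOn (fun x => gradDot u η x - gradSq u x * dotR (u x) (η x)) Ω :=
    (integrableOn_gradDot hΩ huc hη).sub (integrableOn_gradSq_mul_dotR hΩ hb huc hη)
  have hi2 : IntegrableOn (fun x => (1 + 6 * M + 24 * M ^ 2) * (gradSq u x + gradSq η x)) Ω :=
    ((integrableOn_gradSq hΩ huc).add (integrableOn_gradSq hΩ hη)).const_mul _
  have h4M : (0 : ℝ) < 4 * M := by linarith
  suffices h : 2 * ∫ x in Ω, (gradDot u η x - gradSq u x * dotR (u x) (η x)) = 0 by linarith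
  refine eq_zero_of_two_sided_bound (t₀ := min 1 (1 / (4 * M)))
    (b := ∫ x in Ω, (1 + 6 * M + 24 * M ^ 2) * (gradSq u x + gradSq η x))
    (lt_min one_pos (one_div_pos.2 h4M)) fun t ht => ?_
  have ht1 : |t| ≤ 1 := ht.trans (min_le_left _ _)
  have htM : 4 * M * |t| ≤ 1 := by
    have := ht.trans (min_le_right _ _)
    rw [le_div_iff₀ h4M] at this
    linarith
  have hnorm : ∀ x ∈ closure Ω, normSq (fun j => u x j + t * η x j) =
      1 + 2 * t * dotR (u x) (η x) + t ^ 2 * normSq (η x) := fun x hx => by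
    rw [normSq_add_smul, hu.1.2 x hx]
  have key := hu.integral_gradSq_le hΩ hb (W := fun x j => u x j + t * η x j)
    (G := fun x => gradSq u x + 2 * t * (gradDot u η x - gradSq u x * dotR (u x) (η x)) +
      t ^ 2 * ((1 + 6 * M + 24 * M ^ 2) * (gradSq u x + gradSq η x)))
    (fun j => (huc j).add hΩ ((hη j).const_mul hΩ hb t)) (fun x hx => ?_) (fun x hx => ?_)
    (((integrableOn_gradSq hΩ huc).add (hi1.const_mul _)).add (hi2.const_mul _))
    (fun x hx => ?_)
  · rw [integral_add_mul_add_mul (integrableOn_gradSq hΩ huc) hi1 hi2] at key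
    linarith
  · rw [hnorm x hx]
    have h1 : |t * dotR (u x) (η x)| ≤ |t| * M := by
      rw [abs_mul]; exact mul_le_mul_of_nonneg_left (hM x hx) (abs_nonneg _)
    have h2 := neg_abs_le (t * dotR (u x) (η x))
    have h3 := mul_nonneg (sq_nonneg t) (normSq_nonneg (η x))
    nlinarith
  · ext j
    simp [h0 hx]
  · have hud := fun j => (huc j).differentiableAt hΩ hx
    have hηd := fun j => (hη j).differentiableAt hΩ hx
    have hg := gradSq_add_smul hud hηd t
    rw [hnorm x (subset_closure hx), hg]
    exact first_variation_bound (gradSq_nonneg _ _) (gradSq_nonneg _ _)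
      (abs_gradDot_le (differentiableAt_pi.2 hud) (differentiableAt_pi.2 hηd))
      (hM x (subset_closure hx)) (normSq_nonneg _) ht1 htM (hg ▸ gradSq_nonneg _ _)

end EulerLagrange

/-- The Laplacian, as a sum of iterated partial derivatives. -/
def lap {m : ℕ} (f : (Fin m → ℝ) → ℝ) (x : Fin m → ℝ) : ℝ := ∑ i, pd i (pd i f) x

section Superharmonic

variable {m n : ℕ} {Ω K : Set (Fin m → ℝ)} {u ubd : (Fin m → ℝ) → Fin n → ℝ}
  {p η : (Fin m → ℝ) → ℝ}

theorem contDiff_pd (hη : ContDiff ℝ 2 η) (i : Fin m) : ContDiff ℝ 1 (pd i η) :=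
  (hη.fderiv_right (m := 1) (by norm_num)).clm_apply contDiff_const

theorem continuous_pd (hη : ContDiff ℝ 1 η) (i : Fin m) : Continuous (pd i η) :=
  (hη.continuous_fderiv one_ne_zero).clm_apply continuous_const

theorem continuous_lap (hη : ContDiff ℝ 2 η) : Continuous (lap η) :=
  continuous_finsetSum _ fun i _ => continuous_pd (contDiff_pd hη i) i

theorem integral_gradDotS_eq_neg (hΩ : IsOpen Ω) (hb : IsBounded Ω) (hK : IsCompact K)
    (hKΩ : K ⊆ Ω) (hp : H1C Ω p) (hη : ContDiff ℝ 2 η) (h0 : ∀ x, x ∉ K → η x = 0) :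
    ∫ x in Ω, gradDotS p η x = -∫ x in Ω, p x * lap η x := by
  have hη1 : ContDiff ℝ 1 η := hη.of_le (by norm_num)
  have hi1 := integrableOn_gradDotS hΩ hp (H1C.of_contDiff hb hη1)
  have hi2 : IntegrableOn (fun x => p x * lap η x) Ω :=
    integrableOn_of_continuousOn_closure hb (hp.2.1.mul (continuous_lap hη).continuousOn)
  rw [eq_neg_iff_add_eq_zero, ← integral_add hi1 hi2]
  have e : ∀ x ∈ Ω, gradDotS p η x + p x * lap η x =
      ∑ i, pd i (fun y => p y * pd i η y) x := by
    intro x hx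
    simp only [gradDotS_eq_sum_pd, lap, Finset.mul_sum, ← Finset.sum_add_distrib]
    refine Finset.sum_congr rfl fun i _ => ?_
    rw [pd_mul (hp.differentiableAt hΩ hx) ((contDiff_pd hη i).differentiable one_ne_zero x)]
    ring
  rw [setIntegral_congr_fun hΩ.measurableSet e, integral_finsetSum]
  · exact Finset.sum_eq_zero fun i _ => integral_pd_eq_zero_of_compact hΩ hK hKΩ
      (hp.1.mul (contDiff_pd hη i).contDiffOn)
      (fun x hx => by rw [pd_eq_zero_off_compact hK h0 i hx, mul_zero]) i
  · intro i _
    exact integrableOn_pd hΩ hb (hp.mul hΩ hb (H1C.of_contDiff hb (contDiff_pd hη i))) i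

theorem normSq_update (y : Fin n → ℝ) (j : Fin n) (z : ℝ) :
    normSq (Function.update y j z) = normSq y - y j ^ 2 + z ^ 2 := by
  unfold normSq
  rw [← Finset.add_sum_erase _ _ (Finset.mem_univ j),
    ← Finset.add_sum_erase (a := j) Finset.univ (fun k => y k ^ 2) (Finset.mem_univ j),
    Finset.sum_congr rfl (g := fun k => y k ^ 2) fun k hk => by
      rw [Function.update_of_ne (Finset.ne_of_mem_erase hk)]]
  simp
  ring

theorem component_update (u : (Fin m → ℝ) → Fin n → ℝ) (j k : Fin n) (p : (Fin m → ℝ) → ℝ) :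
    (fun x => Function.update (u x) j (p x) k) = if k = j then p else fun x => u x k := by
  ext x
  by_cases h : k = j
  · subst h; simp
  · simp [h]

theorem H1C.update (hu : ∀ k, H1C Ω (fun x => u x k)) (hp : H1C Ω p) (j k : Fin n) :
    H1C Ω (fun x => Function.update (u x) j (p x) k) := by
  rw [component_update]
  split_ifs
  exacts [hp, hu k]

theorem gradSq_update (hΩ : IsOpen Ω) (hu : ∀ k, H1C Ω (fun x => u x k)) (hp : H1C Ω p)
    (j : Fin n) {x : Fin m → ℝ} (hx : x ∈ Ω) :
    gradSq (fun x => Function.update (u x) j (p x)) x =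
      gradSq u x - gradSqS (fun x => u x j) x + gradSqS p x := by
  rw [gradSq_eq_sum (differentiableAt_of_components hΩ (fun k => H1C.update hu hp j k) hx),
    gradSq_eq_sum (differentiableAt_of_components hΩ hu hx),
    ← Finset.add_sum_erase _ _ (Finset.mem_univ j),
    ← Finset.add_sum_erase (a := j) Finset.univ (fun k => gradSqS (fun x => u x k) x)
      (Finset.mem_univ j),
    Finset.sum_congr rfl (g := fun k => gradSqS (fun x => u x k) x) fun k hk => by
      rw [component_update, if_neg (Finset.ne_of_mem_erase hk)]]
  rw [component_update, if_pos rfl]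
  ring

/-- A smooth approximation of the absolute value. -/
def sabs (ε x : ℝ) : ℝ := Real.sqrt (x ^ 2 + ε ^ 2) - ε

theorem contDiff_sabs {ε : ℝ} (hε : 0 < ε) : ContDiff ℝ 1 (sabs ε) :=
  (((contDiff_id.pow 2).add contDiff_const).sqrt fun x => by
    have : 0 < ε ^ 2 := by positivity
    simp only [id]
    positivity).sub contDiff_const

theorem sabs_nonneg (ε x : ℝ) : 0 ≤ sabs ε x := by
  rw [sabs, sub_nonneg]
  exact Real.le_sqrt_of_sq_le (by nlinarith [sq_nonneg x])

theorem sabs_zero {ε : ℝ} (hε : 0 < ε) : sabs ε 0 = 0 := by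
  simp [sabs, Real.sqrt_sq hε.le]

theorem sabs_le {ε : ℝ} (hε : 0 < ε) (x : ℝ) : sabs ε x ≤ |x| := by
  rw [sabs, sub_le_iff_le_add, Real.sqrt_le_left (by positivity)]
  nlinarith [sq_abs x, abs_nonneg x, mul_nonneg (abs_nonneg x) hε.le]

theorem le_sabs {ε : ℝ} (x : ℝ) : |x| - ε ≤ sabs ε x := by
  rw [sabs]
  have : |x| ≤ Real.sqrt (x ^ 2 + ε ^ 2) :=
    Real.le_sqrt_of_sq_le (by nlinarith [sq_abs x, sq_nonneg ε])
  linarith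

theorem le_sabs_sq {ε : ℝ} (hε : 0 < ε) {x : ℝ} (hx : |x| ≤ 1) : x ^ 2 - 2 * ε ≤ sabs ε x ^ 2 := by
  have h1 := sabs_le hε x
  have h2 : (sabs ε x + ε) ^ 2 = x ^ 2 + ε ^ 2 := by
    rw [sabs, sub_add_cancel, Real.sq_sqrt (by positivity)]
  nlinarith

theorem hasDerivAt_sabs {ε : ℝ} (hε : 0 < ε) (x : ℝ) : ∃ d, HasDerivAt (sabs ε) d x ∧ d ^ 2 ≤ 1 := by
  have hpos : 0 < x ^ 2 + ε ^ 2 := by positivity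
  have h := (((hasDerivAt_pow 2 x).add_const (ε ^ 2)).sqrt hpos.ne').sub_const ε
  refine ⟨_, h, ?_⟩
  have hs := Real.sqrt_pos.2 hpos
  rw [div_pow, div_le_one (by positivity), mul_pow, mul_pow 2 (√_), Real.sq_sqrt hpos.le]
  norm_num
  nlinarith [sq_nonneg ε]

theorem IsMinHarm.variation_sabs (hu : IsMinHarm Ω ubd u) (hΩ : IsOpen Ω) (hb : IsBounded Ω)
    {j : Fin n} (hj : ∀ x ∈ frontier Ω, u x j = 0) (hK : IsCompact K) (hKΩ : K ⊆ Ω)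
    (hη : ContDiff ℝ 2 η) (h0 : ∀ x, x ∉ K → η x = 0) (hη0 : ∀ x, 0 ≤ η x)
    {ε t : ℝ} (hε : 0 < ε) (hε2 : ε < 1 / 2) (ht : 0 ≤ t) :
    (1 - 2 * ε) * ∫ x in Ω, gradSq u x ≤ (∫ x in Ω, gradSq u x) +
      (2 * t) * (-∫ x in Ω, sabs ε (u x j) * lap η x) + t ^ 2 * ∫ x in Ω, gradSqS η x := by
  have huc := fun j => hu.1.component hΩ j
  have hη1 : ContDiff ℝ 1 η := hη.of_le (by norm_num)
  have hηH : H1C Ω η := H1C.of_contDiff hb hη1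
  have hsH : H1C Ω (fun x => sabs ε (u x j)) :=
    (huc j).comp hΩ hb isOpen_univ (contDiff_sabs hε).contDiffOn (mapsTo_univ _ _)
  have hp : H1C Ω (fun x => sabs ε (u x j) + t * η x) := hsH.add hΩ (hηH.const_mul hΩ hb t)
  rw [← integral_gradDotS_eq_neg hΩ hb hK hKΩ hsH hη h0,
    ← integral_add_mul_add_mul (integrableOn_gradSq hΩ huc) (integrableOn_gradDotS hΩ hsH hηH)
      hηH.2.2]
  have hG : IntegrableOn (fun x => gradSq u x + 2 * t * gradDotS (fun x => sabs ε (u x j)) η x +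
      t ^ 2 * gradSqS η x) Ω :=
    ((integrableOn_gradSq hΩ huc).add ((integrableOn_gradDotS hΩ hsH hηH).const_mul _)).add
      (hηH.2.2.const_mul _)
  have hε3 : 0 < 1 - 2 * ε := by linarith
  have hnorm : ∀ x ∈ closure Ω,
      1 - 2 * ε ≤ normSq (Function.update (u x) j (sabs ε (u x j) + t * η x)) := by
    intro x hx
    rw [normSq_update, hu.1.2 x hx]
    have h1 : |u x j| ≤ 1 := by
      rw [← sq_le_one_iff_abs_le_one, ← hu.1.2 x hx]
      exact Finset.single_le_sum (f := fun k => u x k ^ 2) (fun _ _ => sq_nonneg _)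
        (Finset.mem_univ j)
    have h2 := le_sabs_sq hε h1
    have h3 := mul_nonneg (sabs_nonneg ε (u x j)) (mul_nonneg ht (hη0 x))
    nlinarith [sq_nonneg (t * η x)]
  rw [mul_comm, ← le_div_iff₀ hε3, ← integral_div]
  refine hu.integral_gradSq_le hΩ hb
    (W := fun x => Function.update (u x) j (sabs ε (u x j) + t * η x))
    (fun k => H1C.update huc hp j k) (fun x hx => lt_of_lt_of_le hε3 (hnorm x hx))
    (fun x hx => ?_) (hG.div_const _) fun x hx => ?_
  · have hxK : x ∉ K := fun h => by
      rw [hΩ.frontier_eq] at hx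
      exact hx.2 (hKΩ h)
    simp only
    rw [hj x hx, sabs_zero hε, h0 x hxK, mul_zero, add_zero, ← hj x hx, Function.update_eq_self]
  · have hg0 := gradSq_nonneg (fun x => Function.update (u x) j (sabs ε (u x j) + t * η x)) x
    have hle : gradSq (fun x => Function.update (u x) j (sabs ε (u x j) + t * η x)) x ≤
        gradSq u x + 2 * t * gradDotS (fun x => sabs ε (u x j)) η x + t ^ 2 * gradSqS η x := by
      obtain ⟨d, hd, hd1⟩ := hasDerivAt_sabs hε (u x j)
      rw [gradSq_update hΩ huc hp j hx,
        gradSqS_add (hsH.differentiableAt hΩ hx) ((hηH.differentiableAt hΩ hx).const_mul t),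
        gradDotS_const_mul_right t (hηH.differentiableAt hΩ hx),
        gradSqS_const_mul t (hηH.differentiableAt hΩ hx),
        gradSqS_comp hd ((huc j).differentiableAt hΩ hx)]
      nlinarith [gradSqS_nonneg (fun x => u x j) x]
    rw [div_mul_eq_mul_div, le_div_iff₀ hε3]
    exact mul_le_mul hle (hnorm x (subset_closure hx)) hε3.le (hg0.trans hle)

/-- For a minimising map, the absolute value of a component with zero boundary values is
superharmonic. -/
theorem IsMinHarm.integral_abs_mul_lap_nonpos (hu : IsMinHarm Ω ubd u) (hΩ : IsOpen Ω)
    (hb : IsBounded Ω) {j : Fin n} (hj : ∀ x ∈ frontier Ω, u x j = 0) (hK : IsCompact K)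
    (hKΩ : K ⊆ Ω) (hη : ContDiff ℝ 2 η) (h0 : ∀ x, x ∉ K → η x = 0) (hη0 : ∀ x, 0 ≤ η x) :
    ∫ x in Ω, |u x j| * lap η x ≤ 0 := by
  have huc := fun j => hu.1.component hΩ j
  have hlc : ContinuousOn (lap η) (closure Ω) := (continuous_lap hη).continuousOn
  have hi : IntegrableOn (fun x => |u x j| * lap η x) Ω :=
    integrableOn_of_continuousOn_closure hb ((huc j).2.1.abs.mul hlc)
  have hil : IntegrableOn (fun x => |lap η x|) Ω := integrableOn_of_continuousOn_closure hb hlc.abs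
  set E := ∫ x in Ω, gradSq u x
  set D := ∫ x in Ω, gradSqS η x
  set L := ∫ x in Ω, |lap η x|
  have key : ∀ t : ℝ, 0 < t → t < 1 / 2 →
      ∫ x in Ω, |u x j| * lap η x ≤ t * (E + D / 2) + t ^ 2 * L := by
    intro t ht ht2
    have ht3 : t ^ 2 < 1 / 2 := by nlinarith
    have htp : 0 < t ^ 2 := by positivity
    have h1 := hu.variation_sabs hΩ hb hj hK hKΩ hη h0 hη0 htp ht3 ht.le
    have h2 : (∫ x in Ω, |u x j| * lap η x) - t ^ 2 * L ≤
        ∫ x in Ω, sabs (t ^ 2) (u x j) * lap η x := by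
      rw [← integral_const_mul, ← integral_sub hi (hil.const_mul _)]
      refine integral_mono (hi.sub (hil.const_mul _)) ?_ fun x => ?_
      · exact integrableOn_of_continuousOn_closure hb
          (((contDiff_sabs htp).continuous.comp_continuousOn (huc j).2.1).mul hlc)
      · have a1 := sabs_le htp (u x j)
        have a2 := le_sabs (ε := t ^ 2) (u x j)
        have a3 : (|u x j| - sabs (t ^ 2) (u x j)) * lap η x ≤ t ^ 2 * |lap η x| := by
          calc _ ≤ (|u x j| - sabs (t ^ 2) (u x j)) * |lap η x| :=
                mul_le_mul_of_nonneg_left (le_abs_self _) (by linarith)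
            _ ≤ _ := mul_le_mul_of_nonneg_right (by linarith) (abs_nonneg _)
        simp only
        linarith
    have h3 : 2 * t * ∫ x in Ω, sabs (t ^ 2) (u x j) * lap η x ≤ 2 * t * (t * (E + D / 2)) := by
      simp only [E, D]
      nlinarith
    have h4 := le_of_mul_le_mul_left h3 (by positivity)
    linarith
  have hlim : Filter.Tendsto (fun t : ℝ => t * (E + D / 2) + t ^ 2 * L)
      (nhdsWithin 0 (Ioi 0)) (nhds 0) := by
    have : Continuous fun t : ℝ => t * (E + D / 2) + t ^ 2 * L := by fun_prop
    have h := (this.tendsto 0).mono_left (nhdsWithin_le_nhds (s := Ioi 0))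
    simpa using h
  refine ge_of_tendsto hlim ?_
  filter_upwards [Ioo_mem_nhdsGT (show (0 : ℝ) < 1 / 2 by norm_num)] with t ht
  exact key t ht.1 ht.2

end Superharmonic

section Radial

/-- Squared Euclidean distance to `c`. -/
def sqDist {m : ℕ} (c x : Fin m → ℝ) : ℝ := ∑ i, (x i - c i) ^ 2

theorem contDiff_sqDist {m : ℕ} (c : Fin m → ℝ) : ContDiff ℝ 2 (sqDist c) := by
  unfold sqDist
  fun_prop

theorem pd_coord {m : ℕ} (c : Fin m → ℝ) (i : Fin m) (x : Fin m → ℝ) :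
    pd i (fun y => y i - c i) x = 1 := by
  have h : HasFDerivAt (fun y : Fin m → ℝ => y i - c i)
      (ContinuousLinearMap.proj (R := ℝ) (φ := fun _ : Fin m => ℝ) i) x :=
    (ContinuousLinearMap.proj (R := ℝ) (φ := fun _ : Fin m => ℝ) i).hasFDerivAt.sub_const (c i)
  rw [pd, h.fderiv]
  simp

theorem pd_sqDist {m : ℕ} (c : Fin m → ℝ) (i : Fin m) (x : Fin m → ℝ) :
    pd i (sqDist c) x = 2 * (x i - c i) := by
  have hd : ∀ k : Fin m, HasFDerivAt (fun y : Fin m → ℝ => (y k - c k) ^ 2)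
      ((2 * (x k - c k)) • ContinuousLinearMap.proj (R := ℝ) (φ := fun _ : Fin m => ℝ) k) x := by
    intro k
    have h := ((ContinuousLinearMap.proj (R := ℝ) (φ := fun _ : Fin m => ℝ) k).hasFDerivAt
      (x := x)).sub_const (c k)
    simpa using h.pow 2
  have h := HasFDerivAt.fun_sum (u := Finset.univ) fun k _ => hd k
  rw [pd]
  unfold sqDist
  rw [h.fderiv]
  simp [Pi.single_apply]

theorem lap_radial {k f : ℝ → ℝ} (hk : ContDiff ℝ 1 k) (hf : ∀ s, HasDerivAt f (-k s) s)
    (c x : Fin 2 → ℝ) :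
    lap (fun y => f (sqDist c y)) x = -4 * deriv (fun s => s * k s) (sqDist c x) := by
  have hq : Differentiable ℝ (sqDist c) := (contDiff_sqDist c).differentiable two_ne_zero
  have hkd : ∀ s, HasDerivAt k (deriv k s) s := fun s =>
    (hk.differentiable one_ne_zero s).hasDerivAt
  have e1 : ∀ i, pd i (fun y => f (sqDist c y)) =
      fun y => -2 * (k (sqDist c y) * (y i - c i)) := by
    intro i
    ext y
    rw [pd_comp (hf _) (hq y), pd_sqDist]
    ring
  have hkq : DifferentiableAt ℝ (fun y => k (sqDist c y)) x :=
    (hkd _).differentiableAt.comp x (hq x)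
  have hco : ∀ i : Fin 2, DifferentiableAt ℝ (fun y : Fin 2 → ℝ => y i - c i) x := by
    intro i; fun_prop
  have e2 : ∀ i, pd i (pd i (fun y => f (sqDist c y))) x =
      -2 * (k (sqDist c x) + 2 * (x i - c i) ^ 2 * deriv k (sqDist c x)) := by
    intro i
    rw [e1, pd_const_mul _ (hkq.fun_mul (hco i)), pd_mul hkq (hco i), pd_coord,
      pd_comp (hkd _) (hq x), pd_sqDist]
    ring
  have e3 : deriv (fun s => s * k s) (sqDist c x) =
      k (sqDist c x) + sqDist c x * deriv k (sqDist c x) := by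
    have h := (hasDerivAt_id (sqDist c x)).fun_mul (hkd (sqDist c x))
    simp only [id, one_mul] at h
    exact h.deriv
  rw [e3, lap, Fin.sum_univ_two, e2, e2]
  have : sqDist c x = (x 0 - c 0) ^ 2 + (x 1 - c 1) ^ 2 := Fin.sum_univ_two _
  rw [this]
  ring

theorem hasDerivAt_expNegInvGlue (s : ℝ) :
    HasDerivAt expNegInvGlue ((s⁻¹) ^ 2 * expNegInvGlue s) s := by
  simpa using expNegInvGlue.hasDerivAt_polynomial_eval_inv_mul 1 s

theorem expNegInvGlue_le_one (s : ℝ) : expNegInvGlue s ≤ 1 := by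
  by_cases h : s ≤ 0
  · rw [expNegInvGlue.zero_of_nonpos h]; exact zero_le_one
  · rw [expNegInvGlue, if_neg h, Real.exp_le_one_iff]
    have : 0 < s := not_le.1 h
    simp only [Left.neg_nonpos_iff]
    positivity

/-- Inner cut-off of the radial test functions. -/
def innerCut (σ s : ℝ) : ℝ := Real.smoothTransition (2 * s / σ - 1)

/-- Outer cut-off of the radial test functions. -/
def outerCut (ρ s : ℝ) : ℝ := expNegInvGlue (ρ - s)

theorem contDiff_innerCut (σ : ℝ) : ContDiff ℝ 1 (innerCut σ) :=
  Real.smoothTransition.contDiff.comp (by fun_prop)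

theorem contDiff_outerCut (ρ : ℝ) : ContDiff ℝ 1 (outerCut ρ) :=
  expNegInvGlue.contDiff.comp (by fun_prop)

theorem hasDerivAt_innerCut (σ s : ℝ) :
    HasDerivAt (innerCut σ) (deriv Real.smoothTransition (2 * s / σ - 1) * (2 / σ)) s := by
  have h1 : HasDerivAt (fun s : ℝ => 2 * s / σ - 1) (2 / σ) s := by
    simpa using (((hasDerivAt_id s).const_mul 2).div_const σ).sub_const 1
  exact ((Real.smoothTransition.contDiff (n := 1)).differentiable one_ne_zero _).hasDerivAt.comp s h1

theorem hasDerivAt_outerCut (ρ s : ℝ) :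
    HasDerivAt (outerCut ρ) (-(((ρ - s)⁻¹) ^ 2 * outerCut ρ s)) s := by
  have h1 : HasDerivAt (fun s : ℝ => ρ - s) (-1) s := by
    simpa using (hasDerivAt_id s).const_sub ρ
  have := (hasDerivAt_expNegInvGlue (ρ - s)).comp s h1
  rw [mul_neg_one] at this
  exact this

theorem innerCut_eq_zero {σ s : ℝ} (hσ : 0 < σ) (hs : s ≤ σ / 2) : innerCut σ s = 0 := by
  refine Real.smoothTransition.zero_of_nonpos ?_
  rw [sub_nonpos, div_le_one hσ]
  linarith

/-- Logarithmic density of the radial test functions. -/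
def radialDensity (σ ρ s : ℝ) : ℝ := innerCut σ s * outerCut ρ s * s⁻¹

theorem contDiff_radialDensity {σ : ℝ} (hσ : 0 < σ) (ρ : ℝ) : ContDiff ℝ 1 (radialDensity σ ρ) := by
  rw [contDiff_iff_contDiffAt]
  intro s
  by_cases hs : s < σ / 2
  · have : radialDensity σ ρ =ᶠ[nhds s] fun _ => 0 := by
      filter_upwards [isOpen_Iio.mem_nhds hs] with y hy
      simp [radialDensity, innerCut_eq_zero hσ (le_of_lt hy)]
    exact contDiffAt_const.congr_of_eventuallyEq this
  · have : s ≠ 0 := by intro h; subst h; exact hs (by linarith)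
    exact ((contDiff_innerCut σ).mul (contDiff_outerCut ρ)).contDiffAt.mul (contDiffAt_inv ℝ this)

theorem mul_radialDensity {σ : ℝ} (hσ : 0 < σ) (ρ : ℝ) :
    (fun s => s * radialDensity σ ρ s) = fun s => innerCut σ s * outerCut ρ s := by
  ext s
  by_cases hs : s = 0
  · subst hs
    simp [innerCut_eq_zero hσ (half_pos hσ).le]
  · simp only [radialDensity]
    field_simp

theorem radialDensity_nonneg {σ ρ s : ℝ} (hσ : 0 < σ) : 0 ≤ radialDensity σ ρ s := by
  by_cases hs : s ≤ σ / 2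
  · simp [radialDensity, innerCut_eq_zero hσ hs]
  · have : 0 < s := by linarith
    exact mul_nonneg (mul_nonneg (Real.smoothTransition.nonneg _) (expNegInvGlue.nonneg _))
      (inv_nonneg.2 this.le)

theorem radialDensity_eq_zero {σ ρ s : ℝ} (hs : ρ ≤ s) : radialDensity σ ρ s = 0 := by
  simp [radialDensity, outerCut, expNegInvGlue.zero_of_nonpos (sub_nonpos.2 hs)]

theorem exists_radial_test {σ ρ : ℝ} (hσ : 0 < σ) : ∃ f : ℝ → ℝ, ContDiff ℝ 2 f ∧
    (∀ s, HasDerivAt f (-radialDensity σ ρ s) s) ∧ (∀ s, 0 ≤ f s) ∧ ∀ s, ρ ≤ s → f s = 0 := by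
  have hk := contDiff_radialDensity hσ ρ
  have hd : ∀ s, HasDerivAt (fun s => ∫ y in s..ρ, radialDensity σ ρ y) (-radialDensity σ ρ s) s :=
    fun s => intervalIntegral.integral_hasDerivAt_left (hk.continuous.intervalIntegrable _ _)
      (hk.continuous.stronglyMeasurableAtFilter _ _) hk.continuous.continuousAt
  have hz : ∀ s, ρ ≤ s → ∫ y in s..ρ, radialDensity σ ρ y = 0 := fun s hs => by
    rw [intervalIntegral.integral_symm, intervalIntegral.integral_congr (g := fun _ => 0)]
    · simp
    · intro y hy
      rw [uIcc_of_le hs] at hy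
      exact radialDensity_eq_zero hy.1
  refine ⟨_, ?_, hd, fun s => ?_, hz⟩
  · have h2 : (2 : WithTop ℕ∞) = 1 + 1 := by norm_num
    rw [h2, contDiff_succ_iff_deriv]
    refine ⟨fun s => (hd s).differentiableAt, by simp, ?_⟩
    have : deriv (fun s => ∫ y in s..ρ, radialDensity σ ρ y) = fun s => -radialDensity σ ρ s :=
      funext fun s => (hd s).deriv
    rw [this]
    exact hk.neg
  · rcases le_total s ρ with h | h
    · exact intervalIntegral.integral_nonneg h fun y _ => radialDensity_nonneg hσ
    · exact (hz s h).ge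

theorem eqOn_zero_of_integral_eq_zero {m : ℕ} {Ω : Set (Fin m → ℝ)} {f : (Fin m → ℝ) → ℝ}
    (hΩ : IsOpen Ω) (hf : ContinuousOn f Ω) (h0 : ∀ x ∈ Ω, 0 ≤ f x) (hi : IntegrableOn f Ω)
    (h : ∫ x in Ω, f x ≤ 0) : EqOn f 0 Ω := by
  have hae : 0 ≤ᵐ[volume.restrict Ω] f :=
    (ae_restrict_iff' hΩ.measurableSet).2 (Filter.Eventually.of_forall h0)
  have h' : ∫ x in Ω, f x = 0 := le_antisymm h (integral_nonneg_of_ae hae)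
  rw [setIntegral_eq_zero_iff_of_nonneg_ae hae hi] at h'
  exact Measure.eqOn_open_of_ae_eq h' hΩ hf continuousOn_const

end Radial

section StrongMinimumPrinciple

variable {Ω : Set (Fin 2 → ℝ)} {g : (Fin 2 → ℝ) → ℝ}

/-- Weak formulation of `-Δ g ≥ 0`. -/
def WeaklySuperharmonic (Ω : Set (Fin 2 → ℝ)) (g : (Fin 2 → ℝ) → ℝ) : Prop :=
  ∀ (K : Set (Fin 2 → ℝ)) (η : (Fin 2 → ℝ) → ℝ), IsCompact K → K ⊆ Ω → ContDiff ℝ 2 η →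
    (∀ x, x ∉ K → η x = 0) → (∀ x, 0 ≤ η x) → ∫ x in Ω, g x * lap η x ≤ 0

theorem sqDist_nonneg {m : ℕ} (c x : Fin m → ℝ) : 0 ≤ sqDist c x :=
  Finset.sum_nonneg fun _ _ => sq_nonneg _

theorem sqDist_gt_of_notMem_closedBall {m : ℕ} {c x : Fin m → ℝ} {r : ℝ} (hr : 0 ≤ r)
    (hx : x ∉ Metric.closedBall c r) : r ^ 2 < sqDist c x := by
  rw [Metric.mem_closedBall, dist_pi_le_iff hr] at hx
  push Not at hx
  obtain ⟨i, hi⟩ := hx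
  rw [Real.dist_eq] at hi
  calc r ^ 2 < |x i - c i| ^ 2 := pow_lt_pow_left₀ hi hr two_ne_zero
    _ = (x i - c i) ^ 2 := sq_abs _
    _ ≤ sqDist c x := Finset.single_le_sum (f := fun i => (x i - c i) ^ 2)
        (fun _ _ => sq_nonneg _) (Finset.mem_univ i)

theorem continuous_deriv_outerCut (ρ : ℝ) : Continuous (deriv (outerCut ρ)) :=
  (contDiff_outerCut ρ).continuous_deriv le_rfl

theorem continuous_deriv_innerCut (σ : ℝ) : Continuous (deriv (innerCut σ)) :=
  (contDiff_innerCut σ).continuous_deriv le_rfl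

theorem WeaklySuperharmonic.annulus_inequality (hsup : WeaklySuperharmonic Ω g) (hb : IsBounded Ω)
    (hg : ContinuousOn g (closure Ω)) {c : Fin 2 → ℝ} {R σ : ℝ} (hR : 0 < R)
    (hball : Metric.closedBall c R ⊆ Ω) (hσ : 0 < σ) :
    ∫ x in Ω, g x * (innerCut σ (sqDist c x) * -deriv (outerCut (R ^ 2)) (sqDist c x)) ≤
      ∫ x in Ω, g x * (deriv (innerCut σ) (sqDist c x) * outerCut (R ^ 2) (sqDist c x)) := by
  obtain ⟨f, hf2, hfd, hf0, hfz⟩ := exists_radial_test (σ := σ) (ρ := R ^ 2) hσ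
  have hqc : Continuous (sqDist c) := (contDiff_sqDist c).continuous
  have h := hsup (Metric.closedBall c R) (fun x => f (sqDist c x)) (isCompact_closedBall c R) hball
    (hf2.comp (contDiff_sqDist c))
    (fun x hx => hfz _ (sqDist_gt_of_notMem_closedBall hR.le hx).le) fun x => hf0 _
  have hi1 : IntegrableOn (fun x => g x *
      (innerCut σ (sqDist c x) * -deriv (outerCut (R ^ 2)) (sqDist c x))) Ω :=
    integrableOn_of_continuousOn_closure hb (hg.mul
      (((contDiff_innerCut σ).continuous.comp hqc).mul
        ((continuous_deriv_outerCut _).comp hqc).neg).continuousOn)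
  have hi2 : IntegrableOn (fun x => g x *
      (deriv (innerCut σ) (sqDist c x) * outerCut (R ^ 2) (sqDist c x))) Ω :=
    integrableOn_of_continuousOn_closure hb (hg.mul
      (((continuous_deriv_innerCut σ).comp hqc).mul
        ((contDiff_outerCut _).continuous.comp hqc)).continuousOn)
  rw [← sub_nonpos, ← integral_sub hi1 hi2]
  have e : ∀ x, g x * (innerCut σ (sqDist c x) * -deriv (outerCut (R ^ 2)) (sqDist c x)) -
      g x * (deriv (innerCut σ) (sqDist c x) * outerCut (R ^ 2) (sqDist c x)) =
      4⁻¹ * (g x * lap (fun x => f (sqDist c x)) x) := by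
    intro x
    rw [lap_radial (contDiff_radialDensity hσ _) hfd, mul_radialDensity hσ]
    have hd := (hasDerivAt_innerCut σ (sqDist c x)).fun_mul (hasDerivAt_outerCut (R ^ 2) (sqDist c x))
    rw [hd.deriv, (hasDerivAt_innerCut σ _).deriv, (hasDerivAt_outerCut (R ^ 2) _).deriv]
    ring
  simp only [e, integral_const_mul]
  linarith

theorem neg_deriv_outerCut_nonneg (ρ s : ℝ) : 0 ≤ -deriv (outerCut ρ) s := by
  rw [(hasDerivAt_outerCut ρ s).deriv, neg_neg]
  exact mul_nonneg (sq_nonneg _) (expNegInvGlue.nonneg _)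

theorem neg_deriv_outerCut_pos {ρ s : ℝ} (h : s < ρ) : 0 < -deriv (outerCut ρ) s := by
  rw [(hasDerivAt_outerCut ρ s).deriv, neg_neg]
  have h1 : 0 < ρ - s := sub_pos.2 h
  exact mul_pos (by positivity) (expNegInvGlue.pos_of_pos h1)

theorem integral_innerCut_le (hΩ : IsOpen Ω) (hg0 : ∀ x ∈ Ω, 0 ≤ g x)
    {c : Fin 2 → ℝ} {C ρ r ε : ℝ} (hC0 : 0 ≤ C) (hC : ∀ t, |deriv Real.smoothTransition t| ≤ C)
    (hr : 0 < r) (hball : Metric.closedBall c r ⊆ Ω)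
    (hε : ∀ x ∈ Metric.closedBall c r, g x ≤ ε) :
    ∫ x in Ω, g x * (deriv (innerCut (r ^ 2)) (sqDist c x) * outerCut ρ (sqDist c x)) ≤
      8 * C * ε := by
  have hε0 : 0 ≤ ε :=
    (hg0 c (hball (Metric.mem_closedBall_self hr.le))).trans (hε c (Metric.mem_closedBall_self hr.le))
  have hr2 : 0 < r ^ 2 := by positivity
  have hle : ∀ x ∈ Ω, g x * (deriv (innerCut (r ^ 2)) (sqDist c x) * outerCut ρ (sqDist c x)) ≤
      (Metric.closedBall c r).indicator (fun _ => ε * (C * (2 / r ^ 2))) x := by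
    intro x hx
    rw [(hasDerivAt_innerCut _ _).deriv]
    by_cases hxb : x ∈ Metric.closedBall c r
    · rw [indicator_of_mem hxb]
      refine mul_le_mul (hε x hxb) ?_ ?_ hε0
      · calc _ ≤ C * (2 / r ^ 2) * 1 := by
              refine mul_le_mul ?_ (expNegInvGlue_le_one _) (expNegInvGlue.nonneg _) (by positivity)
              exact mul_le_mul_of_nonneg_right ((le_abs_self _).trans (hC _)) (by positivity)
          _ = _ := mul_one _
      · refine mul_nonneg (mul_nonneg ?_ (by positivity)) (expNegInvGlue.nonneg _)
        exact Real.smoothTransition.monotone.deriv_nonneg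
    · rw [indicator_of_notMem hxb, deriv_smoothTransition_eq_zero]
      · simp
      · right
        have := sqDist_gt_of_notMem_closedBall hr.le hxb
        rw [lt_sub_iff_add_lt, lt_div_iff₀ hr2]
        linarith
  have hind : IntegrableOn ((Metric.closedBall c r).indicator
      (fun _ => ε * (C * (2 / r ^ 2)))) Ω := by
    have h1 : IntegrableOn (fun _ : Fin 2 → ℝ => ε * (C * (2 / r ^ 2))) (Metric.closedBall c r) :=
      integrableOn_const (isCompact_closedBall c r).measure_lt_top.ne
    exact ((integrable_indicator_iff measurableSet_closedBall).2 h1).integrableOn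
  have hintg : ∫ x in Ω, (Metric.closedBall c r).indicator (fun _ => ε * (C * (2 / r ^ 2))) x =
      8 * C * ε := by
    rw [setIntegral_indicator measurableSet_closedBall, inter_eq_self_of_subset_right hball,
      setIntegral_const, Measure.real, Real.volume_pi_closedBall c hr.le,
      ENNReal.toReal_ofReal (by positivity)]
    simp only [Fintype.card_fin, smul_eq_mul]
    field_simp
    ring
  by_cases hi : IntegrableOn (fun x =>
      g x * (deriv (innerCut (r ^ 2)) (sqDist c x) * outerCut ρ (sqDist c x))) Ω
  · rw [← hintg]
    exact setIntegral_mono_on hi hind hΩ.measurableSet hle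
  · rw [integral_undef hi]
    positivity

theorem WeaklySuperharmonic.eventually_eq_zero (hsup : WeaklySuperharmonic Ω g) (hΩ : IsOpen Ω)
    (hb : IsBounded Ω) (hg : ContinuousOn g (closure Ω)) (hg0 : ∀ x ∈ Ω, 0 ≤ g x)
    {c : Fin 2 → ℝ} (hc : c ∈ Ω) (hgc : g c = 0) : ∀ᶠ x in nhds c, g x = 0 := by
  obtain ⟨R, hR, hball⟩ := Metric.nhds_basis_closedBall.mem_iff.1 (hΩ.mem_nhds hc)
  have hqc : Continuous (sqDist c) := (contDiff_sqDist c).continuous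
  have hqz : sqDist c c = 0 := by simp [sqDist]
  have hR2 : 0 < R ^ 2 := by positivity
  have hnear : ∀ᶠ x in nhds c, sqDist c x < R ^ 2 :=
    (hqc.tendsto c).eventually_lt_const (by rwa [hqz])
  filter_upwards [hnear] with y hy
  by_contra hgy
  have hyΩ : y ∈ Ω := by
    refine hball ?_
    by_contra h
    exact absurd (sqDist_gt_of_notMem_closedBall hR.le h) (not_lt.2 hy.le)
  have hσ : 0 < sqDist c y := by
    refine lt_of_le_of_ne (sqDist_nonneg c y) fun h => hgy ?_
    have : y = c := by
      ext i
      have := (Finset.sum_eq_zero_iff_of_nonneg fun i _ => sq_nonneg (y i - c i)).1 h.symm i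
        (Finset.mem_univ i)
      exact sub_eq_zero.1 (pow_eq_zero_iff two_ne_zero |>.1 this)
    rw [this, hgc]
  set σ := sqDist c y with hσd
  have hcont : ∀ σ, ContinuousOn (fun x => g x *
      (innerCut σ (sqDist c x) * -deriv (outerCut (R ^ 2)) (sqDist c x))) (closure Ω) := fun σ =>
    hg.mul (((contDiff_innerCut σ).continuous.comp hqc).mul
        ((continuous_deriv_outerCut _).comp hqc).neg).continuousOn
  have hnn : ∀ σ, ∀ x ∈ Ω, 0 ≤ g x *
      (innerCut σ (sqDist c x) * -deriv (outerCut (R ^ 2)) (sqDist c x)) := fun σ x hx =>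
    mul_nonneg (hg0 x hx) (mul_nonneg (Real.smoothTransition.nonneg _)
      (neg_deriv_outerCut_nonneg _ _))
  have hI : 0 < ∫ x in Ω, g x *
      (innerCut σ (sqDist c x) * -deriv (outerCut (R ^ 2)) (sqDist c x)) := by
    by_contra hI
    have h := eqOn_zero_of_integral_eq_zero hΩ ((hcont σ).mono subset_closure) (hnn σ)
      (integrableOn_of_continuousOn_closure hb (hcont σ)) (not_lt.1 hI) hyΩ
    have h1 : innerCut σ (sqDist c y) = 1 := by
      rw [innerCut, ← hσd, mul_div_assoc, div_self hσ.ne']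
      norm_num
    simp only [h1, one_mul, Pi.zero_apply, mul_eq_zero] at h
    exact h.elim hgy (neg_deriv_outerCut_pos hy).ne'
  set I := ∫ x in Ω, g x * (innerCut σ (sqDist c x) * -deriv (outerCut (R ^ 2)) (sqDist c x))
  obtain ⟨C, hC0, hC⟩ := exists_bound_deriv_smoothTransition
  have hε : 0 < I / (8 * C + 1) := by positivity
  have hgc' : ∀ᶠ x in nhds c, g x < I / (8 * C + 1) :=
    ((hg.mono subset_closure).continuousAt (hΩ.mem_nhds hc)).eventually_lt_const (by rwa [hgc])
  have hlt : ∀ᶠ x in nhds c, sqDist c x < σ := (hqc.tendsto c).eventually_lt_const (by rwa [hqz])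
  obtain ⟨r, hr, hrb⟩ := Metric.nhds_basis_closedBall.mem_iff.1
    ((hΩ.eventually_mem hc).and (hgc'.and hlt))
  have hrσ : r ^ 2 ≤ σ := by
    have hz : c + Pi.single 0 r ∈ Metric.closedBall c r := by
      rw [Metric.mem_closedBall, dist_eq_norm, add_sub_cancel_left, Pi.norm_single,
        Real.norm_eq_abs, abs_of_pos hr]
    have := (hrb hz).2.2
    simp only [sqDist, Pi.add_apply, add_sub_cancel_left, Fin.sum_univ_two] at this
    simp at this
    exact this.le
  have hr2 : 0 < r ^ 2 := by positivity
  have h1 := hsup.annulus_inequality hb hg hR hball hr2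
  have h2 := integral_innerCut_le (ρ := R ^ 2) hΩ hg0 hC0 hC hr (fun x hx => (hrb hx).1)
    (fun x hx => (hrb hx).2.1.le)
  have h3 : I ≤ ∫ x in Ω, g x *
      (innerCut (r ^ 2) (sqDist c x) * -deriv (outerCut (R ^ 2)) (sqDist c x)) := by
    refine setIntegral_mono_on (integrableOn_of_continuousOn_closure hb (hcont σ))
      (integrableOn_of_continuousOn_closure hb (hcont _)) hΩ.measurableSet fun x hx => ?_
    refine mul_le_mul_of_nonneg_left (mul_le_mul_of_nonneg_right ?_
      (neg_deriv_outerCut_nonneg _ _)) (hg0 x hx)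
    refine Real.smoothTransition.monotone ?_
    have := sqDist_nonneg c x
    gcongr
  have h4 : 8 * C * (I / (8 * C + 1)) < I := by
    rw [mul_div_assoc', div_lt_iff₀ (by positivity)]
    linarith
  linarith

/-- Strong minimum principle. -/
theorem WeaklySuperharmonic.eq_zero_or_ne_zero (hsup : WeaklySuperharmonic Ω g) (hΩ : IsOpen Ω)
    (hc : IsPreconnected Ω) (hb : IsBounded Ω) (hg : ContinuousOn g (closure Ω))
    (hg0 : ∀ x ∈ Ω, 0 ≤ g x) : (∀ x ∈ Ω, g x = 0) ∨ ∀ x ∈ Ω, g x ≠ 0 := by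
  have hU : IsOpen {x | x ∈ Ω ∧ g x = 0} := by
    rw [isOpen_iff_mem_nhds]
    rintro x ⟨hx, hx0⟩
    filter_upwards [hΩ.mem_nhds hx, hsup.eventually_eq_zero hΩ hb hg hg0 hx hx0] with y h1 h2
    exact ⟨h1, h2⟩
  have hV : IsOpen (Ω ∩ g ⁻¹' {0}ᶜ) :=
    (hg.mono subset_closure).isOpen_inter_preimage hΩ isOpen_compl_singleton
  rcases isPreconnected_iff_subset_of_disjoint.1 hc _ _ hU hV
    (fun x hx => by
      by_cases h : g x = 0
      exacts [Or.inl ⟨hx, h⟩, Or.inr ⟨hx, h⟩])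
    (by
      ext x
      simp only [mem_inter_iff, mem_empty_iff_false, iff_false]
      rintro ⟨_, h1, h2⟩
      exact h2.2 h1.2) with h | h
  · exact Or.inl fun x hx => (h hx).2
  · exact Or.inr fun x hx => (h hx).2

theorem IsMinHarm.component_eq_zero_or_ne_zero {n : ℕ} {u ubd : (Fin 2 → ℝ) → Fin n → ℝ}
    (hu : IsMinHarm Ω ubd u) (hΩ : IsOpen Ω) (hc : IsPreconnected Ω) (hb : IsBounded Ω)
    {j : Fin n} (hj : ∀ x ∈ frontier Ω, u x j = 0) :
    (∀ x ∈ Ω, u x j = 0) ∨ ∀ x ∈ Ω, u x j ≠ 0 := by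
  have hsup : WeaklySuperharmonic Ω fun x => |u x j| := fun K η hK hKΩ hη h0 hη0 =>
    hu.integral_abs_mul_lap_nonpos hΩ hb hj hK hKΩ hη h0 hη0
  simpa using hsup.eq_zero_or_ne_zero hΩ hc hb (hu.1.component hΩ j).2.1.abs
    fun x _ => abs_nonneg _

end StrongMinimumPrinciple

section Hardy

variable {m n : ℕ} {Ω K : Set (Fin m → ℝ)} {u w ubd : (Fin m → ℝ) → Fin n → ℝ}
  {φ h f : (Fin m → ℝ) → ℝ}

/-- The remainder `|∇h - h ∇φ / φ|²` in the Hardy-type identity. -/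
def hardyRem (φ h : (Fin m → ℝ) → ℝ) (x : Fin m → ℝ) : ℝ :=
  ∑ i, (pd i h x - h x * pd i φ x / φ x) ^ 2

theorem hardyRem_nonneg (φ h : (Fin m → ℝ) → ℝ) (x : Fin m → ℝ) : 0 ≤ hardyRem φ h x :=
  Finset.sum_nonneg fun _ _ => sq_nonneg _

theorem gradDotS_div_eq (hΩ : IsOpen Ω) (hφ : ContDiffOn ℝ 1 φ Ω) (hne : ∀ x ∈ Ω, φ x ≠ 0)
    (hh : ContDiffOn ℝ 1 h Ω) {x : Fin m → ℝ} (hx : x ∈ Ω) :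
    gradDotS φ (fun y => h y * h y / φ y) x = gradSqS h x - hardyRem φ h x := by
  have hψ : ContDiffOn ℝ 1 (fun y => h y * h y / φ y) Ω := (hh.mul hh).div hφ hne
  have hφd := hφ.differentiableAt_of_isOpen hΩ hx
  have hhd := hh.differentiableAt_of_isOpen hΩ hx
  have hψd := hψ.differentiableAt_of_isOpen hΩ hx
  rw [gradDotS_eq_sum_pd, gradSqS_eq_sum_pd, hardyRem, ← Finset.sum_sub_distrib]
  refine Finset.sum_congr rfl fun i _ => ?_
  have e : pd i (fun y => h y * h y / φ y * φ y) x = pd i (fun y => h y * h y) x :=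
    pd_congr hΩ (fun y hy => div_mul_cancel₀ _ (hne y hy)) hx
  rw [pd_mul hψd hφd, pd_mul hhd hhd] at e
  have hφx := hne x hx
  field_simp at e ⊢
  linear_combination pd i φ x * e

theorem continuousOn_hardyRem (hΩ : IsOpen Ω) (hφ : ContDiffOn ℝ 1 φ Ω) (hne : ∀ x ∈ Ω, φ x ≠ 0)
    (hh : ContDiffOn ℝ 1 h Ω) : ContinuousOn (hardyRem φ h) Ω :=
  continuousOn_finsetSum _ fun i _ => ((continuousOn_pd hΩ hh i).sub
    ((hh.continuousOn.mul (continuousOn_pd hΩ hφ i)).div hφ.continuousOn hne)).pow 2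

theorem gradDot_update_zero (hu : ∀ k, DifferentiableAt ℝ (fun y => u y k) x)
    (hf : DifferentiableAt ℝ f x) (j : Fin n) :
    gradDot u (fun y => Function.update (0 : Fin n → ℝ) j (f y)) x =
      gradDotS (fun y => u y j) f x := by
  have hc : ∀ k, (fun y => Function.update (0 : Fin n → ℝ) j (f y) k) =
      if k = j then f else fun _ => 0 := fun k =>
    component_update (fun _ => (0 : Fin n → ℝ)) j k f
  rw [gradDot_eq_sum (differentiableAt_pi.2 hu)
    (differentiableAt_pi.2 fun k => by rw [hc]; split_ifs; exacts [hf, differentiableAt_const _])]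
  simp only [hc]
  rw [Finset.sum_eq_single j]
  · simp
  · intro k _ hk
    simp [hk, gradDotS_eq_sum_pd, pd_const]
  · simp

theorem dotR_update_zero (y : Fin n → ℝ) (j : Fin n) (z : ℝ) :
    dotR y (Function.update (0 : Fin n → ℝ) j z) = y j * z := by
  rw [dotR, Finset.sum_eq_single j]
  · simp
  · intro k _ hk
    simp [hk]
  · simp

theorem IsMinHarm.hardy_identity (hu : IsMinHarm Ω ubd u) (hΩ : IsOpen Ω) (hb : IsBounded Ω)
    {j : Fin n} (hne : ∀ x ∈ Ω, u x j ≠ 0) (hK : IsCompact K) (hKΩ : K ⊆ Ω)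
    (hh : ContDiffOn ℝ 1 h Ω) (h0 : ∀ x, x ∉ K → h x = 0) :
    IntegrableOn (hardyRem (fun x => u x j) h) Ω ∧
      ∫ x in Ω, (gradSqS h x - gradSq u x * h x ^ 2) =
        ∫ x in Ω, hardyRem (fun x => u x j) h x := by
  have huc := fun j => hu.1.component hΩ j
  have hhH : H10S Ω h := h10S_of_compact hΩ hb hK hKΩ hh h0
  set ψ : (Fin m → ℝ) → ℝ := fun y => h y * h y / u y j with hψd
  have hψ : H10S Ω ψ := h10S_of_compact hΩ hb hK hKΩ ((hh.mul hh).div (huc j).1 hne)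
    fun x hx => by simp [hψd, h0 x hx]
  have hrem : ∀ x ∈ Ω, hardyRem (fun x => u x j) h x =
      gradSqS h x - gradDotS (fun x => u x j) ψ x := fun x hx => by
    rw [gradDotS_div_eq hΩ (huc j).1 hne hh hx]; ring
  have hi := hhH.2.2.1.sub (integrableOn_gradDotS hΩ (huc j) hψ.h1c)
  have hirem : IntegrableOn (hardyRem (fun x => u x j) h) Ω :=
    hi.congr_fun (fun x hx => (hrem x hx).symm) hΩ.measurableSet
  refine ⟨hirem, ?_⟩
  have hiq : IntegrableOn (fun x => gradSq u x * h x ^ 2) Ω := by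
    have := integrableOn_mul_of_continuousOn hΩ hb (hhH.2.1.pow 2) (continuousOn_gradSq hΩ huc)
      (integrableOn_gradSq hΩ huc)
    exact this.congr (Filter.Eventually.of_forall fun x => mul_comm _ _)
  have hη : ∀ k, H1C Ω (fun x => Function.update (0 : Fin n → ℝ) j (ψ x) k) :=
    H1C.update (u := fun _ => 0) (fun k => H1C.of_contDiff hb contDiff_const) hψ.h1c j
  have hEL := hu.euler_lagrange hΩ hb hη fun x hx => by
    have : ψ x = 0 := hψ.2.2.2.2 hx
    simp [this]
  have hisub : IntegrableOn (fun x => gradSqS h x - gradSq u x * h x ^ 2) Ω := hhH.2.2.1.sub hiq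
  rw [← sub_eq_zero, ← integral_sub hisub hirem, ← hEL]
  refine setIntegral_congr_fun hΩ.measurableSet fun x hx => ?_
  rw [hrem x hx, gradDot_update_zero (fun k => (huc k).differentiableAt hΩ hx)
    (hψ.h1c.differentiableAt hΩ hx), dotR_update_zero]
  simp only [hψd]
  have := hne x hx
  field_simp
  ring

/-- Limit of the Hardy identity along truncations: the remainder is controlled by the quadratic
form. -/
theorem IsMinHarm.integral_hardyRem_le (hu : IsMinHarm Ω ubd u) (hΩ : IsOpen Ω) (hb : IsBounded Ω)
    {j : Fin n} (hne : ∀ x ∈ Ω, u x j ≠ 0) (hf : H10S Ω f) (k₀ : ℕ) :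
    IntegrableOn (hardyRem (fun x => u x j) f) (Ω ∩ {x | 2 * (1 / ((k₀ : ℝ) + 1)) < |f x|}) ∧
    ∫ x in Ω ∩ {x | 2 * (1 / ((k₀ : ℝ) + 1)) < |f x|}, hardyRem (fun x => u x j) f x ≤
      ∫ x in Ω, (gradSqS f x - gradSq u x * f x ^ 2) := by
  have huc := fun j => hu.1.component hΩ j
  obtain ⟨C, hC0, hC⟩ := exists_bound_deriv_trunc
  set S := Ω ∩ {x | 2 * (1 / ((k₀ : ℝ) + 1)) < |f x|} with hS
  have hSo : IsOpen S := hf.1.continuousOn.abs.isOpen_inter_preimage hΩ isOpen_Ioi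
  have hδ : ∀ k : ℕ, (0 : ℝ) < 1 / ((k : ℝ) + 1) := fun k => Nat.one_div_pos_of_nat
  set H : ℕ → (Fin m → ℝ) → ℝ :=
    fun k => Ω.indicator fun x => trunc (1 / ((k : ℝ) + 1)) (f x) with hH
  have hHc : ∀ k, ContDiffOn ℝ 1 (H k) Ω := fun k =>
    ((contDiff_trunc _).comp_contDiffOn hf.1).congr fun x hx => indicator_of_mem hx _
  have hid := fun k => hu.hardy_identity hΩ hb hne (isCompact_superlevel hb hf.2.1 _)
    (superlevel_subset hΩ hf.2.2.2.2 (hδ k)) (hHc k) fun x hx => trunc_indicator_eq_zero (hδ k) hx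
  have hHS : ∀ k, k₀ ≤ k → EqOn (H k) f S := by
    intro k hk x hx
    simp only [hH]
    rw [indicator_of_mem hx.1, trunc_eq_self (hδ k)]
    have : (1 : ℝ) / ((k : ℝ) + 1) ≤ 1 / ((k₀ : ℝ) + 1) := Nat.one_div_le_one_div hk
    have := hx.2
    simp only [mem_ofPred_eq] at this
    linarith
  have hrS : ∀ k, k₀ ≤ k →
      EqOn (hardyRem (fun x => u x j) (H k)) (hardyRem (fun x => u x j) f) S := by
    intro k hk x hx
    refine Finset.sum_congr rfl fun i _ => ?_
    rw [pd_congr hSo (hHS k hk) hx, hHS k hk hx]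
  refine ⟨((hid k₀).1.mono_set inter_subset_left).congr_fun (hrS k₀ le_rfl) hSo.measurableSet, ?_⟩
  have hge : ∀ k, k₀ ≤ k → ∫ x in S, hardyRem (fun x => u x j) f x ≤
      ∫ x in Ω, (gradSqS (H k) x - gradSq u x * H k x ^ 2) := by
    intro k hk
    rw [(hid k).2, ← setIntegral_congr_fun hSo.measurableSet (hrS k hk)]
    exact setIntegral_mono_set (hid k).1
      (Filter.Eventually.of_forall fun x => hardyRem_nonneg _ _ x)
      (Filter.Eventually.of_forall inter_subset_left)
  have hgS : ∀ k, ∀ x ∈ Ω, gradSqS (H k) x =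
      deriv (trunc (1 / ((k : ℝ) + 1))) (f x) ^ 2 * gradSqS f x := by
    intro k x hx
    rw [gradSqS_congr hΩ (fun y hy => indicator_of_mem hy _) hx,
      gradSqS_comp (((contDiff_trunc _).differentiable one_ne_zero _).hasDerivAt)
        (hf.h1c.differentiableAt hΩ hx)]
  have hiq : IntegrableOn (fun x => gradSq u x * f x ^ 2) Ω := by
    have := integrableOn_mul_of_continuousOn hΩ hb (hf.2.1.pow 2) (continuousOn_gradSq hΩ huc)
      (integrableOn_gradSq hΩ huc)
    exact this.congr (Filter.Eventually.of_forall fun x => mul_comm _ _)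
  have hlim := tendsto_integral_of_dominated_convergence (μ := volume.restrict Ω)
    (F := fun (k : ℕ) x => gradSqS (H k) x - gradSq u x * H k x ^ 2)
    (f := fun x => gradSqS f x - gradSq u x * f x ^ 2)
    (fun x => C ^ 2 * gradSqS f x + gradSq u x * f x ^ 2) (fun k => ?_)
    ((hf.2.2.1.const_mul _).add hiq) (fun k => ?_) ?_
  · exact ge_of_tendsto hlim (Filter.eventually_atTop.2 ⟨k₀, hge⟩)
  · refine ContinuousOn.aestronglyMeasurable ?_ hΩ.measurableSet
    exact (continuousOn_gradSqS hΩ (hHc k)).sub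
      ((continuousOn_gradSq hΩ huc).mul ((hHc k).continuousOn.pow 2))
  · refine (ae_restrict_iff' hΩ.measurableSet).2 (Filter.Eventually.of_forall fun x hx => ?_)
    rw [hgS k x hx, Real.norm_eq_abs]
    simp only [hH, indicator_of_mem hx]
    have h1 := abs_trunc_le (1 / ((k : ℝ) + 1)) (f x)
    have h2 : trunc (1 / ((k : ℝ) + 1)) (f x) ^ 2 ≤ f x ^ 2 := sq_le_sq.2 h1
    have h3 : deriv (trunc (1 / ((k : ℝ) + 1))) (f x) ^ 2 ≤ C ^ 2 :=
      sq_le_sq.2 ((hC _ _).trans (le_abs_self C))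
    have h4 := mul_le_mul_of_nonneg_right h3 (gradSqS_nonneg f x)
    have h5 := mul_le_mul_of_nonneg_left h2 (gradSq_nonneg u x)
    have h6 := mul_nonneg (sq_nonneg (deriv (trunc (1 / ((k : ℝ) + 1))) (f x))) (gradSqS_nonneg f x)
    have h7 := mul_nonneg (gradSq_nonneg u x) (sq_nonneg (trunc (1 / ((k : ℝ) + 1)) (f x)))
    rw [abs_le]
    constructor <;> linarith [gradSqS_nonneg f x]
  · refine (ae_restrict_iff' hΩ.measurableSet).2 ?_
    filter_upwards [ae_all_iff.2 (ae_pd_eq_zero_of_eq_zero hΩ hf.1)] with x hx0 hx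
    refine tendsto_const_nhds.congr' ?_
    filter_upwards [tendsto_trunc_seq (f x)] with k hk
    rw [hgS k x hx, hk.2]
    simp only [hH, indicator_of_mem hx, hk.1]
    by_cases hfx : f x = 0
    · have : gradSqS f x = 0 := by
        rw [gradSqS_eq_sum_pd]
        exact Finset.sum_eq_zero fun i _ => by rw [hx0 i hx hfx, sq, mul_zero]
      simp [this]
    · simp [hfx]

theorem IsMinHarm.integral_quadratic_nonneg (hu : IsMinHarm Ω ubd u) (hΩ : IsOpen Ω)
    (hb : IsBounded Ω) {j : Fin n} (hne : ∀ x ∈ Ω, u x j ≠ 0) (hf : H10S Ω f) :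
    0 ≤ ∫ x in Ω, (gradSqS f x - gradSq u x * f x ^ 2) :=
  le_trans (integral_nonneg fun x => hardyRem_nonneg _ _ x) (hu.integral_hardyRem_le hΩ hb hne hf 0).2

theorem IsMinHarm.pd_eq_of_quadratic_nonpos (hu : IsMinHarm Ω ubd u) (hΩ : IsOpen Ω)
    (hb : IsBounded Ω) {j : Fin n} (hne : ∀ x ∈ Ω, u x j ≠ 0) (hf : H10S Ω f)
    (hQ : ∫ x in Ω, (gradSqS f x - gradSq u x * f x ^ 2) ≤ 0) {x : Fin m → ℝ} (hx : x ∈ Ω)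
    (hfx : f x ≠ 0) (i : Fin m) : pd i f x = f x * pd i (fun y => u y j) x / u x j := by
  obtain ⟨k₀, hk₀⟩ := exists_nat_one_div_lt (half_pos (abs_pos.2 hfx))
  obtain ⟨hi, hle⟩ := hu.integral_hardyRem_le hΩ hb hne hf k₀
  have hSo : IsOpen (Ω ∩ {x | 2 * (1 / ((k₀ : ℝ) + 1)) < |f x|}) :=
    hf.1.continuousOn.abs.isOpen_inter_preimage hΩ isOpen_Ioi
  have hz := eqOn_zero_of_integral_eq_zero hSo
    ((continuousOn_hardyRem hΩ (hu.1.component hΩ j).1 hne hf.1).mono inter_subset_left)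
    (fun y _ => hardyRem_nonneg _ _ y) hi (hle.trans hQ)
    (show x ∈ _ from ⟨hx, by simp only [mem_ofPred_eq]; linarith⟩)
  have := (Finset.sum_eq_zero_iff_of_nonneg fun i _ => sq_nonneg _).1 hz i (Finset.mem_univ i)
  exact sub_eq_zero.1 (pow_eq_zero_iff two_ne_zero |>.1 this)

theorem exists_eq_const_of_pd (hΩ : IsOpen Ω) (hc : IsPreconnected Ω)
    (hf : ContDiffOn ℝ 1 f Ω) (h : ∀ x ∈ Ω, ∀ i, pd i f x = 0) : ∃ c, ∀ x ∈ Ω, f x = c :=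
  hΩ.exists_is_const_of_fderiv_eq_zero hc (hf.differentiableOn one_ne_zero)
    fun x hx => fderiv_eq_zero_of_pd (h x hx)

theorem exists_eq_const_mul_of_pd (hΩ : IsOpen Ω) (hc : IsPreconnected Ω)
    (hφ : ContDiffOn ℝ 1 φ Ω) (hne : ∀ x ∈ Ω, φ x ≠ 0) (hf : ContDiffOn ℝ 1 f Ω)
    (h : ∀ x ∈ Ω, f x ≠ 0 → ∀ i, pd i f x = f x * pd i φ x / φ x) :
    ∃ c, ∀ x ∈ Ω, f x = φ x * c := by
  have hζ : ContDiffOn ℝ 1 (fun y => f y / φ y) Ω := hf.div hφ hne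
  have hpd : ∀ x ∈ Ω, f x ≠ 0 → ∀ i, pd i (fun y => f y / φ y) x = 0 := by
    intro x hx hfx i
    have e : pd i (fun y => f y / φ y * φ y) x = pd i f x :=
      pd_congr hΩ (fun y hy => div_mul_cancel₀ _ (hne y hy)) hx
    rw [pd_mul (hζ.differentiableAt_of_isOpen hΩ hx) (hφ.differentiableAt_of_isOpen hΩ hx),
      h x hx hfx i] at e
    have hφx := hne x hx
    have : φ x ^ 2 * pd i (fun y => f y / φ y) x = 0 := by
      field_simp at e
      linarith
    exact (mul_eq_zero.1 this).resolve_left (pow_ne_zero 2 hφx)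
  obtain ⟨C, hC⟩ := exists_eq_const_of_pd hΩ hc (hζ.mul hζ) (f := fun y => f y / φ y * (f y / φ y))
    fun x hx i => by
      have hd := hζ.differentiableAt_of_isOpen hΩ hx
      rw [pd_mul hd hd]
      by_cases hfx : f x = 0
      · simp [hfx]
      · rw [hpd x hx hfx i]; ring
  by_cases hC0 : C = 0
  · refine ⟨0, fun x hx => ?_⟩
    have := hC x hx
    rw [hC0, mul_self_eq_zero, div_eq_zero_iff] at this
    rw [mul_zero]
    exact this.resolve_right (hne x hx)
  · have hfne : ∀ x ∈ Ω, f x ≠ 0 := fun x hx hfx => hC0 (by rw [← hC x hx, hfx]; simp)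
    obtain ⟨c, hcc⟩ := exists_eq_const_of_pd hΩ hc hζ fun x hx i => hpd x hx (hfne x hx) i
    refine ⟨c, fun x hx => ?_⟩
    rw [← hcc x hx]
    have := hne x hx
    field_simp

theorem normSq_add (y z : Fin n → ℝ) :
    normSq (fun j => y j + z j) = normSq y + 2 * dotR y z + normSq z := by
  simpa using normSq_add_smul y z 1

theorem gradSq_add (hu : ∀ j, DifferentiableAt ℝ (fun y => u y j) x)
    (hη : ∀ j, DifferentiableAt ℝ (fun y => w y j) x) :
    gradSq (fun y j => u y j + w y j) x = gradSq u x + 2 * gradDot u w x + gradSq w x := by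
  simpa using gradSq_add_smul hu hη 1

/-- The second variation at a minimiser vanishes in the direction of another minimiser. -/
theorem IsMinHarm.sum_integral_quadratic_eq_zero (hu : IsMinHarm Ω ubd u) (hw : IsMinHarm Ω ubd w)
    (hΩ : IsOpen Ω) (hb : IsBounded Ω) :
    ∑ k, ∫ x in Ω, (gradSqS (fun y => w y k - u y k) x -
      gradSq u x * (w x k - u x k) ^ 2) = 0 := by
  have huc := fun j => hu.1.component hΩ j
  have hwc := fun j => hw.1.component hΩ j
  set v : (Fin m → ℝ) → Fin n → ℝ := fun x k => w x k - u x k with hv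
  have hvc : ∀ k, H1C Ω (fun x => v x k) := fun k => (hwc k).sub hΩ hb (huc k)
  have hv0 : EqOn v 0 (frontier Ω) := fun x hx => by
    ext k
    simp only [hv, hw.1.1.2.2.2.2 hx, hu.1.1.2.2.2.2 hx, sub_self, Pi.zero_apply]
  have hwv : w = fun x k => u x k + v x k := by ext x k; simp [hv]
  have hEL := hu.euler_lagrange hΩ hb hvc hv0
  have hE : ∫ x in Ω, gradSq w x = ∫ x in Ω, gradSq u x :=
    le_antisymm (hw.integral_gradSq_le_sAdmissible hu.1) (hu.integral_gradSq_le_sAdmissible hw.1)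
  have hdot : ∀ x ∈ Ω, dotR (u x) (v x) = -(normSq (v x) / 2) := fun x hx => by
    have h1 := hw.1.2 x (subset_closure hx)
    rw [hwv, normSq_add, hu.1.2 x (subset_closure hx)] at h1
    linarith
  have hiq : ∀ k, IntegrableOn (fun x => gradSq u x * v x k ^ 2) Ω := fun k => by
    have := integrableOn_mul_of_continuousOn hΩ hb ((hvc k).2.1.pow 2) (continuousOn_gradSq hΩ huc)
      (integrableOn_gradSq hΩ huc)
    exact this.congr (Filter.Eventually.of_forall fun x => mul_comm _ _)
  have hisub : ∀ k, IntegrableOn (fun x => gradSqS (fun y => w y k - u y k) x -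
      gradSq u x * (w x k - u x k) ^ 2) Ω := fun k => (hvc k).2.2.sub (hiq k)
  have hi : IntegrableOn (fun x => gradDot u v x - gradSq u x * dotR (u x) (v x)) Ω :=
    (integrableOn_gradDot hΩ huc hvc).sub (integrableOn_gradSq_mul_dotR hΩ hb huc hvc)
  rw [← integral_finsetSum _ fun k _ => hisub k]
  have e : ∀ x ∈ Ω, ∑ k, (gradSqS (fun y => w y k - u y k) x - gradSq u x * (w x k - u x k) ^ 2) =
      gradSq w x + (-1) * gradSq u x +
        (-2) * (gradDot u v x - gradSq u x * dotR (u x) (v x)) := by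
    intro x hx
    have h1 : gradSq w x = gradSq u x + 2 * gradDot u v x + gradSq v x := by
      conv_lhs => rw [hwv]
      exact gradSq_add (fun k => (huc k).differentiableAt hΩ hx)
        (fun k => (hvc k).differentiableAt hΩ hx)
    rw [h1, hdot x hx, gradSq_eq_sum (differentiableAt_of_components hΩ hvc hx),
      Finset.sum_sub_distrib, ← Finset.mul_sum]
    simp only [hv, normSq]
    ring
  rw [setIntegral_congr_fun hΩ.measurableSet e,
    integral_add_mul_add_mul (integrableOn_gradSq hΩ hwc) (integrableOn_gradSq hΩ huc) hi, hE, hEL]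
  ring

/-- Two minimisers differ by a constant multiple of any component of the first one that is
positive or negative throughout the domain. -/
theorem IsMinHarm.exists_eq_add_mul (hu : IsMinHarm Ω ubd u) (hw : IsMinHarm Ω ubd w)
    (hΩ : IsOpen Ω) (hc : IsPreconnected Ω) (hb : IsBounded Ω) {j : Fin n}
    (hj : ∀ x ∈ frontier Ω, u x j = 0) (hne : ∀ x ∈ Ω, u x j ≠ 0) :
    ∃ c : Fin n → ℝ, ∀ x ∈ closure Ω, ∀ k, w x k = u x k + u x j * c k := by
  have huc := fun j => hu.1.component hΩ j
  have hwc := fun j => hw.1.component hΩ j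
  have hvc : ∀ k, H10S Ω (fun x => w x k - u x k) := fun k =>
    ((hwc k).sub hΩ hb (huc k)).h10S hb fun x hx => by
      simp only [hw.1.1.2.2.2.2 hx, hu.1.1.2.2.2.2 hx, sub_self, Pi.zero_apply]
  have hsum := hu.sum_integral_quadratic_eq_zero hw hΩ hb
  have hQ := (Finset.sum_eq_zero_iff_of_nonneg fun k _ =>
    hu.integral_quadratic_nonneg hΩ hb hne (hvc k)).1 hsum
  have hex : ∀ k, ∃ c, ∀ x ∈ Ω, w x k - u x k = u x j * c := fun k =>
    exists_eq_const_mul_of_pd hΩ hc (huc j).1 hne (hvc k).1 fun x hx hfx i =>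
      hu.pd_eq_of_quadratic_nonpos hΩ hb hne (hvc k) (hQ k (Finset.mem_univ k)).le hx hfx i
  choose c hcc using hex
  refine ⟨c, fun x hx k => ?_⟩
  by_cases hxΩ : x ∈ Ω
  · linarith [hcc k x hxΩ]
  · have hxf : x ∈ frontier Ω := by rw [hΩ.frontier_eq]; exact ⟨hx, hxΩ⟩
    rw [hj x hxf, hw.1.1.2.2.2.2 hxf, hu.1.1.2.2.2.2 hxf]
    ring

theorem dotR_relation_of_eq_add_mul (hΩ : IsOpen Ω) (hu : SAdmissible Ω ubd u)
    (hw : SAdmissible Ω ubd w) {j : Fin n} (hne : ∀ x ∈ Ω, u x j ≠ 0) {c : Fin n → ℝ}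
    (h : ∀ x ∈ closure Ω, ∀ k, w x k = u x k + u x j * c k) :
    ∀ x ∈ closure Ω, 2 * dotR (u x) c + u x j * normSq c = 0 := by
  have huc := fun j => hu.component hΩ j
  refine EqOn.of_subset_closure (s := Ω) (g := fun _ => (0 : ℝ)) (fun x hx => ?_) ?_
    continuousOn_const subset_closure subset_rfl
  · have h1 := hw.2 x (subset_closure hx)
    have h2 : w x = fun k => u x k + u x j * c k := funext (h x (subset_closure hx))
    rw [h2, normSq_add_smul, hu.2 x (subset_closure hx)] at h1
    have h3 : u x j * (2 * dotR (u x) c + u x j * normSq c) = 0 := by linarith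
    exact (mul_eq_zero.1 h3).resolve_left (hne x hx)
  · exact (continuousOn_const.mul (continuousOn_dotR (continuousOn_of_components huc)
      continuousOn_const)).add ((huc j).2.1.mul continuousOn_const)

end Hardy

section Lifting

theorem eq_of_exp_eq {f : ℝ → ℂ} (hf : Continuous f)
    (h : ∀ t, Complex.exp (f t) = Complex.exp (f 0)) (t : ℝ) : f t = f 0 :=
  congrFun (Complex.isCoveringMap_exp.eq_of_comp_eq hf (continuous_const (y := f 0))
    (funext fun s => Subtype.ext (h s)) 0 rfl) t

/-- A circle around `z₀` admits no continuous logarithm of `z - z₀`. -/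
theorem not_exp_eq_circle {H : ℝ → ℂ} (hH : Continuous H) (hper : H (2 * Real.pi) = H 0) {ρ : ℝ}
    {z₀ : ℂ} (hz₀ : ‖z₀‖ < ρ)
    (h : ∀ θ : ℝ, Complex.exp (H θ) = ρ * Complex.exp (θ * Complex.I) - z₀) : False := by
  have hρ : 0 < ρ := (norm_nonneg _).trans_lt hz₀
  have hρ' : (ρ : ℂ) ≠ 0 := by exact_mod_cast hρ.ne'
  set q : ℝ → ℂ := fun θ => 1 - z₀ * Complex.exp (-(θ * Complex.I)) / ρ with hq
  have hqc : Continuous q := by fun_prop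
  have hnorm : ∀ θ : ℝ, ‖z₀ * Complex.exp (-(θ * Complex.I)) / ρ‖ < 1 := fun θ => by
    have : ‖Complex.exp (-(θ * Complex.I))‖ = 1 := by
      have := Complex.norm_exp_ofReal_mul_I (-θ)
      simpa using this
    rw [norm_div, norm_mul, this, mul_one, Complex.norm_real, Real.norm_of_nonneg hρ.le,
      div_lt_one hρ]
    exact hz₀
  have hqs : ∀ θ, q θ ∈ Complex.slitPlane := fun θ => by
    left
    have := (Complex.re_le_norm _).trans_lt (hnorm θ)
    simp only [hq, Complex.sub_re, Complex.one_re]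
    linarith
  set D : ℝ → ℂ := fun θ => H θ - θ * Complex.I - Complex.log (q θ) with hD
  have hDc : Continuous D := (hH.sub (by fun_prop)).sub (hqc.clog hqs)
  have hDe : ∀ θ, Complex.exp (D θ) = ρ := fun θ => by
    have hqne := Complex.slitPlane_ne_zero (hqs θ)
    have hene := Complex.exp_ne_zero (θ * Complex.I)
    simp only [hD]
    rw [Complex.exp_sub, Complex.exp_sub, Complex.exp_log hqne, h, div_div, div_eq_iff
      (mul_ne_zero hene hqne)]
    simp only [hq]
    rw [Complex.exp_neg]
    field_simp
  have := eq_of_exp_eq hDc (fun θ => by rw [hDe, hDe]) (2 * Real.pi)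
  have hq2 : q (2 * Real.pi) = q 0 := by
    simp only [hq]
    rw [Complex.exp_neg]
    push_cast
    rw [Complex.exp_two_pi_mul_I]
    simp
  simp only [hD, hper, hq2] at this
  have h2 : ((2 * Real.pi : ℝ) : ℂ) * Complex.I = 0 := by
    have h0 : ((0 : ℝ) : ℂ) * Complex.I = 0 := by simp
    rw [h0] at this
    linear_combination -this
  simp at h2

/-- The plane `Fin 2 → ℝ` seen as `ℂ`. -/
def toC (x : Fin 2 → ℝ) : ℂ := ⟨x 0, x 1⟩

theorem toC_eq (x : Fin 2 → ℝ) : toC x = (x 0 : ℂ) + (x 1 : ℂ) * Complex.I :=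
  Complex.mk_eq_add_mul_I _ _

theorem continuous_toC : Continuous toC := by
  rw [show toC = fun x => (x 0 : ℂ) + (x 1 : ℂ) * Complex.I from funext toC_eq]
  fun_prop

theorem toC_injective : Function.Injective toC := fun x y h => by
  ext i
  fin_cases i
  · exact congrArg Complex.re h
  · exact congrArg Complex.im h

/-- The circle of radius `ρ` in the plane. -/
def circ (ρ θ : ℝ) : Fin 2 → ℝ := ![ρ * Real.cos θ, ρ * Real.sin θ]

theorem continuous_circ (ρ : ℝ) : Continuous (circ ρ) :=
  continuous_pi fun i => by fin_cases i <;> (simp [circ]; fun_prop)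

theorem toC_circ (ρ θ : ℝ) : toC (circ ρ θ) = ρ * Complex.exp (θ * Complex.I) := by
  rw [toC_eq, Complex.exp_mul_I]
  simp [circ]
  ring

theorem circ_two_pi (ρ : ℝ) : circ ρ (2 * Real.pi) = circ ρ 0 := by
  simp [circ]

variable {Ω : Set (Fin 2 → ℝ)}

theorem exists_lift {F : (Fin 2 → ℝ) → ℂ} (hF : Continuous F) (h0 : ∀ x, F x ≠ 0) :
    ∃ H : (Fin 2 → ℝ) → ℂ, Continuous H ∧ ∀ x, Complex.exp (H x) = F x := by
  have hsc : IsSimplyConnected (univ : Set (Fin 2 → ℝ)) :=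
    have := convex_univ.contractibleSpace (univ_nonempty (α := Fin 2 → ℝ))
    inferInstanceAs (SimplyConnectedSpace (univ : Set (Fin 2 → ℝ)))
  obtain ⟨H, hHc, hH⟩ := Complex.exists_continuousOn_eqOn_exp_comp hsc isOpen_univ
    hF.continuousOn (by simpa using h0)
  exact ⟨H, continuousOn_univ.1 hHc, fun x => hH (mem_univ x)⟩

/-- An integer-valued continuous function on the complement of a bounded simply connected domain
that extends continuously to the plane takes a single value. -/
theorem eq_circ_of_int_valued (hΩ : IsOpen Ω) (hsc : SimplyConnectedSpace Ω)
    {κ : (Fin 2 → ℝ) → ℝ} (hκ : Continuous κ) (hintg : ∀ x ∉ Ω, ∃ k : ℤ, κ x = k) {ρ : ℝ}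
    (hρ : ∀ x ∈ Ω, ‖toC x‖ < ρ) {p : Fin 2 → ℝ} (hp : p ∉ Ω) (hpρ : ‖toC p‖ < ρ) :
    κ p = κ (circ ρ 0) := by
  classical
  by_contra hne
  have hρ0 : 0 < ρ := (norm_nonneg _).trans_lt hpρ
  have hcirc : ∀ θ, circ ρ θ ∉ Ω := fun θ hθ => by
    have := hρ _ hθ
    rw [toC_circ, norm_mul, Complex.norm_exp_ofReal_mul_I, Complex.norm_real,
      Real.norm_of_nonneg hρ0.le, mul_one] at this
    exact this.false
  have hconst : ∀ θ, κ (circ ρ θ) = κ (circ ρ 0) := by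
    have hc : Continuous fun θ => ((κ (circ ρ θ) : ℂ) * (2 * Real.pi * Complex.I)) :=
      (Complex.continuous_ofReal.comp (hκ.comp (continuous_circ ρ))).mul continuous_const
    have he : ∀ θ, Complex.exp ((κ (circ ρ θ) : ℂ) * (2 * Real.pi * Complex.I)) = 1 := fun θ => by
      obtain ⟨k, hk⟩ := hintg _ (hcirc θ)
      rw [hk]
      push_cast
      exact Complex.exp_int_mul_two_pi_mul_I k
    intro θ
    have := eq_of_exp_eq hc (fun t => by rw [he, he]) θ
    have := mul_right_cancel₀ Complex.two_pi_I_ne_zero this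
    exact_mod_cast this
  set k := κ (circ ρ 0) with hk
  have hdich : ∀ x ∉ Ω, κ x = k ∨ 1 ≤ |κ x - k| := by
    intro x hx
    obtain ⟨l, hl⟩ := hintg x hx
    obtain ⟨l', hl'⟩ := hintg _ (hcirc 0)
    rw [← hk] at hl'
    rw [hl, hl']
    by_cases h : l = l'
    · left; rw [h]
    · right
      have : 1 ≤ |l - l'| := Int.one_le_abs (sub_ne_zero.2 h)
      exact_mod_cast this
  obtain ⟨L, hLc, hL⟩ := Complex.exists_continuousOn_eqOn_exp_comp
    (X := Fin 2 → ℝ) (U := Ω) hsc hΩ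
    (g := fun x => toC x - toC p) (continuous_toC.sub continuous_const).continuousOn (by
      rintro ⟨x, hx, h⟩
      exact hp (toC_injective (sub_eq_zero.1 h) ▸ hx))
  set χ : (Fin 2 → ℝ) → ℝ := fun x => max 0 (min 1 (2 * |κ x - k| - 1 / 2)) with hχ
  have hχc : Continuous χ := by fun_prop
  set F : (Fin 2 → ℝ) → ℂ := fun x => if x ∈ Ω then Complex.exp ((1 - (χ x : ℂ)) * L x)
    else if κ x = k then toC x - toC p else 1 with hFdef
  have hFfar : ∀ x, 3 / 4 < |κ x - k| → F x = 1 := by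
    intro x hx
    have h1 : χ x = 1 := by
      simp only [hχ]
      rw [min_eq_left (by linarith), max_eq_right zero_le_one]
    simp only [hFdef, h1]
    have : κ x ≠ k := fun h => by rw [h] at hx; norm_num at hx
    simp [this]
  have hFnear : ∀ x, |κ x - k| < 1 / 4 → F x = toC x - toC p := by
    intro x hx
    have h1 : χ x = 0 := by
      simp only [hχ]
      exact max_eq_left ((min_le_right _ _).trans (by linarith))
    simp only [hFdef, h1]
    split_ifs with h2 h3
    · simpa using hL h2
    · rfl
    · rcases hdich x h2 with h | h
      · exact absurd h h3
      · linarith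
  have hκa : Continuous fun x => |κ x - k| := by fun_prop
  have hcover : ∀ x, x ∈ Ω ∨ 3 / 4 < |κ x - k| ∨ |κ x - k| < 1 / 4 := by
    intro x
    by_cases hx : x ∈ Ω
    · exact Or.inl hx
    · rcases hdich x hx with h | h
      · right; right; rw [h]; norm_num
      · right; left; linarith
  have hpfar : 1 ≤ |κ p - k| := (hdich p hp).resolve_left hne
  have hFc : Continuous F := by
    rw [continuous_iff_continuousAt]
    intro x
    rcases hcover x with hx | hx | hx
    · have h1 : ContinuousOn (fun x => Complex.exp ((1 - (χ x : ℂ)) * L x)) Ω :=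
        Complex.continuous_exp.comp_continuousOn
          ((continuous_const.sub (Complex.continuous_ofReal.comp hχc)).continuousOn.mul hLc)
      refine (h1.continuousAt (hΩ.mem_nhds hx)).congr ?_
      filter_upwards [hΩ.mem_nhds hx] with y hy
      simp only [hFdef, hy, if_true]
    · refine (continuousAt_const (y := (1 : ℂ))).congr ?_
      filter_upwards [(isOpen_lt continuous_const hκa).mem_nhds hx] with y hy
      exact (hFfar y hy).symm
    · refine (continuous_toC.sub (continuous_const (y := toC p))).continuousAt.congr ?_
      filter_upwards [(isOpen_lt hκa continuous_const).mem_nhds hx] with y hy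
      exact (hFnear y hy).symm
  have hF0 : ∀ x, F x ≠ 0 := by
    intro x
    rcases hcover x with hx | hx | hx
    · simp only [hFdef, hx, if_true]
      exact Complex.exp_ne_zero _
    · rw [hFfar x hx]; exact one_ne_zero
    · rw [hFnear x hx]
      intro h
      rw [toC_injective (sub_eq_zero.1 h)] at hx
      linarith
  obtain ⟨H, hHc, hH⟩ := exists_lift hFc hF0
  refine not_exp_eq_circle (H := fun θ => H (circ ρ θ)) (hHc.comp (continuous_circ ρ))
    (by simp only [circ_two_pi]) hpρ fun θ => ?_
  rw [hH, hFnear _ (by rw [hconst]; simp), toC_circ]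

/-- A circle-valued map on a bounded simply connected domain that equals `1` on the boundary has a
continuous angle vanishing on the boundary. -/
theorem exists_angle (hΩ : IsOpen Ω) (hb : IsBounded Ω) (hsc : SimplyConnectedSpace Ω)
    {c s : (Fin 2 → ℝ) → ℝ} (hc : ContinuousOn c (closure Ω)) (hs : ContinuousOn s (closure Ω))
    (hcs : ∀ x ∈ closure Ω, c x ^ 2 + s x ^ 2 = 1) (hc1 : ∀ x ∈ frontier Ω, c x = 1)
    (hs0 : ∀ x ∈ frontier Ω, s x = 0) :
    ∃ ψ : (Fin 2 → ℝ) → ℝ, Continuous ψ ∧ (∀ x ∈ closure Ω, Real.cos (ψ x) = c x) ∧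
      (∀ x ∈ closure Ω, Real.sin (ψ x) = s x) ∧ ∀ x ∈ frontier Ω, ψ x = 0 := by
  classical
  set F : (Fin 2 → ℝ) → ℂ := fun x => if x ∈ closure Ω then (c x : ℂ) + s x * Complex.I else 1
    with hFdef
  have hFon : ∀ x ∈ closure Ω, F x = (c x : ℂ) + s x * Complex.I := fun x hx => if_pos hx
  have hFc : Continuous F := by
    refine continuous_if (p := fun x => x ∈ closure Ω) (fun x hx => ?_) ?_ continuousOn_const
    · have hx' : x ∈ frontier Ω := frontier_closure_subset hx
      rw [hc1 x hx', hs0 x hx']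
      simp
    · rw [show {x | x ∈ closure Ω} = closure Ω from rfl, closure_closure]
      exact (Complex.continuous_ofReal.comp_continuousOn hc).add
        ((Complex.continuous_ofReal.comp_continuousOn hs).mul continuousOn_const)
  have hFout : ∀ x ∉ Ω, F x = 1 := by
    intro x hx
    by_cases hxc : x ∈ closure Ω
    · have hxf : x ∈ frontier Ω := by rw [hΩ.frontier_eq]; exact ⟨hxc, hx⟩
      rw [hFon x hxc, hc1 x hxf, hs0 x hxf]
      simp
    · exact if_neg hxc
  have hFnorm : ∀ x, ‖F x‖ = 1 := by
    intro x
    by_cases hxc : x ∈ closure Ω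
    · rw [hFon x hxc, Complex.norm_add_mul_I, hcs x hxc, Real.sqrt_one]
    · rw [hFout x fun h => hxc (subset_closure h), norm_one]
  obtain ⟨H, hHc, hH⟩ := exists_lift hFc fun x h => by
    have := hFnorm x
    rw [h, norm_zero] at this
    exact zero_ne_one this
  have hre : ∀ x, (H x).re = 0 := fun x => by
    have := hFnorm x
    rw [← hH, Complex.norm_exp] at this
    exact Real.exp_eq_one_iff _ |>.1 this
  have hcos : ∀ x, Real.cos (H x).im = (F x).re := fun x => by
    rw [← hH, Complex.exp_re, hre, Real.exp_zero, one_mul]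
  have hsin : ∀ x, Real.sin (H x).im = (F x).im := fun x => by
    rw [← hH, Complex.exp_im, hre, Real.exp_zero, one_mul]
  have h2π : (0 : ℝ) < 2 * Real.pi := Real.two_pi_pos
  have hintg : ∀ x ∉ Ω, ∃ k : ℤ, (H x).im / (2 * Real.pi) = k := fun x hx => by
    obtain ⟨k, hk⟩ := (Real.cos_eq_one_iff (H x).im).1 (by rw [hcos, hFout x hx]; rfl)
    exact ⟨k, by rw [← hk, mul_div_cancel_right₀ _ h2π.ne']⟩
  obtain ⟨ρ, hρ⟩ := hb.isCompact_closure.exists_bound_of_continuousOn continuous_toC.continuousOn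
  have hρ0 : 0 ≤ |ρ| + 1 := by positivity
  have hρ' : ∀ x ∈ closure Ω, ‖toC x‖ < |ρ| + 1 := fun x hx =>
    (hρ x hx).trans_lt ((le_abs_self ρ).trans_lt (lt_add_one _))
  have hout : circ (|ρ| + 1) 0 ∉ Ω := fun h => by
    have := hρ' _ (subset_closure h)
    rw [toC_circ, norm_mul, Complex.norm_exp_ofReal_mul_I, Complex.norm_real,
      Real.norm_of_nonneg hρ0, mul_one] at this
    exact this.false
  have hψc : Continuous fun x => (H x).im := Complex.continuous_im.comp hHc
  obtain ⟨k, hk⟩ := hintg _ hout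
  refine ⟨fun x => (H x).im - k * (2 * Real.pi), hψc.sub continuous_const, fun x hx => ?_,
    fun x hx => ?_, fun x hx => ?_⟩
  · rw [Real.cos_sub_int_mul_two_pi, hcos, hFon x hx]; simp
  · rw [Real.sin_sub_int_mul_two_pi, hsin, hFon x hx]; simp
  · have hxΩ : x ∉ Ω := by rw [hΩ.frontier_eq] at hx; exact hx.2
    have := eq_circ_of_int_valued hΩ hsc (hψc.div_const (2 * Real.pi)) hintg
      (fun y hy => hρ' y (subset_closure hy)) hxΩ (hρ' x (frontier_subset_closure hx))
    rw [hk, div_eq_iff h2π.ne'] at this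
    exact sub_eq_zero.2 this

theorem contDiffOn_of_cos_sin (hΩ : IsOpen Ω) {ψ c s : (Fin 2 → ℝ) → ℝ} (hψ : Continuous ψ)
    (hc : ContDiffOn ℝ 1 c Ω) (hs : ContDiffOn ℝ 1 s Ω) (hcos : ∀ x ∈ Ω, Real.cos (ψ x) = c x)
    (hsin : ∀ x ∈ Ω, Real.sin (ψ x) = s x) : ContDiffOn ℝ 1 ψ Ω := by
  intro p hp
  have hp2 : ContDiffAt ℝ 1 (fun x => ψ p + Real.arcsin (s x * c p - c x * s p)) p := by
    have h1 : ContDiffAt ℝ 1 (fun x => s x * c p - c x * s p) p :=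
      ((hs.contDiffAt (hΩ.mem_nhds hp)).mul contDiffAt_const).sub
        ((hc.contDiffAt (hΩ.mem_nhds hp)).mul contDiffAt_const)
    refine contDiffAt_const.add
      (ContDiffAt.comp (g := Real.arcsin) p (Real.contDiffAt_arcsin ?_ ?_) h1) <;>
      (rw [mul_comm, sub_self]; norm_num)
  refine (hp2.congr_of_eventuallyEq ?_).contDiffWithinAt
  have hnear : ∀ᶠ x in nhds p, |ψ x - ψ p| < Real.pi / 2 := by
    have := (hψ.sub continuous_const).abs.tendsto' p (|ψ p - ψ p|) rfl
    refine this.eventually (gt_mem_nhds ?_)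
    rw [sub_self, abs_zero]
    exact Real.pi_div_two_pos
  filter_upwards [hΩ.mem_nhds hp, hnear] with x hx hxp
  rw [← hcos x hx, ← hcos p hp, ← hsin x hx, ← hsin p hp, ← Real.sin_sub,
    Real.arcsin_sin (abs_lt.1 hxp).1.le (abs_lt.1 hxp).2.le]
  ring

end Lifting

section Explicit

variable {n : ℕ} {a : ℝ} {Ω : Set (Fin 2 → ℝ)} {w : (Fin 2 → ℝ) → Fin n → ℝ} {x : Fin 2 → ℝ}

theorem uA_zero (hn : 2 ≤ n) : uA n a x ⟨0, by lia⟩ = Real.cos (a * x 0) := rfl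

theorem uA_one (hn : 2 ≤ n) : uA n a x ⟨1, by lia⟩ = Real.sin (a * x 0) := rfl

theorem uA_of_two_le {j : Fin n} (hj : 2 ≤ (j : ℕ)) : uA n a x j = 0 := by
  simp only [uA]
  rw [if_neg (by lia), if_neg (by lia)]

theorem sum_eq_of_two_le (hn : 2 ≤ n) {F : Fin n → ℝ} (hF : ∀ j : Fin n, 2 ≤ (j : ℕ) → F j = 0) :
    ∑ j, F j = F ⟨0, by lia⟩ + F ⟨1, by lia⟩ := by
  refine Fintype.sum_eq_add _ _ (by simp) fun j hj => hF j ?_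
  have h0 : (j : ℕ) ≠ 0 := fun h => hj.1 (Fin.ext h)
  have h1 : (j : ℕ) ≠ 1 := fun h => hj.2 (Fin.ext h)
  lia

theorem pd_apply_zero (i : Fin 2) : pd i (fun y : Fin 2 → ℝ => y 0) x = if i = 0 then 1 else 0 := by
  have : HasFDerivAt (fun y : Fin 2 → ℝ => y 0)
      (ContinuousLinearMap.proj (R := ℝ) (φ := fun _ : Fin 2 => ℝ) 0) x :=
    (ContinuousLinearMap.proj (R := ℝ) (φ := fun _ : Fin 2 => ℝ) 0).hasFDerivAt
  rw [pd, this.fderiv, ContinuousLinearMap.proj_apply, Pi.single_apply]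
  simp [eq_comm]

theorem contDiff_phase (a : ℝ) : ContDiff ℝ 1 (fun y : Fin 2 → ℝ => a * y 0) :=
  contDiff_const.mul (contDiff_apply ℝ ℝ 0)

theorem differentiableAt_phase (a : ℝ) (x : Fin 2 → ℝ) :
    DifferentiableAt ℝ (fun y : Fin 2 → ℝ => a * y 0) x :=
  (contDiff_phase a).differentiable one_ne_zero x

theorem pd_phase (i : Fin 2) : pd i (fun y : Fin 2 → ℝ => a * y 0) x = if i = 0 then a else 0 := by
  rw [pd_const_mul a (by fun_prop), pd_apply_zero]
  simp

theorem gradSqS_phase : gradSqS (fun y : Fin 2 → ℝ => a * y 0) x = a ^ 2 := by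
  rw [gradSqS_eq_sum_pd]
  simp [pd_phase]

theorem gradSqS_cos_add_gradSqS_sin {θ : (Fin 2 → ℝ) → ℝ} (hθ : DifferentiableAt ℝ θ x) :
    gradSqS (fun y => Real.cos (θ y)) x + gradSqS (fun y => Real.sin (θ y)) x = gradSqS θ x := by
  rw [gradSqS_comp (Real.hasDerivAt_cos _) hθ, gradSqS_comp (Real.hasDerivAt_sin _) hθ]
  linear_combination gradSqS θ x * Real.sin_sq_add_cos_sq (θ x)

theorem h1c_cos_phase (hb : IsBounded Ω) (a : ℝ) : H1C Ω (fun x => Real.cos (a * x 0)) :=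
  H1C.of_contDiff hb (Real.contDiff_cos.comp (contDiff_phase a))

theorem h1c_sin_phase (hb : IsBounded Ω) (a : ℝ) : H1C Ω (fun x => Real.sin (a * x 0)) :=
  H1C.of_contDiff hb (Real.contDiff_sin.comp (contDiff_phase a))

theorem h1c_uA (hb : IsBounded Ω) (j : Fin n) : H1C Ω (fun x => uA n a x j) := by
  by_cases h0 : (j : ℕ) = 0
  · simp only [uA, h0, if_true]
    exact h1c_cos_phase hb a
  · by_cases h1 : (j : ℕ) = 1
    · simp only [uA, h1]
      simpa using h1c_sin_phase hb a
    · simp only [uA, h0, h1, if_false]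
      exact H1C.of_contDiff hb contDiff_const

theorem normSq_uA (hn : 2 ≤ n) : normSq (uA n a x) = 1 := by
  rw [normSq, sum_eq_of_two_le hn fun j hj => by rw [uA_of_two_le hj, sq, mul_zero], uA_zero hn,
    uA_one hn, Real.cos_sq_add_sin_sq]

theorem sAdmissible_uA (hn : 2 ≤ n) (hΩ : IsOpen Ω) (hb : IsBounded Ω) :
    SAdmissible Ω (uA n a) (uA n a) :=
  ⟨admissible_of_components hΩ hb (fun j => h1c_uA hb j) fun _ _ => rfl, fun _ _ => normSq_uA hn⟩

theorem gradSqS_zero : gradSqS (fun _ : Fin 2 → ℝ => (0 : ℝ)) x = 0 := by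
  rw [gradSqS_eq_sum_pd]
  simp [pd_const]

theorem gradSq_uA (hn : 2 ≤ n) : gradSq (uA n a) x = a ^ 2 := by
  have hd : DifferentiableAt ℝ (uA n a) x :=
    differentiableAt_of_components Metric.isOpen_ball (fun j => h1c_uA Metric.isBounded_ball j)
      (Metric.mem_ball_self one_pos)
  rw [gradSq_eq_sum hd, sum_eq_of_two_le hn fun j hj => by
    simp only [uA_of_two_le hj, gradSqS_zero]]
  simp only [uA_zero hn, uA_one hn]
  rw [gradSqS_cos_add_gradSqS_sin (differentiableAt_phase a x), gradSqS_phase]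

/-- An `𝕊ⁿ⁻¹`-valued map with the boundary values of `u_a` and image in the horizontal plane has
a phase `a x₁ + ψ` with `ψ` vanishing on the boundary. -/
theorem exists_phase (hn : 2 ≤ n) (hΩ : IsOpen Ω) (hb : IsBounded Ω) (hsc : SimplyConnectedSpace Ω)
    (hw : SAdmissible Ω (uA n a) w) (hhor : ∀ x ∈ Ω, w x ∈ horizontal n) :
    ∃ ψ : (Fin 2 → ℝ) → ℝ, H10S Ω ψ ∧ ∀ x ∈ closure Ω, w x = fun j : Fin n =>
      if (j : ℕ) = 0 then Real.cos (a * x 0 + ψ x)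
        else if (j : ℕ) = 1 then Real.sin (a * x 0 + ψ x) else 0 := by
  have hwc := fun j => hw.component hΩ j
  set i0 : Fin n := ⟨0, by lia⟩ with hi0
  set i1 : Fin n := ⟨1, by lia⟩ with hi1
  have hhor' : ∀ x ∈ closure Ω, ∀ j : Fin n, 2 ≤ (j : ℕ) → w x j = 0 := fun x hx j hj => by
    by_cases hxΩ : x ∈ Ω
    · exact hhor x hxΩ j hj
    · rw [hw.1.2.2.2.2 (by rw [hΩ.frontier_eq]; exact ⟨hx, hxΩ⟩), uA_of_two_le hj]
  have hnorm : ∀ x ∈ closure Ω, w x i0 ^ 2 + w x i1 ^ 2 = 1 := fun x hx => by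
    rw [← hw.2 x hx, normSq, sum_eq_of_two_le hn fun j hj => by rw [hhor' x hx j hj, sq, mul_zero]]
  have hC := h1c_cos_phase hb a
  have hS := h1c_sin_phase hb a
  set c : (Fin 2 → ℝ) → ℝ :=
    fun x => w x i0 * Real.cos (a * x 0) + w x i1 * Real.sin (a * x 0) with hc
  set s : (Fin 2 → ℝ) → ℝ :=
    fun x => w x i1 * Real.cos (a * x 0) - w x i0 * Real.sin (a * x 0) with hs
  have hcH : H1C Ω c := ((hwc i0).mul hΩ hb hC).add hΩ ((hwc i1).mul hΩ hb hS)
  have hsH : H1C Ω s := ((hwc i1).mul hΩ hb hC).sub hΩ hb ((hwc i0).mul hΩ hb hS)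
  have hbd : ∀ x ∈ frontier Ω, w x i0 = Real.cos (a * x 0) ∧ w x i1 = Real.sin (a * x 0) :=
    fun x hx => by
      rw [hw.1.2.2.2.2 hx]
      exact ⟨uA_zero hn, uA_one hn⟩
  obtain ⟨ψ, hψ, hcos, hsin, h0⟩ := exists_angle hΩ hb hsc hcH.2.1 hsH.2.1
    (fun x hx => by
      simp only [hc, hs]
      linear_combination (Real.sin (a * x 0) ^ 2 + Real.cos (a * x 0) ^ 2) * hnorm x hx +
        Real.sin_sq_add_cos_sq (a * x 0))
    (fun x hx => by
      simp only [hc, (hbd x hx).1, (hbd x hx).2]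
      linear_combination Real.sin_sq_add_cos_sq (a * x 0))
    (fun x hx => by
      simp only [hs, (hbd x hx).1, (hbd x hx).2]
      ring)
  have hψd : ContDiffOn ℝ 1 ψ Ω := contDiffOn_of_cos_sin hΩ hψ hcH.1 hsH.1
    (fun x hx => hcos x (subset_closure hx)) (fun x hx => hsin x (subset_closure hx))
  have hgrad : ∀ x ∈ Ω, gradSqS c x + gradSqS s x = gradSqS ψ x := fun x hx => by
    rw [← gradSqS_cos_add_gradSqS_sin (hψd.differentiableAt_of_isOpen hΩ hx),
      gradSqS_congr hΩ (fun y hy => hcos y (subset_closure hy)) hx,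
      gradSqS_congr hΩ (fun y hy => hsin y (subset_closure hy)) hx]
  have hψH : H1C Ω ψ := ⟨hψd, hψ.continuousOn,
    (hcH.2.2.add hsH.2.2).congr_fun hgrad hΩ.measurableSet⟩
  refine ⟨ψ, hψH.h10S hb h0, fun x hx => ?_⟩
  have h1 := Real.sin_sq_add_cos_sq (a * x 0)
  ext j
  split_ifs with hj0 hj1
  · rw [show j = i0 from Fin.ext hj0, Real.cos_add, hcos x hx, hsin x hx]
    simp only [hc, hs]
    linear_combination -(w x i0) * h1
  · rw [show j = i1 from Fin.ext hj1, Real.sin_add, hcos x hx, hsin x hx]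
    simp only [hc, hs]
    linear_combination -(w x i1) * h1
  · exact hhor' x hx j (by lia)

theorem exists_mem_frontier_apply_zero_eq (hΩ : IsOpen Ω) (hb : IsBounded Ω) (hx : x ∈ Ω) :
    ∃ y ∈ frontier Ω, y 0 = x 0 := by
  obtain ⟨R, hR⟩ := hb.exists_norm_le
  have hconv : Convex ℝ {y : Fin 2 → ℝ | y 0 = x 0} :=
    (convex_singleton (x 0)).linear_preimage (LinearMap.proj (R := ℝ) (φ := fun _ => ℝ) (0 : Fin 2))
  by_contra! hno
  have hout : (![x 0, |R| + 1] : Fin 2 → ℝ) ∉ Ω := fun h => by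
    have h1 := (norm_le_pi_norm (![x 0, |R| + 1] : Fin 2 → ℝ) 1).trans (hR _ h)
    have h2 : ‖(![x 0, |R| + 1] : Fin 2 → ℝ) 1‖ = |R| + 1 := by
      simp only [Matrix.cons_val_one, Matrix.cons_val_zero]
      exact Real.norm_of_nonneg (by positivity)
    linarith [le_abs_self R]
  have hdich : ∀ y : Fin 2 → ℝ, y 0 = x 0 → y ∈ Ω ∨ y ∈ (closure Ω)ᶜ := fun y hy => by
    by_contra! h
    exact hno y (by rw [hΩ.frontier_eq]; exact ⟨not_notMem.1 h.2, h.1⟩) hy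
  obtain ⟨z, -, hz, hz'⟩ := hconv.isPreconnected Ω (closure Ω)ᶜ hΩ isClosed_closure.isOpen_compl
    hdich ⟨x, rfl, hx⟩ ⟨![x 0, |R| + 1], rfl, (hdich ![x 0, |R| + 1] rfl).resolve_left hout⟩
  exact hz' (subset_closure hz)

/-- Among horizontal maps `u_a` has the least energy, and only `u_a` attains it. -/
theorem integral_gradSq_of_horizontal (hn : 2 ≤ n) (hΩ : IsOpen Ω)
    (hc : IsPreconnected Ω) (hb : IsBounded Ω) (hsc : SimplyConnectedSpace Ω)
    (hw : SAdmissible Ω (uA n a) w) (hhor : ∀ x ∈ Ω, w x ∈ horizontal n) :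
    ∫ x in Ω, gradSq (uA n a) x ≤ ∫ x in Ω, gradSq w x ∧
    (∫ x in Ω, gradSq w x ≤ ∫ x in Ω, gradSq (uA n a) x → EqOn w (uA n a) (closure Ω)) := by
  obtain ⟨ψ, hψ, hwψ⟩ := exists_phase hn hΩ hb hsc hw hhor
  have hwc := fun j => hw.component hΩ j
  have hgrad : ∀ x ∈ Ω, gradSq w x = gradSqS ψ x + (2 * a) * pd 0 ψ x + 1 * gradSq (uA n a) x := by
    intro x hx
    have hd := hψ.h1c.differentiableAt hΩ hx
    have hcomp : ∀ j : Fin n, EqOn (fun y => w y j) (fun y => if (j : ℕ) = 0 then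
        Real.cos (a * y 0 + ψ y) else if (j : ℕ) = 1 then Real.sin (a * y 0 + ψ y) else 0) Ω :=
      fun j y hy => congrFun (hwψ y (subset_closure hy)) j
    rw [gradSq_eq_sum (differentiableAt_of_components hΩ hwc hx), sum_eq_of_two_le hn fun j hj => by
      rw [gradSqS_congr hΩ (hcomp j) hx]
      have h0 : (j : ℕ) ≠ 0 := by lia
      have h1 : (j : ℕ) ≠ 1 := by lia
      simp only [h0, h1, if_false, gradSqS_zero],
      gradSqS_congr hΩ (hcomp _) hx, gradSqS_congr hΩ (hcomp ⟨1, by lia⟩) hx]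
    simp only [if_true, one_ne_zero, if_false]
    rw [gradSqS_cos_add_gradSqS_sin ((differentiableAt_phase a x).fun_add hd),
      gradSqS_add (differentiableAt_phase a x) hd, gradSqS_phase, gradSq_uA hn,
      gradDotS_eq_sum_pd]
    simp [pd_phase]
    ring
  have hE : ∫ x in Ω, gradSq w x = (∫ x in Ω, gradSqS ψ x) + ∫ x in Ω, gradSq (uA n a) x := by
    rw [setIntegral_congr_fun hΩ.measurableSet hgrad,
      integral_add_mul_add_mul hψ.2.2.1 (integrableOn_pd hΩ hb hψ.h1c 0)
        (integrableOn_gradSq (u := uA n a) hΩ fun j => h1c_uA hb j), integral_pd_eq_zero hΩ hb hψ 0]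
    ring
  have hpos : 0 ≤ ∫ x in Ω, gradSqS ψ x := integral_nonneg fun x => gradSqS_nonneg ψ x
  refine ⟨by linarith, fun hle => ?_⟩
  have hz := eqOn_zero_of_integral_eq_zero hΩ (continuousOn_gradSqS hΩ hψ.1)
    (fun x _ => gradSqS_nonneg ψ x) hψ.2.2.1 (by linarith)
  obtain ⟨C, hC⟩ := exists_eq_const_of_pd hΩ hc hψ.1 fun x hx i => by
    have h0 : ∑ i, pd i ψ x ^ 2 = 0 := by rw [← gradSqS_eq_sum_pd]; exact hz hx
    exact pow_eq_zero_iff two_ne_zero |>.1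
      ((Finset.sum_eq_zero_iff_of_nonneg fun i _ => sq_nonneg _).1 h0 i (Finset.mem_univ i))
  have hC' : EqOn ψ (fun _ => C) (closure Ω) :=
    EqOn.of_subset_closure hC hψ.2.1 continuousOn_const subset_closure subset_rfl
  intro x hx
  obtain ⟨p, hp⟩ : Ω.Nonempty := closure_nonempty_iff.1 ⟨x, hx⟩
  obtain ⟨y, hy, -⟩ := exists_mem_frontier_apply_zero_eq hΩ hb hp
  have hC0 : C = 0 := (hC' (frontier_subset_closure hy)).symm.trans (hψ.2.2.2.2 hy)
  rw [hwψ x hx, hC' hx, hC0]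
  simp only [add_zero]
  rfl

variable {lam : ℝ}

theorem sub_integral_nonneg_of_poincare (hle : a ^ 2 ≤ lam)
    (hlam : IsFirstEigenvalue Ω lam) {φ : (Fin 2 → ℝ) → ℝ} (hφ : H10S Ω φ) :
    0 ≤ ∫ x in Ω, (gradSqS φ x - a ^ 2 * φ x ^ 2) := by
  have h1 := hlam.1 φ hφ
  have h2 : 0 ≤ ∫ x in Ω, φ x ^ 2 := integral_nonneg fun x => sq_nonneg _
  rw [integral_sub hφ.2.2.1 (hφ.2.2.2.1.const_mul _), integral_const_mul]
  nlinarith [mul_le_mul_of_nonneg_right hle h2]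

theorem isMinHarm_uA (hn : 2 ≤ n) (hΩ : IsOpen Ω) (hb : IsBounded Ω) (hle : a ^ 2 ≤ lam)
    (hlam : IsFirstEigenvalue Ω lam) : IsMinHarm Ω (uA n a) (uA n a) := by
  refine ⟨sAdmissible_uA hn hΩ hb, fun w hw => ?_⟩
  have huc : ∀ j, H1C Ω (fun x => uA n a x j) := fun j => h1c_uA hb j
  have hwc := fun j => hw.component hΩ j
  set v : (Fin 2 → ℝ) → Fin n → ℝ := fun x k => w x k - uA n a x k with hv
  have hvc : ∀ k, H10S Ω (fun x => v x k) := fun k =>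
    ((hwc k).sub hΩ hb (huc k)).h10S hb fun x hx => by
      simp only [hv, hw.1.2.2.2.2 hx, sub_self, Pi.zero_apply]
  have hwv : w = fun x k => uA n a x k + v x k := by ext x k; simp [hv]
  set i0 : Fin n := ⟨0, by lia⟩ with hi0
  set i1 : Fin n := ⟨1, by lia⟩ with hi1
  have hC := h1c_cos_phase hb a (Ω := Ω)
  have hS := h1c_sin_phase hb a (Ω := Ω)
  set q : (Fin 2 → ℝ) → ℝ :=
    fun x => Real.cos (a * x 0) * v x i1 - Real.sin (a * x 0) * v x i0 with hq
  have hqH : H10S Ω q := ((hC.mul hΩ hb (hvc i1).h1c).sub hΩ hb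
    (hS.mul hΩ hb (hvc i0).h1c)).h10S hb fun x hx => by
      have h0 : v x i0 = 0 := (hvc i0).2.2.2.2 hx
      have h1 : v x i1 = 0 := (hvc i1).2.2.2.2 hx
      simp only [hq, h0, h1, mul_zero, sub_zero, Pi.zero_apply]
  have hdot : ∀ x ∈ Ω, dotR (uA n a x) (v x) = -(normSq (v x) / 2) := fun x hx => by
    have h1 := hw.2 x (subset_closure hx)
    rw [hwv, normSq_add, normSq_uA hn] at h1
    linarith
  have hgrad : ∀ x ∈ Ω, gradSq w x = gradSq (uA n a) x + (2 * a) * pd 0 q x +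
      1 * ∑ k, (gradSqS (fun y => v y k) x - a ^ 2 * v x k ^ 2) := by
    intro x hx
    have hd0 := (hvc i0).h1c.differentiableAt hΩ hx
    have hd1 := (hvc i1).h1c.differentiableAt hΩ hx
    have hdC := hC.differentiableAt hΩ hx
    have hdS := hS.differentiableAt hΩ hx
    have hpdC : ∀ i : Fin 2, pd i (fun y => Real.cos (a * y 0)) x =
        -Real.sin (a * x 0) * if i = 0 then a else 0 := fun i => by
      rw [pd_comp (Real.hasDerivAt_cos _) (differentiableAt_phase a x), pd_phase]
    have hpdS : ∀ i : Fin 2, pd i (fun y => Real.sin (a * y 0)) x =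
        Real.cos (a * x 0) * if i = 0 then a else 0 := fun i => by
      rw [pd_comp (Real.hasDerivAt_sin _) (differentiableAt_phase a x), pd_phase]
    have h1 : gradSq w x = gradSq (uA n a) x + 2 * gradDot (uA n a) v x + gradSq v x := by
      conv_lhs => rw [hwv]
      exact gradSq_add (fun k => (huc k).differentiableAt hΩ hx)
        (fun k => (hvc k).h1c.differentiableAt hΩ hx)
    have h2 : gradDot (uA n a) v x =
        a * (Real.cos (a * x 0) * pd 0 (fun y => v y i1) x -
          Real.sin (a * x 0) * pd 0 (fun y => v y i0) x) := by
      rw [gradDot_eq_sum (differentiableAt_of_components hΩ huc hx)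
        (differentiableAt_of_components hΩ (fun k => (hvc k).h1c) hx),
        sum_eq_of_two_le hn fun j hj => by
          simp only [uA_of_two_le hj, gradDotS_eq_sum_pd, pd_const, zero_mul,
            Finset.sum_const_zero]]
      simp only [uA_zero hn, uA_one hn, gradDotS_eq_sum_pd, Fin.sum_univ_two, hpdC, hpdS]
      simp [hi0, hi1]
      ring
    have h3 : pd 0 q x = Real.cos (a * x 0) * pd 0 (fun y => v y i1) x -
          Real.sin (a * x 0) * pd 0 (fun y => v y i0) x -
          a * (Real.cos (a * x 0) * v x i0 + Real.sin (a * x 0) * v x i1) := by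
      simp only [hq]
      rw [pd_sub (hdC.fun_mul hd1) (hdS.fun_mul hd0), pd_mul hdC hd1, pd_mul hdS hd0, hpdC, hpdS]
      simp
      ring
    have h4 : Real.cos (a * x 0) * v x i0 + Real.sin (a * x 0) * v x i1 =
        -(normSq (v x) / 2) := by
      rw [← hdot x hx, dotR, sum_eq_of_two_le hn fun j hj => by rw [uA_of_two_le hj, zero_mul]]
      rfl
    rw [h1, h2, h3, h4, gradSq_eq_sum (differentiableAt_of_components hΩ
      (fun k => (hvc k).h1c) hx), Finset.sum_sub_distrib, ← Finset.mul_sum]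
    simp only [normSq]
    ring
  have hisub : ∀ k, IntegrableOn (fun x => gradSqS (fun y => v y k) x - a ^ 2 * v x k ^ 2) Ω :=
    fun k => (hvc k).2.2.1.sub ((hvc k).2.2.2.1.const_mul _)
  have hE : ∫ x in Ω, gradSq w x = (∫ x in Ω, gradSq (uA n a) x) +
      ∑ k, ∫ x in Ω, (gradSqS (fun y => v y k) x - a ^ 2 * v x k ^ 2) := by
    rw [setIntegral_congr_fun hΩ.measurableSet hgrad,
      integral_add_mul_add_mul (integrableOn_gradSq (u := uA n a) hΩ huc)
        (integrableOn_pd hΩ hb hqH.h1c 0) (integrable_finsetSum _ fun k _ => hisub k),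
      integral_pd_eq_zero hΩ hb hqH 0, integral_finsetSum _ fun k _ => hisub k]
    ring
  have hnn := Finset.sum_nonneg fun k (_ : k ∈ Finset.univ) =>
    sub_integral_nonneg_of_poincare hle hlam (hvc k)
  simp only [DirEnergy, integral_div]
  linarith

end Explicit

section Reflection

variable {n : ℕ}

theorem dotR_sub_mul (y z c : Fin n → ℝ) (s t : ℝ) :
    dotR (fun k => y k - s * c k) (fun k => z k - t * c k) =
      dotR y z - t * dotR y c - s * dotR z c + s * t * normSq c := by
  simp only [dotR, normSq, Finset.mul_sum, ← Finset.sum_sub_distrib, ← Finset.sum_add_distrib]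
  exact Finset.sum_congr rfl fun k _ => by ring

theorem dotR_add_left (y z c : Fin n → ℝ) : dotR (y + z) c = dotR y c + dotR z c := by
  simp only [dotR, Pi.add_apply, add_mul, Finset.sum_add_distrib]

theorem dotR_smul_left (t : ℝ) (y c : Fin n → ℝ) : dotR (t • y) c = t * dotR y c := by
  simp only [dotR, Pi.smul_apply, smul_eq_mul, mul_assoc, Finset.mul_sum]

theorem dotR_sub_mul_left (y c : Fin n → ℝ) (s : ℝ) :
    dotR (fun k => y k - s * c k) c = dotR y c - s * normSq c := by
  simp only [dotR, normSq, Finset.mul_sum, ← Finset.sum_sub_distrib]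
  exact Finset.sum_congr rfl fun k _ => by ring

theorem eq_zero_of_normSq_eq_zero {c : Fin n → ℝ} (h : normSq c = 0) (k : Fin n) : c k = 0 :=
  pow_eq_zero_iff two_ne_zero |>.1
    ((Finset.sum_eq_zero_iff_of_nonneg fun _ _ => sq_nonneg _).1 h k (Finset.mem_univ k))

/-- Reflection in the hyperplane orthogonal to `c` (the identity if `c = 0`). -/
def reflect (c : Fin n → ℝ) : (Fin n → ℝ) →ₗ[ℝ] (Fin n → ℝ) where
  toFun y := fun k => y k - 2 * dotR y c / normSq c * c k
  map_add' y z := by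
    ext k
    simp only [dotR_add_left, Pi.add_apply]
    ring
  map_smul' t y := by
    ext k
    simp only [dotR_smul_left, Pi.smul_apply, smul_eq_mul, RingHom.id_apply]
    ring

theorem reflect_apply (c y : Fin n → ℝ) :
    reflect c y = fun k => y k - 2 * dotR y c / normSq c * c k := rfl

theorem isOrth_reflect (c : Fin n → ℝ) : IsOrth (reflect c) := by
  refine ⟨Function.Involutive.bijective fun y => ?_, fun y z => ?_⟩
  · ext k
    rw [reflect_apply, reflect_apply, dotR_sub_mul_left]
    by_cases h : normSq c = 0
    · simp [h]
    · field_simp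
      ring
  · rw [reflect_apply, reflect_apply, dotR_sub_mul]
    by_cases h : normSq c = 0
    · simp [h]
    · field_simp
      ring

end Reflection

section Main

variable {n : ℕ} {a lam : ℝ} {Ω : Set (Fin 2 → ℝ)} {u v w : (Fin 2 → ℝ) → Fin n → ℝ}

theorem uA_congr {x y : Fin 2 → ℝ} (h : x 0 = y 0) : uA n a x = uA n a y :=
  funext fun j => by simp only [uA, h]

theorem IsMinHarm.apply_frontier_eq_zero (hu : IsMinHarm Ω (uA n a) u) {j : Fin n}
    (hj : 2 ≤ (j : ℕ)) : ∀ x ∈ frontier Ω, u x j = 0 := fun x hx => by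
  rw [hu.1.1.2.2.2.2 hx, uA_of_two_le hj]

/-- A minimiser that is not horizontal has a vertical component without zeros. -/
theorem IsMinHarm.exists_component_ne_zero (hu : IsMinHarm Ω (uA n a) u) (hΩ : IsOpen Ω)
    (hc : IsPreconnected Ω) (hb : IsBounded Ω) (hx : ∃ x ∈ Ω, u x ∉ horizontal n) :
    ∃ j : Fin n, 2 ≤ (j : ℕ) ∧ ∀ x ∈ Ω, u x j ≠ 0 := by
  obtain ⟨x, hx, hxh⟩ := hx
  simp only [horizontal, mem_ofPred_eq] at hxh
  push Not at hxh
  obtain ⟨j, hj, hxj⟩ := hxh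
  refine ⟨j, hj, ?_⟩
  rcases hu.component_eq_zero_or_ne_zero hΩ hc hb (hu.apply_frontier_eq_zero hj) with h | h
  · exact absurd (h x hx) hxj
  · exact h

theorem IsMinHarm.eqOn_uA (hw : IsMinHarm Ω (uA n a) w) (hn : 2 ≤ n) (hΩ : IsOpen Ω)
    (hc : IsPreconnected Ω) (hb : IsBounded Ω) (hsc : SimplyConnectedSpace Ω)
    (hua : IsMinHarm Ω (uA n a) (uA n a)) : EqOn w (uA n a) (closure Ω) := by
  by_cases hhor : ∀ x ∈ Ω, w x ∈ horizontal n
  · exact (integral_gradSq_of_horizontal hn hΩ hc hb hsc hw.1 hhor).2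
      (hw.integral_gradSq_le_sAdmissible hua.1)
  · push Not at hhor
    exfalso
    obtain ⟨x, hx, -⟩ := id hhor
    obtain ⟨j, hj, hne⟩ := hw.exists_component_ne_zero hΩ hc hb hhor
    have hj0 := hw.apply_frontier_eq_zero hj
    obtain ⟨c, hcw⟩ := hw.exists_eq_add_mul hua hΩ hc hb hj0 hne
    have hrel := dotR_relation_of_eq_add_mul hΩ hw.1 hua.1 hne hcw
    have hdot : ∀ x ∈ closure Ω, 2 * dotR (uA n a x) c = w x j * normSq c := fun x hx => by
      have h1 : uA n a x = fun k => w x k - (-w x j) * c k := funext fun k => by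
        rw [hcw x hx k]; ring
      rw [h1, dotR_sub_mul_left]
      linarith [hrel x hx]
    obtain ⟨y, hy, hyx⟩ := exists_mem_frontier_apply_zero_eq hΩ hb hx
    have h1 := hdot x (subset_closure hx)
    have h2 := hdot y (frontier_subset_closure hy)
    rw [uA_congr hyx, hj0 y hy, zero_mul] at h2
    rw [h2] at h1
    have h3 := eq_zero_of_normSq_eq_zero ((mul_eq_zero.1 h1.symm).resolve_left (hne x hx)) j
    have h4 := hcw x (subset_closure hx) j
    rw [uA_of_two_le hj, h3, mul_zero, add_zero] at h4
    exact hne x hx h4.symm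

theorem exists_h10S_quadratic_neg (hlam : IsFirstEigenvalue Ω lam) (hlt : lam < a ^ 2) :
    ∃ φ, H10S Ω φ ∧ ∫ x in Ω, (gradSqS φ x - a ^ 2 * φ x ^ 2) < 0 := by
  by_contra! h
  refine hlt.not_ge (hlam.2 (a ^ 2) fun φ hφ => ?_)
  have := h φ hφ
  rw [integral_sub hφ.2.2.1 (hφ.2.2.2.1.const_mul _), integral_const_mul] at this
  linarith

/-- Perturbing `u_a` in a vertical direction lowers the minimal energy. -/
theorem IsMinHarm.integral_gradSq_lt (hu : IsMinHarm Ω (uA n a) u) (hn : 3 ≤ n) (hΩ : IsOpen Ω)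
    (hb : IsBounded Ω) {φ : (Fin 2 → ℝ) → ℝ} (hφ : H10S Ω φ)
    (hQ : ∫ x in Ω, (gradSqS φ x - a ^ 2 * φ x ^ 2) < 0) :
    ∫ x in Ω, gradSq u x < ∫ x in Ω, gradSq (uA n a) x := by
  set j : Fin n := ⟨2, by lia⟩ with hj
  have hj2 : 2 ≤ (j : ℕ) := le_rfl
  have huc : ∀ k, H1C Ω (fun x => uA n a x k) := fun k => h1c_uA hb k
  set Q := ∫ x in Ω, (gradSqS φ x - a ^ 2 * φ x ^ 2) with hQdef
  set K := ∫ x in Ω, a ^ 2 * φ x ^ 4 with hK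
  have hK0 : 0 ≤ K := integral_nonneg fun x => by positivity
  set s := -Q / (K + 1) with hs
  have hs0 : 0 < s := div_pos (by linarith) (by linarith)
  have hsK : s * K < -Q := by
    rw [hs, div_mul_eq_mul_div, div_lt_iff₀ (by linarith)]
    nlinarith
  set t := Real.sqrt s with ht
  have hts : t ^ 2 = s := Real.sq_sqrt hs0.le
  have hφt := hφ.h1c.const_mul hΩ hb t
  have hiQ : IntegrableOn (fun x => gradSqS φ x - a ^ 2 * φ x ^ 2) Ω :=
    hφ.2.2.1.sub (hφ.2.2.2.1.const_mul _)
  have hiK : IntegrableOn (fun x => a ^ 2 * φ x ^ 4) Ω :=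
    integrableOn_of_continuousOn_closure hb (continuousOn_const.mul (hφ.2.1.pow 4))
  have hia := integrableOn_gradSq (u := uA n a) hΩ huc
  have hN : ∀ x, normSq (Function.update (uA n a x) j (t * φ x)) = 1 + s * φ x ^ 2 := fun x => by
    rw [normSq_update, normSq_uA (by lia), uA_of_two_le hj2, mul_pow, hts]
    ring
  have hle := hu.integral_gradSq_le hΩ hb (W := fun x => Function.update (uA n a x) j (t * φ x))
    (fun k => H1C.update huc hφt j k) (fun x _ => by rw [hN]; positivity)
    (fun x hx => by
      have h0 : φ x = 0 := hφ.2.2.2.2 hx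
      simp only [h0, mul_zero, hu.1.1.2.2.2.2 hx]
      rw [Function.update_eq_self_iff, uA_of_two_le hj2])
    (G := fun x => gradSq (uA n a) x + s * (gradSqS φ x - a ^ 2 * φ x ^ 2) +
      s ^ 2 * (a ^ 2 * φ x ^ 4)) ((hia.add (hiQ.const_mul s)).add (hiK.const_mul _))
    (fun x hx => by
      rw [gradSq_update hΩ huc hφt j hx, hN, gradSq_uA (by lia),
        gradSqS_const_mul t (hφ.h1c.differentiableAt hΩ hx), hts]
      simp only [uA_of_two_le hj2, gradSqS_zero]
      have h1 := mul_nonneg (mul_nonneg (sq_nonneg s) (sq_nonneg (φ x))) (gradSqS_nonneg φ x)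
      have h2 : 0 ≤ s ^ 3 * a ^ 2 * φ x ^ 6 := by positivity
      linarith)
  rw [integral_add_mul_add_mul hia hiQ hiK] at hle
  nlinarith

theorem IsMinHarm.exists_notMem_horizontal (hu : IsMinHarm Ω (uA n a) u) (hn : 3 ≤ n)
    (hΩ : IsOpen Ω) (hc : IsPreconnected Ω) (hb : IsBounded Ω) (hsc : SimplyConnectedSpace Ω)
    (hlam : IsFirstEigenvalue Ω lam) (hlt : lam < a ^ 2) : ∃ x ∈ Ω, u x ∉ horizontal n := by
  obtain ⟨φ, hφ, hQ⟩ := exists_h10S_quadratic_neg hlam hlt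
  by_contra! hhor
  exact (hu.integral_gradSq_lt hn hΩ hb hφ hQ).not_ge
    (integral_gradSq_of_horizontal (by lia) hΩ hc hb hsc hu.1 hhor).1

theorem eq_zero_of_cos_add_sin (hΩ : IsOpen Ω) {x : Fin 2 → ℝ} (hx : x ∈ Ω) (ha : a ≠ 0)
    {c d : ℝ} (h : ∀ y ∈ Ω, c * Real.cos (a * y 0) + d * Real.sin (a * y 0) = 0) :
    c = 0 ∧ d = 0 := by
  have hd := differentiableAt_phase a x
  have hpd : pd 0 (fun y => c * Real.cos (a * y 0) + d * Real.sin (a * y 0)) x = 0 := by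
    rw [pd_congr hΩ h hx (g := fun _ => 0), pd_const]
  rw [pd_add (hd.cos.const_mul c) (hd.sin.const_mul d), pd_const_mul c hd.cos,
    pd_const_mul d hd.sin, pd_comp (Real.hasDerivAt_cos _) hd, pd_comp (Real.hasDerivAt_sin _) hd,
    pd_phase, if_pos rfl] at hpd
  have h1 := h x hx
  have h2 : d * Real.cos (a * x 0) - c * Real.sin (a * x 0) = 0 :=
    mul_left_cancel₀ ha (by linear_combination hpd)
  have h3 := Real.sin_sq_add_cos_sq (a * x 0)
  constructor
  · linear_combination Real.cos (a * x 0) * h1 - Real.sin (a * x 0) * h2 - c * h3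
  · linear_combination Real.sin (a * x 0) * h1 + Real.cos (a * x 0) * h2 - d * h3

theorem IsMinHarm.exists_orth (hu : IsMinHarm Ω (uA n a) u) (hv : IsMinHarm Ω (uA n a) v)
    (hn : 2 ≤ n) (hΩ : IsOpen Ω) (hc : IsPreconnected Ω) (hb : IsBounded Ω) (ha : a ≠ 0)
    (hhor : ∃ x ∈ Ω, u x ∉ horizontal n) :
    ∃ R : (Fin n → ℝ) →ₗ[ℝ] (Fin n → ℝ), IsOrth R ∧
      (∀ y ∈ horizontal n, R y = y) ∧ EqOn v (fun x => R (u x)) (closure Ω) := by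
  obtain ⟨p, hp, -⟩ := id hhor
  obtain ⟨j, hj, hne⟩ := hu.exists_component_ne_zero hΩ hc hb hhor
  have hj0 := hu.apply_frontier_eq_zero hj
  obtain ⟨c, hcv⟩ := hu.exists_eq_add_mul hv hΩ hc hb hj0 hne
  have hrel := dotR_relation_of_eq_add_mul hΩ hu.1 hv.1 hne hcv
  obtain ⟨hc0, hc1⟩ := eq_zero_of_cos_add_sin (c := c ⟨0, by lia⟩) (d := c ⟨1, by lia⟩) hΩ hp ha
    fun x hx => by
      obtain ⟨y, hy, hyx⟩ := exists_mem_frontier_apply_zero_eq hΩ hb hx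
      have h1 := hrel y (frontier_subset_closure hy)
      rw [hj0 y hy, hu.1.1.2.2.2.2 hy, uA_congr hyx, dotR, sum_eq_of_two_le hn fun k hk => by
        rw [uA_of_two_le hk, zero_mul], uA_zero hn, uA_one hn] at h1
      linarith
  refine ⟨reflect c, isOrth_reflect c, fun y hy => ?_, fun x hx => ?_⟩
  · have h0 : dotR y c = 0 := by
      rw [dotR, sum_eq_of_two_le hn fun k hk => by rw [hy k hk, zero_mul], hc0, hc1]
      ring
    rw [reflect_apply, h0]
    simp
  · ext k
    simp only [reflect_apply]
    rw [hcv x hx k]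
    by_cases h : normSq c = 0
    · rw [eq_zero_of_normSq_eq_zero h k]
      ring
    · have h1 : 2 * dotR (u x) c = -(u x j * normSq c) := by linarith [hrel x hx]
      rw [h1]
      field_simp
      ring

end Main

/-- Proposition A.1: non-escaping/uniqueness for `a² ≤ λ₁(Ω)` and
escaping/non-uniqueness (with instability of `u_a`) for `a² > λ₁(Ω)`. -/
theorem statement_15 {n : ℕ} (hn : 3 ≤ n)
    (Ω : Set (Fin 2 → ℝ)) (hΩo : IsOpen Ω) (hΩc : IsConnected Ω) (hΩb : IsBounded Ω)
    (hΩsc : SimplyConnectedSpace Ω)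
    (a lam : ℝ) (hlam : IsFirstEigenvalue Ω lam) :
    (a ^ 2 ≤ lam →
      IsMinHarm Ω (uA n a) (uA n a) ∧
      ∀ w, IsMinHarm Ω (uA n a) w → EqOn w (uA n a) (closure Ω)) ∧
    (lam < a ^ 2 →
      (∀ u, IsMinHarm Ω (uA n a) u → ∃ x ∈ Ω, u x ∉ horizontal n) ∧
      (∀ u v, IsMinHarm Ω (uA n a) u → IsMinHarm Ω (uA n a) v →
        ∃ R : (Fin n → ℝ) →ₗ[ℝ] (Fin n → ℝ), IsOrth R ∧
          (∀ y ∈ horizontal n, R y = y) ∧ EqOn v (fun x => R (u x)) (closure Ω)) ∧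
      (∃ φ : (Fin 2 → ℝ) → ℝ, H10S Ω φ ∧
        (∫ x in Ω, (gradSqS φ x - gradSq (uA n a) x * φ x ^ 2)) < 0)) := by
  have hc := hΩc.isPreconnected
  refine ⟨fun hle => ?_, fun hlt => ?_⟩
  · have hua := isMinHarm_uA (n := n) (by lia) hΩo hΩb hle hlam
    exact ⟨hua, fun w hw => hw.eqOn_uA (by lia) hΩo hc hΩb hΩsc hua⟩
  · have hesc : ∀ u, IsMinHarm Ω (uA n a) u → ∃ x ∈ Ω, u x ∉ horizontal n := fun u hu =>
      hu.exists_notMem_horizontal hn hΩo hc hΩb hΩsc hlam hlt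
    have hlam0 : 0 ≤ lam := hlam.2 0 fun φ _ => by
      rw [zero_mul]
      exact integral_nonneg fun x => gradSqS_nonneg φ x
    have ha : a ≠ 0 := fun h => by
      rw [h] at hlt
      norm_num at hlt
      linarith
    refine ⟨hesc, fun u v hu hv => hu.exists_orth hv (by lia) hΩo hc hΩb ha (hesc u hu), ?_⟩
    obtain ⟨φ, hφ, hQ⟩ := exists_h10S_quadratic_neg hlam hlt
    refine ⟨φ, hφ, ?_⟩
    simpa only [gradSq_uA (show 2 ≤ n by lia)] using hQ
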